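/- (Johansson–Kahn–Vu theorem) For every strictly 1-balanced graph H, the function (log n)^{1/e(H)} / n^{1/m_1(H)} is a threshold for the property that G(n,p) contains an H-factor: if p·n^{1/m_1(H)}/(log n)^{1/e(H)} → 0 then a.a.s. G(n,p) contains no H-factor, while if p·n^{1/m_1(H)}/(log n)^{1/e(H)} → ∞ then a.a.s. G(n,p) contains an H-factor. -/

import Mathlib

open MeasureTheory Filter Topology

/-- Bernoulli measure on `Bool` with success probability `p` (clamped to `[0,1]`). -/
noncomputable def bernoulliMeasure (p : ℝ) : Measure Bool :=
  (min (ENNReal.ofReal p) 1) • Measure.dirac true +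
    (1 - min (ENNReal.ofReal p) 1) • Measure.dirac false

/-- The distribution of the binomial random graph `G(n,p)`, as a product of independent
Bernoulli measures, one for each potential edge. -/
noncomputable def gnp (n : ℕ) (p : ℝ) : Measure (Sym2 (Fin n) → Bool) :=
  Measure.pi fun _ => bernoulliMeasure p

/-- The simple graph on `[n]` determined by an outcome of the edge indicators. -/
def graphOf {n : ℕ} (ω : Sym2 (Fin n) → Bool) : SimpleGraph (Fin n) :=
  SimpleGraph.fromRel fun u v => ω s(u, v) = true

/-- `G` contains a (not necessarily induced) copy of `H`. -/
def ContainsCopy {α β : Type*} (H : SimpleGraph α) (G : SimpleGraph β) : Prop :=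
  ∃ f : α → β, Function.Injective f ∧ ∀ ⦃u v⦄, H.Adj u v → G.Adj (f u) (f v)

/-- The maximum degree of a graph on a finite vertex type. -/
noncomputable def maxDeg {V : Type*} [Fintype V] (G : SimpleGraph V) : ℕ :=
  Finset.univ.sup fun v => (G.neighborSet v).ncard

/-- The maximum 0-density `m₀(H)`. -/
noncomputable def m0 {V : Type*} [Fintype V] (H : SimpleGraph V) : ℝ :=
  sSup {x : ℝ | ∃ H' : H.Subgraph, H'.verts.Nonempty ∧
    x = (H'.edgeSet.ncard : ℝ) / (H'.verts.ncard : ℝ)}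

/-- The maximum 1-density `m₁(H)`. -/
noncomputable def m1 {V : Type*} [Fintype V] (H : SimpleGraph V) : ℝ :=
  sSup {x : ℝ | ∃ H' : H.Subgraph, 1 < H'.verts.ncard ∧
    x = (H'.edgeSet.ncard : ℝ) / ((H'.verts.ncard : ℝ) - 1)}

/-- The maximum 2-density `m₂(H)`. -/
noncomputable def m2 {V : Type*} [Fintype V] (H : SimpleGraph V) : ℝ :=
  sSup {x : ℝ | ∃ H' : H.Subgraph, 0 < H'.edgeSet.ncard ∧
    x = if 2 < H'.verts.ncard
      then ((H'.edgeSet.ncard : ℝ) - 1) / ((H'.verts.ncard : ℝ) - 2)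
      else 1 / 2}

/-- The maximum Riordan-density `m_R(H)`. -/
noncomputable def mR {V : Type*} [Fintype V] (H : SimpleGraph V) : ℝ :=
  sSup {x : ℝ | ∃ H' : H.Subgraph, 2 < H'.verts.ncard ∧
    x = (H'.edgeSet.ncard : ℝ) / ((H'.verts.ncard : ℝ) - 2)}

/-- The local 1-density `m₁(x,H)` of `H` at the vertex `x`. -/
noncomputable def m1At {V : Type*} [Fintype V] (H : SimpleGraph V) (x : V) : ℝ :=
  sSup {r : ℝ | ∃ H' : H.Subgraph, x ∈ H'.verts ∧ 1 < H'.verts.ncard ∧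
    r = (H'.edgeSet.ncard : ℝ) / ((H'.verts.ncard : ℝ) - 1)}

/-- `H` is strictly 1-balanced: `H` itself is the unique maximiser of the 1-density. -/
def StrictlyOneBalanced {V : Type*} [Fintype V] (H : SimpleGraph V) : Prop :=
  ∀ H' : H.Subgraph, 1 < H'.verts.ncard → H' ≠ ⊤ →
    (H'.edgeSet.ncard : ℝ) / ((H'.verts.ncard : ℝ) - 1) <
      (H.edgeSet.ncard : ℝ) / ((Fintype.card V : ℝ) - 1)

/-- `H` is vertex-1-balanced: the local 1-density at every vertex equals `m₁(H)`. -/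
def VertexOneBalanced {V : Type*} [Fintype V] (H : SimpleGraph V) : Prop :=
  ∀ x : V, m1At H x = m1 H

/-- `G` (an `n`-vertex graph) contains an `H`-factor: `⌊n / v(H)⌋` pairwise vertex-disjoint
copies of `H`. -/
def HasFactor {V : Type*} [Fintype V] (H : SimpleGraph V) {n : ℕ}
    (G : SimpleGraph (Fin n)) : Prop :=
  ∃ f : Fin (n / Fintype.card V) × V → Fin n, Function.Injective f ∧
    ∀ (i : Fin (n / Fintype.card V)) ⦃u v : V⦄, H.Adj u v → G.Adj (f (i, u)) (f (i, v))


section ExLib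
open Finset
open scoped Classical

/-- Real-valued indicator of a proposition. -/
noncomputable def ind (P : Prop) : ℝ := if P then 1 else 0

lemma ind_nonneg (P : Prop) : 0 ≤ ind P := by unfold ind; split_ifs <;> norm_num
lemma ind_le_one (P : Prop) : ind P ≤ 1 := by unfold ind; split_ifs <;> norm_num
lemma ind_true {P : Prop} (h : P) : ind P = 1 := by simp [ind, h]
lemma ind_false {P : Prop} (h : ¬ P) : ind P = 0 := by simp [ind, h]
lemma ind_mono {P Q : Prop} (h : P → Q) : ind P ≤ ind Q := by
  by_cases hP : P
  · rw [ind_true hP, ind_true (h hP)]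
  · rw [ind_false hP]; exact ind_nonneg _
lemma ind_congr {P Q : Prop} (h : P ↔ Q) : ind P = ind Q := by
  simp [ind, h]
lemma ind_and (P Q : Prop) : ind (P ∧ Q) = ind P * ind Q := by
  by_cases hP : P <;> by_cases hQ : Q <;> simp [ind, hP, hQ]
lemma ind_or_le (P Q : Prop) : ind (P ∨ Q) ≤ ind P + ind Q := by
  by_cases hP : P <;> by_cases hQ : Q <;> simp [ind, hP, hQ]
lemma ind_not (P : Prop) : ind (¬ P) = 1 - ind P := by
  by_cases hP : P <;> simp [ind, hP]
lemma ind_exists_le {β : Type*} (s : Finset β) (P : β → Prop) :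
    ind (∃ b ∈ s, P b) ≤ ∑ b ∈ s, ind (P b) := by
  by_cases h : ∃ b ∈ s, P b
  · obtain ⟨b, hb, hP⟩ := h
    calc ind (∃ b ∈ s, P b) ≤ 1 := ind_le_one _
      _ = ind (P b) := (ind_true hP).symm
      _ ≤ _ := Finset.single_le_sum (f := fun b => ind (P b)) (fun i _ => ind_nonneg _) hb
  · rw [ind_false h]; exact Finset.sum_nonneg fun i _ => ind_nonneg _

variable {α : Type*} [DecidableEq α]

/-- Expectation of `f` over a random subset of `s` with density `p`. -/
noncomputable def Ex (s : Finset α) (p : ℝ) (f : Finset α → ℝ) : ℝ :=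
  ∑ A ∈ s.powerset, p ^ #A * (1 - p) ^ #(s \ A) * f A

lemma Ex_empty (p : ℝ) (f : Finset α → ℝ) : Ex ∅ p f = f ∅ := by
  simp [Ex]

lemma Ex_insert {s : Finset α} {a : α} (ha : a ∉ s) (p : ℝ) (f : Finset α → ℝ) :
    Ex (insert a s) p f = p * Ex s p (fun A => f (insert a A)) + (1 - p) * Ex s p f := by
  unfold Ex
  rw [Finset.sum_powerset_insert ha, add_comm, Finset.mul_sum, Finset.mul_sum]
  congr 1
  · apply Finset.sum_congr rfl
    intro t ht
    have hat : a ∉ t := fun h => ha (Finset.mem_powerset.1 ht h)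
    have h1 : insert a s \ insert a t = s \ t := by
      ext x; simp only [Finset.mem_sdiff, Finset.mem_insert]
      constructor
      · rintro ⟨h1, h2⟩; push Not at h2; exact ⟨h1.resolve_left h2.1, h2.2⟩
      · rintro ⟨h1, h2⟩
        exact ⟨Or.inr h1, by push Not; exact ⟨fun h => ha (h ▸ h1), h2⟩⟩
    rw [card_insert_of_notMem hat, h1]; ring
  · apply Finset.sum_congr rfl
    intro t ht
    have hat : a ∉ t := fun h => ha (Finset.mem_powerset.1 ht h)
    rw [insert_sdiff_of_notMem _ hat, card_insert_of_notMem (by simp [ha])]; ring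

lemma Ex_congr {s : Finset α} {p : ℝ} {f g : Finset α → ℝ} (h : ∀ A ⊆ s, f A = g A) :
    Ex s p f = Ex s p g := by
  unfold Ex
  exact Finset.sum_congr rfl fun A hA => by rw [h A (Finset.mem_powerset.1 hA)]

lemma Ex_mono {s : Finset α} {p : ℝ} (h0 : 0 ≤ p) (h1 : p ≤ 1) {f g : Finset α → ℝ}
    (h : ∀ A ⊆ s, f A ≤ g A) : Ex s p f ≤ Ex s p g := by
  unfold Ex
  refine Finset.sum_le_sum fun A hA => ?_
  have h2 := h A (Finset.mem_powerset.1 hA)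
  have : 0 ≤ 1 - p := by linarith
  gcongr

lemma Ex_add (s : Finset α) (p : ℝ) (f g : Finset α → ℝ) :
    Ex s p (fun A => f A + g A) = Ex s p f + Ex s p g := by
  unfold Ex; rw [← Finset.sum_add_distrib]; exact Finset.sum_congr rfl fun _ _ => by ring

lemma Ex_sub (s : Finset α) (p : ℝ) (f g : Finset α → ℝ) :
    Ex s p (fun A => f A - g A) = Ex s p f - Ex s p g := by
  unfold Ex; rw [← Finset.sum_sub_distrib]; exact Finset.sum_congr rfl fun _ _ => by ring

lemma Ex_mul (s : Finset α) (p c : ℝ) (f : Finset α → ℝ) :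
    Ex s p (fun A => c * f A) = c * Ex s p f := by
  unfold Ex; rw [Finset.mul_sum]; exact Finset.sum_congr rfl fun _ _ => by ring

lemma Ex_const (s : Finset α) (p c : ℝ) : Ex s p (fun _ => c) = c := by
  induction s using Finset.induction_on with
  | empty => rw [Ex_empty]
  | insert a s ha ih => rw [Ex_insert ha, ih]; ring

lemma Ex_sum {β : Type*} (t : Finset β) (s : Finset α) (p : ℝ) (f : β → Finset α → ℝ) :
    Ex s p (fun A => ∑ b ∈ t, f b A) = ∑ b ∈ t, Ex s p (f b) := by
  unfold Ex
  rw [Finset.sum_comm]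
  exact Finset.sum_congr rfl fun _ _ => by rw [Finset.mul_sum]

lemma Ex_nonneg {s : Finset α} {p : ℝ} (h0 : 0 ≤ p) (h1 : p ≤ 1) {f : Finset α → ℝ}
    (h : ∀ A ⊆ s, 0 ≤ f A) : 0 ≤ Ex s p f := by
  have := Ex_mono (s := s) h0 h1 (f := fun _ => 0) (g := f) h
  rwa [Ex_const] at this

lemma Ex_le_const {s : Finset α} {p : ℝ} (h0 : 0 ≤ p) (h1 : p ≤ 1) {f : Finset α → ℝ} {c : ℝ}
    (h : ∀ A ⊆ s, f A ≤ c) : Ex s p f ≤ c := by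
  have := Ex_mono (s := s) h0 h1 (f := f) (g := fun _ => c) h
  rwa [Ex_const] at this

lemma Ex_ind_not (s : Finset α) (p : ℝ) (P : Finset α → Prop) :
    Ex s p (fun A => ind (¬ P A)) = 1 - Ex s p (fun A => ind (P A)) := by
  simp_rw [ind_not]; rw [Ex_sub, Ex_const]

lemma Ex_comm {β : Type*} [DecidableEq β] (s : Finset α) (t : Finset β) (p q : ℝ)
    (f : Finset α → Finset β → ℝ) :
    Ex s p (fun A => Ex t q (fun B => f A B)) = Ex t q (fun B => Ex s p (fun A => f A B)) := by
  unfold Ex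
  simp_rw [Finset.mul_sum]
  rw [Finset.sum_comm]
  exact Finset.sum_congr rfl fun _ _ => Finset.sum_congr rfl fun _ _ => by ring

lemma Ex_union (s : Finset α) (p q : ℝ) (f : Finset α → ℝ) :
    Ex s p (fun A => Ex s q (fun B => f (A ∪ B))) = Ex s (p + q - p * q) f := by
  induction s using Finset.induction_on generalizing f with
  | empty => simp [Ex_empty]
  | insert a s ha ih =>
    simp only [Ex_insert ha, Finset.insert_union, Finset.union_insert, Finset.insert_idem,
      Ex_add, Ex_mul]
    have h1 := ih (fun A => f (insert a A))
    have h2 := ih f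
    rw [h1, h2]; ring

lemma Ex_inter (s : Finset α) (p q : ℝ) (f : Finset α → ℝ) :
    Ex s p (fun A => Ex s q (fun B => f (A ∩ B))) = Ex s (p * q) f := by
  induction s using Finset.induction_on generalizing f with
  | empty => simp [Ex_empty]
  | insert a s ha ih =>
    have e1 : ∀ A ⊆ s, Ex (insert a s) q (fun B => f (insert a A ∩ B)) =
        q * Ex s q (fun B => f (insert a (A ∩ B))) + (1 - q) * Ex s q (fun B => f (A ∩ B)) := by
      intro A hA
      rw [Ex_insert ha]
      congr 2
      · exact Ex_congr fun B hB => by rw [← Finset.insert_inter_distrib]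
      · exact Ex_congr fun B hB => by
          rw [Finset.insert_inter_of_notMem (fun h => ha (hB h))]
    have e2 : ∀ A ⊆ s, Ex (insert a s) q (fun B => f (A ∩ B)) = Ex s q (fun B => f (A ∩ B)) := by
      intro A hA
      rw [Ex_insert ha]
      have : Ex s q (fun B => f (A ∩ insert a B)) = Ex s q (fun B => f (A ∩ B)) :=
        Ex_congr fun B hB => by rw [Finset.inter_insert_of_notMem (fun h => ha (hA h))]
      rw [this]; ring
    rw [Ex_insert ha, Ex_congr e1, Ex_congr e2, Ex_add, Ex_mul, Ex_mul]
    have h1 := ih (fun A => f (insert a A))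
    have h2 := ih f
    rw [h1, h2, Ex_insert ha]; ring

lemma Ex_disj_union {s t : Finset α} (h : Disjoint s t) (p : ℝ) (f : Finset α → ℝ) :
    Ex (s ∪ t) p f = Ex s p (fun A => Ex t p (fun B => f (A ∪ B))) := by
  induction t using Finset.induction_on generalizing f with
  | empty => simp [Ex_empty]
  | insert a t ha ih =>
    rw [Finset.disjoint_insert_right] at h
    rw [Finset.union_insert, Ex_insert (by simp [h.1, ha]), ih h.2, ih h.2]
    simp only [Ex_insert ha, Ex_add, Ex_mul, Finset.union_insert]

lemma Ex_restrict {s t : Finset α} (h : t ⊆ s) (p : ℝ) (f : Finset α → ℝ) :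
    Ex s p (fun A => f (A ∩ t)) = Ex t p f := by
  have h1 : s = t ∪ (s \ t) := by rw [Finset.union_sdiff_of_subset h]
  rw [h1, Ex_disj_union Finset.disjoint_sdiff]
  refine Ex_congr fun A hA => ?_
  rw [← Ex_const (s \ t) p (f A)]
  refine Ex_congr fun B hB => ?_
  congr 1
  ext x; simp only [Finset.mem_inter, Finset.mem_union]
  constructor
  · rintro ⟨h1 | h1, h2⟩
    · exact h1
    · exact absurd h2 (Finset.mem_sdiff.1 (hB h1)).2
  · intro hx; exact ⟨Or.inl hx, hA hx⟩

lemma Ex_map {β : Type*} [DecidableEq β] (φ : α ↪ β) (s : Finset α) (p : ℝ)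
    (f : Finset β → ℝ) : Ex (s.map φ) p f = Ex s p (fun A => f (A.map φ)) := by
  induction s using Finset.induction_on generalizing f with
  | empty => simp [Ex_empty]
  | insert a s ha ih =>
    rw [Finset.map_insert, Ex_insert (by simp [ha]), Ex_insert ha, ih, ih]
    simp only [Finset.map_insert]

lemma Ex_mono_p {s : Finset α} {p q : ℝ} (h0 : 0 ≤ p) (hpq : p ≤ q) (h1 : q ≤ 1)
    {f : Finset α → ℝ} (hf : ∀ A B, A ⊆ B → f A ≤ f B) : Ex s p f ≤ Ex s q f := by
  rcases eq_or_lt_of_le (hpq.trans h1) with h | h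
  · have : q = p := by linarith
    rw [this]
  · have hq : q = p + (q - p) / (1 - p) - p * ((q - p) / (1 - p)) := by
      have : (1 - p) ≠ 0 := by linarith
      field_simp; ring
    have hr0 : 0 ≤ (q - p) / (1 - p) := div_nonneg (by linarith) (by linarith)
    have hr1 : (q - p) / (1 - p) ≤ 1 := by rw [div_le_one (by linarith)]; linarith
    rw [hq, ← Ex_union]
    refine Ex_mono h0 h.le fun A _ => ?_
    rw [← Ex_const s ((q - p) / (1 - p)) (f A)]
    exact Ex_mono hr0 hr1 fun B _ => hf _ _ Finset.subset_union_left

/-- single coordinate splitting. -/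
lemma Ex_coord {s : Finset α} {z : α} (hz : z ∈ s) (p : ℝ) (f : Finset α → ℝ) :
    Ex s p f = p * Ex (s.erase z) p (fun A => f (insert z A)) + (1 - p) * Ex (s.erase z) p f := by
  conv_lhs => rw [← Finset.insert_erase hz]
  rw [Ex_insert (Finset.notMem_erase z s)]

lemma Ex_coord_le {s : Finset α} {z : α} (hz : z ∈ s) {p : ℝ} (h0 : 0 ≤ p) (h1 : p ≤ 1)
    {g : Finset α → ℝ} (hg : ∀ A, z ∉ A → g (insert z A) ≤ g A) :
    Ex s p (fun A => ind (z ∈ A) * g A) ≤ p * Ex s p g := by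
  rw [Ex_coord hz, Ex_coord hz p g]
  have e1 : Ex (s.erase z) p (fun A => ind (z ∈ insert z A) * g (insert z A)) =
      Ex (s.erase z) p (fun A => g (insert z A)) := Ex_congr fun A _ => by
    rw [ind_true (Finset.mem_insert_self _ _), one_mul]
  have e2 : Ex (s.erase z) p (fun A => ind (z ∈ A) * g A) = 0 := by
    rw [← Ex_const (s.erase z) p 0]
    exact Ex_congr fun A hA => by
      rw [ind_false (fun h => Finset.notMem_erase z s (hA h)), zero_mul]
  have e3 : Ex (s.erase z) p (fun A => g (insert z A)) ≤ Ex (s.erase z) p g :=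
    Ex_mono h0 h1 fun A hA => hg A (fun h => Finset.notMem_erase z s (hA h))
  rw [e1, e2]
  have : 0 ≤ 1 - p := by linarith
  nlinarith [mul_nonneg h0 this]

lemma Ex_coord_eq {s : Finset α} {z : α} (hz : z ∈ s) {p : ℝ}
    {g : Finset α → ℝ} (hg : ∀ A, z ∉ A → g (insert z A) = g A) :
    Ex s p (fun A => ind (z ∈ A) * g A) = p * Ex s p g := by
  rw [Ex_coord hz, Ex_coord hz p g]
  have e1 : Ex (s.erase z) p (fun A => ind (z ∈ insert z A) * g (insert z A)) =
      Ex (s.erase z) p (fun A => g A) := Ex_congr fun A hA => by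
    rw [ind_true (Finset.mem_insert_self _ _), one_mul,
      hg A (fun h => Finset.notMem_erase z s (hA h))]
  have e2 : Ex (s.erase z) p (fun A => ind (z ∈ A) * g A) = 0 := by
    rw [← Ex_const (s.erase z) p 0]
    exact Ex_congr fun A hA => by
      rw [ind_false (fun h => Finset.notMem_erase z s (hA h)), zero_mul]
  have e3 : Ex (s.erase z) p (fun A => g (insert z A)) = Ex (s.erase z) p g :=
    Ex_congr fun A hA => hg A (fun h => Finset.notMem_erase z s (hA h))
  rw [e1, e2, e3]; ring

lemma ind_insert_subset (z : α) (Z A : Finset α) :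
    ind (insert z Z ⊆ A) = ind (z ∈ A) * ind (Z ⊆ A) := by
  rw [← ind_and]; exact ind_congr Finset.insert_subset_iff

lemma ind_subset_insert {z : α} {Z : Finset α} (hz : z ∉ Z) (A : Finset α) :
    ind (Z ⊆ insert z A) = ind (Z ⊆ A) :=
  ind_congr (Finset.subset_insert_iff_of_notMem hz)

lemma Ex_subset_le {s Z : Finset α} (hZ : Z ⊆ s) {p : ℝ} (h0 : 0 ≤ p) (h1 : p ≤ 1)
    {g : Finset α → ℝ} (hg : ∀ z ∈ Z, ∀ A, z ∉ A → g (insert z A) ≤ g A) :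
    Ex s p (fun A => ind (Z ⊆ A) * g A) ≤ p ^ #Z * Ex s p g := by
  induction Z using Finset.induction_on with
  | empty => simp [ind]
  | insert z Z hz ih =>
    have ih' := ih (fun x hx => hZ (Finset.mem_insert_of_mem hx))
      (fun x hx => hg x (Finset.mem_insert_of_mem hx))
    rw [card_insert_of_notMem hz]
    calc Ex s p (fun A => ind (insert z Z ⊆ A) * g A)
        = Ex s p (fun A => ind (z ∈ A) * (ind (Z ⊆ A) * g A)) :=
          Ex_congr fun A _ => by rw [ind_insert_subset, mul_assoc]
      _ ≤ p * Ex s p (fun A => ind (Z ⊆ A) * g A) := by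
          refine Ex_coord_le (hZ (Finset.mem_insert_self _ _)) h0 h1 fun A hA => ?_
          rw [ind_subset_insert hz]
          exact mul_le_mul_of_nonneg_left (hg z (Finset.mem_insert_self _ _) A hA) (ind_nonneg _)
      _ ≤ p * (p ^ #Z * Ex s p g) := by gcongr
      _ = _ := by ring

lemma Ex_subset_eq {s Z : Finset α} (hZ : Z ⊆ s) {p : ℝ}
    {g : Finset α → ℝ} (hg : ∀ z ∈ Z, ∀ A, z ∉ A → g (insert z A) = g A) :
    Ex s p (fun A => ind (Z ⊆ A) * g A) = p ^ #Z * Ex s p g := by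
  induction Z using Finset.induction_on with
  | empty => simp [ind]
  | insert z Z hz ih =>
    have ih' := ih (fun x hx => hZ (Finset.mem_insert_of_mem hx))
      (fun x hx => hg x (Finset.mem_insert_of_mem hx))
    rw [card_insert_of_notMem hz]
    calc Ex s p (fun A => ind (insert z Z ⊆ A) * g A)
        = Ex s p (fun A => ind (z ∈ A) * (ind (Z ⊆ A) * g A)) :=
          Ex_congr fun A _ => by rw [ind_insert_subset, mul_assoc]
      _ = p * Ex s p (fun A => ind (Z ⊆ A) * g A) := by
          refine Ex_coord_eq (hZ (Finset.mem_insert_self _ _)) fun A hA => ?_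
          rw [ind_subset_insert hz, hg z (Finset.mem_insert_self _ _) A hA]
      _ = p * (p ^ #Z * Ex s p g) := by rw [ih']
      _ = _ := by ring

lemma Ex_subset {s Z : Finset α} (hZ : Z ⊆ s) (p : ℝ) :
    Ex s p (fun A => ind (Z ⊆ A)) = p ^ #Z := by
  have := Ex_subset_eq (s := s) hZ (p := p) (g := fun _ => 1) (fun _ _ _ _ => rfl)
  simpa [Ex_const] using this

end ExLib


section Coupling
open Finset
open scoped Classical
variable {α ι : Type*} [DecidableEq α] [DecidableEq ι]

/-- `j` is good for `W` if the weighted number of conflicting sets outside of `W` is small. -/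
def goodSet (F : ι → Finset α) (p : ℝ) (I W : Finset ι) (j : ι) : Prop :=
  ∑ i ∈ (I \ W).filter (fun i => ¬ Disjoint (F i) (F j)),
    p ^ #(F i \ (F j ∪ W.biUnion F)) ≤ 1 / 2

/-- The exploration event. -/
def evD (F : ι → Finset α) (R Ab : Finset ι) (G : Finset α) : Prop :=
  R.biUnion F ⊆ G ∧ ∀ i ∈ Ab, ¬ F i ⊆ G

lemma coupling_key {E : Finset α} {F : ι → Finset α} {p : ℝ} (h0 : 0 ≤ p) (h1 : p ≤ 1)
    (hF : ∀ i, F i ⊆ E) (R Ab : Finset ι) (j : ι)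
    (hs : ∑ i ∈ Ab.filter (fun i => ¬ Disjoint (F i) (F j)),
      p ^ #(F i \ (F j ∪ R.biUnion F)) ≤ 1 / 2) :
    p ^ #(F j) / 2 * Ex E p (fun G => ind (evD F R Ab G)) ≤
      Ex E p (fun G => ind (evD F R Ab G ∧ F j ⊆ G)) := by
  set X := R.biUnion F with hX
  set Ab1 := Ab.filter (fun i => ¬ Disjoint (F i) (F j \ X)) with hAb1
  have hZ : F j \ X ⊆ E := Finset.sdiff_subset.trans (hF j)
  set D0 : Finset α → Prop := fun G => evD F R (Ab \ Ab1) G with hD0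
  have hp0 : 0 ≤ Ex E p (fun G => ind (D0 G)) := Ex_nonneg h0 h1 fun _ _ => ind_nonneg _
  have hDD : Ex E p (fun G => ind (evD F R Ab G)) ≤ Ex E p (fun G => ind (D0 G)) :=
    Ex_mono h0 h1 fun G _ => ind_mono fun h => ⟨h.1, fun i hi => h.2 i (Finset.mem_sdiff.1 hi).1⟩
  have hdec : ∀ z, z ∉ X → ∀ A, z ∉ A → ind (D0 (insert z A)) ≤ ind (D0 A) := by
    intro z hz A _
    refine ind_mono fun h => ⟨?_, fun i hi hiA => h.2 i hi (hiA.trans (Finset.subset_insert _ _))⟩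
    exact (Finset.subset_insert_iff_of_notMem hz).1 h.1
  have t1 : Ex E p (fun G => ind (F j \ X ⊆ G) * ind (D0 G)) =
      p ^ #(F j \ X) * Ex E p (fun G => ind (D0 G)) := by
    refine Ex_subset_eq hZ fun z hz A hA => ?_
    rw [Finset.mem_sdiff] at hz
    refine ind_congr ?_
    have e1 : R.biUnion F ⊆ insert z A ↔ R.biUnion F ⊆ A :=
      Finset.subset_insert_iff_of_notMem hz.2
    simp only [hD0, evD, e1]
    refine and_congr_right fun _ => forall₂_congr fun i hi => not_congr ?_
    refine Finset.subset_insert_iff_of_notMem fun hzi => ?_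
    rw [Finset.mem_sdiff, hAb1, Finset.mem_filter] at hi
    apply hi.2
    refine ⟨hi.1, ?_⟩
    rw [Finset.not_disjoint_iff]
    exact ⟨z, hzi, Finset.mem_sdiff.2 hz⟩
  have t2 : ∀ i ∈ Ab1, Ex E p (fun G => ind ((F j ∪ F i) \ X ⊆ G) * ind (D0 G)) ≤
      p ^ #(F j \ X) * (p ^ #(F i \ (F j ∪ X)) * Ex E p (fun G => ind (D0 G))) := by
    intro i _
    have hc : #((F j ∪ F i) \ X) = #(F j \ X) + #(F i \ (F j ∪ X)) := by
      rw [← Finset.card_union_of_disjoint]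
      · congr 1; ext z; simp only [Finset.mem_sdiff, Finset.mem_union]; tauto
      · rw [Finset.disjoint_left]; intro z; simp only [Finset.mem_sdiff, Finset.mem_union]; tauto
    rw [← mul_assoc, ← pow_add, ← hc]
    exact Ex_subset_le (Finset.sdiff_subset.trans (Finset.union_subset (hF j) (hF i))) h0 h1
      fun z hz => hdec z (Finset.mem_sdiff.1 hz).2
  have t3 : Ex E p (fun G => ind (F j \ X ⊆ G) * ind (D0 G)) -
      ∑ i ∈ Ab1, Ex E p (fun G => ind ((F j ∪ F i) \ X ⊆ G) * ind (D0 G)) ≤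
      Ex E p (fun G => ind (evD F R Ab G ∧ F j ⊆ G)) := by
    rw [← Ex_sum, ← Ex_sub]
    refine Ex_mono h0 h1 fun G _ => ?_
    have hnn : 0 ≤ ∑ i ∈ Ab1, ind ((F j ∪ F i) \ X ⊆ G) * ind (D0 G) :=
      Finset.sum_nonneg fun i _ => mul_nonneg (ind_nonneg _) (ind_nonneg _)
    by_cases hA : F j \ X ⊆ G ∧ D0 G
    · rw [ind_true hA.1, ind_true hA.2]
      by_cases hB : ∃ i ∈ Ab1, F i ⊆ G
      · obtain ⟨i, hi, hiG⟩ := hB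
        have : (1:ℝ) ≤ ∑ i ∈ Ab1, ind ((F j ∪ F i) \ X ⊆ G) * 1 := by
          have h3 : ind ((F j ∪ F i) \ X ⊆ G) * 1 = 1 := by
            rw [ind_true, one_mul]
            intro z hz
            rw [Finset.mem_sdiff, Finset.mem_union] at hz
            rcases hz.1 with h | h
            · exact hA.1 (Finset.mem_sdiff.2 ⟨h, hz.2⟩)
            · exact hiG h
          refine h3.symm.le.trans ?_
          exact Finset.single_le_sum (f := fun i => ind ((F j ∪ F i) \ X ⊆ G) * 1)
            (fun i _ => mul_nonneg (ind_nonneg _) zero_le_one) hi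
        have := ind_nonneg (evD F R Ab G ∧ F j ⊆ G)
        linarith
      · push Not at hB
        rw [ind_true (P := evD F R Ab G ∧ F j ⊆ G)]
        · rw [ind_true hA.2] at hnn; linarith
        · refine ⟨⟨hA.2.1, fun i hi => ?_⟩, ?_⟩
          · by_cases h : i ∈ Ab1
            · exact hB i h
            · exact hA.2.2 i (Finset.mem_sdiff.2 ⟨hi, h⟩)
          · intro z hz
            by_cases hzX : z ∈ X
            · exact hA.2.1 hzX
            · exact hA.1 (Finset.mem_sdiff.2 ⟨hz, hzX⟩)
    · have : ind (F j \ X ⊆ G) * ind (D0 G) = 0 := by rw [← ind_and, ind_false hA]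
      have := ind_nonneg (evD F R Ab G ∧ F j ⊆ G)
      linarith
  have hsum : ∑ i ∈ Ab1, p ^ #(F i \ (F j ∪ X)) ≤ 1 / 2 := by
    refine le_trans (Finset.sum_le_sum_of_subset_of_nonneg ?_ fun _ _ _ => pow_nonneg h0 _) hs
    intro i hi
    rw [hAb1, Finset.mem_filter] at hi
    rw [Finset.mem_filter]
    refine ⟨hi.1, fun h => hi.2 (Finset.disjoint_of_subset_right Finset.sdiff_subset h)⟩
  have t4 : ∑ i ∈ Ab1, Ex E p (fun G => ind ((F j ∪ F i) \ X ⊆ G) * ind (D0 G)) ≤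
      p ^ #(F j \ X) * Ex E p (fun G => ind (D0 G)) * (1 / 2) := by
    refine (Finset.sum_le_sum t2).trans ?_
    rw [← Finset.mul_sum, ← Finset.sum_mul]
    have h5 : 0 ≤ p ^ #(F j \ X) * Ex E p (fun G => ind (D0 G)) :=
      mul_nonneg (pow_nonneg h0 _) hp0
    nlinarith
  have hpow : p ^ #(F j) ≤ p ^ #(F j \ X) :=
    pow_le_pow_of_le_one h0 h1 (Finset.card_le_card Finset.sdiff_subset)
  have hpj : 0 ≤ p ^ #(F j) := pow_nonneg h0 _
  calc p ^ #(F j) / 2 * Ex E p (fun G => ind (evD F R Ab G))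
      ≤ p ^ #(F j \ X) / 2 * Ex E p (fun G => ind (D0 G)) := by
          have h6 : 0 ≤ Ex E p (fun G => ind (evD F R Ab G)) :=
            Ex_nonneg h0 h1 fun _ _ => ind_nonneg _
          gcongr
    _ ≤ _ := by rw [t1] at t3; linarith

lemma coupling_step {E : Finset α} {F : ι → Finset α} {p q : ℝ} (h0 : 0 ≤ p) (h1 : p ≤ 1)
    (hF : ∀ i, F i ⊆ E) (I : Finset ι) (hq0 : 0 ≤ q) (hq1 : q ≤ 1)
    (hq : ∀ j ∈ I, q ≤ p ^ #(F j) / 2)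
    (U : Finset ι → Prop) (hU : ∀ A B, A ⊆ B → U A → U B) (Rem : Finset ι) :
    ∀ w R Ab : Finset ι, R ⊆ w → w ⊆ I → Ab ⊆ I → Rem ⊆ I → Disjoint Ab w → Disjoint Ab Rem →
      Disjoint w Rem →
      Ex E p (fun G => ind (evD F R Ab G)) *
        Ex Rem q (fun W => ind (U (R ∪ W.filter (goodSet F p I (w ∪ W))))) ≤
      Ex E p (fun G => ind (U (I.filter fun j => F j ⊆ G) ∧ evD F R Ab G)) := by
  induction Rem using Finset.induction_on with
  | empty =>
    intro w R Ab hRw hwI _ _ _ _ _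
    rw [Ex_empty]
    simp only [Finset.filter_empty, Finset.union_empty]
    rw [mul_comm, ← Ex_mul]
    refine Ex_mono h0 h1 fun G _ => ?_
    rw [← ind_and]
    refine ind_mono fun h => ⟨hU _ _ ?_ h.1, h.2⟩
    intro i hi
    rw [Finset.mem_filter]
    exact ⟨hwI (hRw hi), (Finset.subset_biUnion_of_mem F hi).trans h.2.1⟩
  | insert j Rem hj ih =>
    intro w R Ab hRw hwI hAI hRI hdw hdR hwR
    have hjI : j ∈ I := hRI (Finset.mem_insert_self _ _)
    have hRI' : Rem ⊆ I := fun x hx => hRI (Finset.mem_insert_of_mem hx)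
    rw [Finset.disjoint_insert_right] at hdR hwR
    have hw'I : insert j w ⊆ I := Finset.insert_subset hjI hwI
    have hd1 : Disjoint Ab (insert j w) := by
      rw [Finset.disjoint_insert_right]; exact ⟨hdR.1, hdw⟩
    have hd2 : Disjoint (insert j w) Rem := by
      rw [Finset.disjoint_insert_left]; exact ⟨hj, hwR.2⟩
    rw [Ex_insert hj]
    set d := Ex E p (fun G => ind (evD F R Ab G)) with hd
    set u := Ex E p (fun G => ind (U (I.filter fun j => F j ⊆ G) ∧ evD F R Ab G)) with hu
    set g0 := Ex Rem q (fun W => ind (U (R ∪ W.filter (goodSet F p I (w ∪ W))))) with hg0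
    have hd0 : 0 ≤ d := Ex_nonneg h0 h1 fun _ _ => ind_nonneg _
    have hu0 : d * g0 ≤ u := ih w R Ab hRw hwI hAI hRI' hdw hdR.2 hwR.2
    by_cases hok : ∑ i ∈ Ab.filter (fun i => ¬ Disjoint (F i) (F j)),
      p ^ #(F i \ (F j ∪ R.biUnion F)) ≤ 1 / 2
    · have hx := coupling_key h0 h1 hF R Ab j hok
      set x := Ex E p (fun G => ind (evD F R Ab G ∧ F j ⊆ G)) with hxdef
      have hqx : q * d ≤ x := by
        refine le_trans ?_ hx
        gcongr; exact hq j hjI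
      have hu1 := ih (insert j w) (insert j R) Ab (Finset.insert_subset_insert j hRw) hw'I hAI
        hRI' hd1 hdR.2 hd2
      have hu2 := ih w R (insert j Ab) hRw hwI (Finset.insert_subset hjI hAI) hRI'
        (by rw [Finset.disjoint_insert_left]; exact ⟨hwR.1, hdw⟩)
        (by rw [Finset.disjoint_insert_left]; exact ⟨hj, hdR.2⟩) hwR.2
      set g1 := Ex Rem q (fun W => ind (U (insert j R ∪ W.filter
        (goodSet F p I (insert j w ∪ W))))) with hg1
      have e1 : Ex E p (fun G => ind (evD F (insert j R) Ab G)) = x := by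
        refine Ex_congr fun G _ => ind_congr ?_
        simp only [evD, Finset.biUnion_insert, Finset.union_subset_iff]; tauto
      have e2 : Ex E p (fun G => ind (evD F R (insert j Ab) G)) = d - x := by
        rw [hd, hxdef, ← Ex_sub]
        refine Ex_congr fun G _ => ?_
        have : ind (evD F R (insert j Ab) G) = ind (evD F R Ab G ∧ ¬ F j ⊆ G) :=
          ind_congr (by simp only [evD, Finset.forall_mem_insert]; tauto)
        rw [this, ind_and, ind_and, ind_not]; ring
      have e3 : u = Ex E p (fun G => ind (U (I.filter fun j => F j ⊆ G) ∧ evD F (insert j R) Ab G)) +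
          Ex E p (fun G => ind (U (I.filter fun j => F j ⊆ G) ∧ evD F R (insert j Ab) G)) := by
        rw [hu, ← Ex_add]
        refine Ex_congr fun G _ => ?_
        have a1 : ind (evD F R (insert j Ab) G) = ind (evD F R Ab G ∧ ¬ F j ⊆ G) :=
          ind_congr (by simp only [evD, Finset.forall_mem_insert]; tauto)
        have a2 : ind (evD F (insert j R) Ab G) = ind (evD F R Ab G ∧ F j ⊆ G) :=
          ind_congr (by simp only [evD, Finset.biUnion_insert, Finset.union_subset_iff]; tauto)
        rw [ind_and, ind_and, ind_and, a1, a2, ind_and, ind_and, ind_not]; ring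
      have hle : Ex Rem q (fun W => ind (U (R ∪ (insert j W).filter
          (goodSet F p I (w ∪ insert j W))))) ≤ g1 := by
        refine Ex_mono hq0 hq1 fun W _ => ind_mono (hU _ _ ?_)
        have : w ∪ insert j W = insert j w ∪ W := by
          rw [Finset.union_insert, Finset.insert_union]
        rw [this]
        intro z
        simp only [Finset.mem_union, Finset.mem_filter, Finset.mem_insert]
        tauto
      rw [e1] at hu1; rw [e2] at hu2
      have hx0 : 0 ≤ d - x := by rw [← e2]; exact Ex_nonneg h0 h1 fun _ _ => ind_nonneg _
      have key : d * (q * g1 + (1 - q) * g0) ≤ u := by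
        rcases le_total g0 g1 with h | h
        · nlinarith
        · have : q * d * g1 ≤ q * d * g0 := by
            apply mul_le_mul_of_nonneg_left h (mul_nonneg hq0 hd0)
          nlinarith
      refine le_trans ?_ key
      gcongr
    · have hu1 := ih (insert j w) R Ab (hRw.trans (Finset.subset_insert _ _)) hw'I hAI
        hRI' hd1 hdR.2 hd2
      set g1 := Ex Rem q (fun W => ind (U (R ∪ W.filter
        (goodSet F p I (insert j w ∪ W))))) with hg1
      have hle : Ex Rem q (fun W => ind (U (R ∪ (insert j W).filter
          (goodSet F p I (w ∪ insert j W))))) = g1 := by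
        refine Ex_congr fun W hW => ?_
        have e4 : w ∪ insert j W = insert j w ∪ W := by
          rw [Finset.union_insert, Finset.insert_union]
        rw [e4, Finset.filter_insert, if_neg]
        intro hgood
        apply hok
        refine le_trans ?_ hgood
        refine le_trans ?_ (Finset.sum_le_sum_of_subset_of_nonneg (s := Ab.filter
          (fun i => ¬ Disjoint (F i) (F j))) ?_ fun _ _ _ => pow_nonneg h0 _)
        · refine Finset.sum_le_sum fun i _ => ?_
          refine pow_le_pow_of_le_one h0 h1 (Finset.card_le_card ?_)
          refine Finset.sdiff_subset_sdiff le_rfl (Finset.union_subset_union le_rfl ?_)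
          refine Finset.biUnion_subset_biUnion_of_subset_left F ?_
          exact hRw.trans ((Finset.subset_insert _ _).trans Finset.subset_union_left)
        · intro i hi
          rw [Finset.mem_filter] at hi ⊢
          refine ⟨Finset.mem_sdiff.2 ⟨hAI hi.1, ?_⟩, hi.2⟩
          rw [Finset.mem_union]
          rintro (h | h)
          · exact Finset.disjoint_left.1 hd1 hi.1 h
          · exact Finset.disjoint_left.1 hdR.2 hi.1 (hW h)
      rw [hle]
      nlinarith

theorem coupling {E : Finset α} {F : ι → Finset α} {p q : ℝ} (h0 : 0 ≤ p) (h1 : p ≤ 1)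
    (hF : ∀ i, F i ⊆ E) (I : Finset ι) (hq0 : 0 ≤ q) (hq1 : q ≤ 1)
    (hq : ∀ j ∈ I, q ≤ p ^ #(F j) / 2)
    (U : Finset ι → Prop) (hU : ∀ A B, A ⊆ B → U A → U B) :
    Ex I q (fun W => ind (U (W.filter (goodSet F p I W)))) ≤
      Ex E p (fun G => ind (U (I.filter fun j => F j ⊆ G))) := by
  have := coupling_step h0 h1 hF I hq0 hq1 hq U hU I ∅ ∅ ∅ (by simp) (by simp) (by simp)
    le_rfl (by simp) (by simp) (by simp)
  simpa [evD, ind_true, Ex_const] using this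

end Coupling

set_option linter.unusedSectionVars false

section FKNP
open Finset
open scoped Classical
variable {ι Ω : Type*} [DecidableEq ι] [Fintype ι] [Fintype Ω]

lemma Ex_union_le {α : Type*} [DecidableEq α] {s Z : Finset α} (hZ : Z ⊆ s) {p : ℝ}
    (h0 : 0 ≤ p) (h1 : p ≤ 1) {g : Finset α → ℝ} (hg : ∀ A, 0 ≤ g A) :
    p ^ #Z * Ex s p (fun B => g (B ∪ Z)) ≤ Ex s p g := by
  rw [← Ex_subset_eq hZ (g := fun B => g (B ∪ Z))]
  · refine Ex_mono h0 h1 fun A _ => ?_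
    by_cases h : Z ⊆ A
    · rw [ind_true h, one_mul, Finset.union_eq_left.2 h]
    · rw [ind_false h, zero_mul]; exact hg A
  · intro z hz A _
    congr 1
    ext x; simp only [Finset.mem_union, Finset.mem_insert]
    constructor
    · rintro ((rfl | h) | h)
      · exact Or.inr hz
      · exact Or.inl h
      · exact Or.inr h
    · tauto

/-- `ω` can be replaced by a `valid` member with a small part outside of `A`. -/
def Repl1 (T : Ω → Finset ι) (valid : ι → Finset ι → Prop) (A C : Finset ι) (ω : Ω) (a : ℕ) : Prop :=
  ∃ ω', T ω' ⊆ A ∪ T ω ∧ #(T ω' \ A) ≤ a ∧ ∀ f ∈ T ω', valid f (A ∪ C ∪ T ω')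

/-- candidate for decoding. -/
def Cand (T : Ω → Finset ι) (valid : ι → Finset ι → Prop) (A C B : Finset ι) (a : ℕ)
    (ω' : Ω) : Prop :=
  T ω' ⊆ A ∪ B ∧ #(T ω' \ A) ≤ a ∧ ∀ f ∈ T ω', valid f (A ∪ B ∪ C ∪ T ω')

/-- The decoded set. -/
noncomputable def decSet (T : Ω → Finset ι) (valid : ι → Finset ι → Prop) (A C : Finset ι) (a : ℕ)
    (B : Finset ι) : Finset ι :=
  if h : ∃ ω', Cand T valid A C B a ω' then T (Classical.choose h) \ A else ∅

lemma decSet_card (T : Ω → Finset ι) (valid : ι → Finset ι → Prop) (A C : Finset ι) (a : ℕ)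
    (B : Finset ι) : #(decSet T valid A C a B) ≤ a := by
  unfold decSet
  split_ifs with h
  · exact (Classical.choose_spec h).2.1
  · simp

lemma exists_planted (T : Ω → Finset ι) (valid : ι → Finset ι → Prop)
    (hv : ∀ f A B, A ⊆ B → valid f B → valid f A) (A B C : Finset ι) (ω : Ω) (a b : ℕ)
    (h1 : Repl1 T valid A (B ∪ C) ω a) (h2 : ¬ Repl1 T valid (A ∪ B) C ω b) :
    ∃ Z : Finset ι, b + 1 ≤ #Z ∧ Z ⊆ decSet T valid A C a (B ∪ Z) ∧ Z ⊆ T ω := by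
  set comp : Finset Ω := Finset.univ.filter fun ω' => T ω' ⊆ A ∪ B ∪ T ω ∧ #(T ω' \ A) ≤ a ∧
    ∀ f ∈ T ω', valid f (A ∪ B ∪ C ∪ T ω') with hcomp
  have hne : comp.Nonempty := by
    obtain ⟨ω', e1, e2, e3⟩ := h1
    refine ⟨ω', ?_⟩
    rw [hcomp, Finset.mem_filter]
    refine ⟨Finset.mem_univ _, e1.trans ?_, e2, ?_⟩
    · exact Finset.union_subset_union Finset.subset_union_left le_rfl
    · rw [Finset.union_assoc A B C]; exact e3
  obtain ⟨ωs, hs, hmin⟩ := Finset.exists_min_image comp (fun ω' => #(T ω' \ (A ∪ B))) hne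
  rw [hcomp, Finset.mem_filter] at hs
  obtain ⟨-, s1, s2, s3⟩ := hs
  set Z := T ωs \ (A ∪ B) with hZ
  have hZω : Z ⊆ T ω := by
    intro x hx
    rw [hZ, Finset.mem_sdiff] at hx
    exact (Finset.mem_union.1 (s1 hx.1)).resolve_left hx.2
  have hZs : Z ⊆ T ωs := Finset.sdiff_subset
  refine ⟨Z, ?_, ?_, hZω⟩
  · by_contra hlt
    push Not at hlt
    exact h2 ⟨ωs, s1, Nat.lt_succ_iff.1 hlt, s3⟩
  · have hc : Cand T valid A C (B ∪ Z) a ωs := by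
      refine ⟨?_, s2, fun f hf => ?_⟩
      · intro x hx
        by_cases hxx : x ∈ A ∪ B
        · rw [← Finset.union_assoc]; exact Finset.mem_union_left _ hxx
        · rw [← Finset.union_assoc]
          exact Finset.mem_union_right _ (Finset.mem_sdiff.2 ⟨hx, hxx⟩)
      · refine hv _ _ _ ?_ (s3 f hf)
        intro x hx
        simp only [Finset.mem_union] at hx ⊢
        rcases hx with ((hx | hx | hx) | hx) | hx
        · tauto
        · tauto
        · exact Or.inr (hZs hx)
        · tauto
        · tauto
    have hex : ∃ ω', Cand T valid A C (B ∪ Z) a ω' := ⟨ωs, hc⟩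
    unfold decSet
    rw [dif_pos hex]
    set ωz := Classical.choose hex with hωz
    obtain ⟨z1, z2, z3⟩ : Cand T valid A C (B ∪ Z) a ωz := Classical.choose_spec hex
    have hzc : ωz ∈ comp := by
      rw [hcomp, Finset.mem_filter]
      refine ⟨Finset.mem_univ _, z1.trans ?_, z2, fun f hf => hv _ _ _ ?_ (z3 f hf)⟩
      · rw [← Finset.union_assoc]; exact Finset.union_subset_union le_rfl hZω
      · intro x hx
        simp only [Finset.mem_union] at hx ⊢
        tauto
    have hsub : T ωz \ (A ∪ B) ⊆ Z := by
      intro x hx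
      rw [Finset.mem_sdiff] at hx
      have := z1 hx.1
      rw [← Finset.union_assoc] at this
      exact (Finset.mem_union.1 this).resolve_left hx.2
    have heq := Finset.eq_of_subset_of_card_le hsub (hmin ωz hzc)
    rw [← heq]
    exact Finset.sdiff_subset_sdiff le_rfl Finset.subset_union_left

lemma fknp_round {T : Ω → Finset ι} {valid : ι → Finset ι → Prop}
    (hv : ∀ f A B, A ⊆ B → valid f B → valid f A) {μ : Ω → ℝ} (hμ : ∀ ω, 0 ≤ μ ω)
    {κ ρ : ℝ} (hκ0 : 0 ≤ κ) (hκ : κ ≤ ρ) (hρ0 : 0 < ρ) (hρ : ρ ≤ 1)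
    (hspread : ∀ P : Finset ι, ∑ ω, μ ω * ind (P ⊆ T ω) ≤ κ ^ #P)
    (A C : Finset ι) (a b : ℕ) :
    Ex univ ρ (fun B => ∑ ω, μ ω * ind (Repl1 T valid A (B ∪ C) ω a ∧ ¬ Repl1 T valid (A ∪ B) C ω b))
      ≤ 2 ^ a * (κ / ρ) ^ (b + 1) := by
  set D := decSet T valid A C a with hD
  set g : Finset ι → Finset ι → ℝ := fun Z B => ind (b + 1 ≤ #Z ∧ Z ⊆ D B) with hg
  have hr0 : 0 ≤ κ / ρ := by positivity
  have hr1 : κ / ρ ≤ 1 := by rw [div_le_one hρ0]; exact hκ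
  have s1 : ∀ B, ∑ ω, μ ω * ind (Repl1 T valid A (B ∪ C) ω a ∧ ¬ Repl1 T valid (A ∪ B) C ω b) ≤
      ∑ Z : Finset ι, κ ^ #Z * g Z (B ∪ Z) := by
    intro B
    calc _ ≤ ∑ ω, μ ω * ∑ Z : Finset ι, g Z (B ∪ Z) * ind (Z ⊆ T ω) := by
          refine Finset.sum_le_sum fun ω _ => mul_le_mul_of_nonneg_left ?_ (hμ ω)
          by_cases h : Repl1 T valid A (B ∪ C) ω a ∧ ¬ Repl1 T valid (A ∪ B) C ω b
          · obtain ⟨Z, z1, z2, z3⟩ := exists_planted T valid hv A B C ω a b h.1 h.2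
            have e : g Z (B ∪ Z) * ind (Z ⊆ T ω) = 1 := by
              rw [hg]; simp only; rw [ind_true ⟨z1, z2⟩, ind_true z3, one_mul]
            rw [ind_true h]
            refine e.symm.le.trans ?_
            exact Finset.single_le_sum (f := fun Z => g Z (B ∪ Z) * ind (Z ⊆ T ω))
              (fun Z _ => mul_nonneg (ind_nonneg _) (ind_nonneg _)) (Finset.mem_univ Z)
          · rw [ind_false h]
            exact Finset.sum_nonneg fun Z _ => mul_nonneg (ind_nonneg _) (ind_nonneg _)
      _ = ∑ Z : Finset ι, g Z (B ∪ Z) * ∑ ω, μ ω * ind (Z ⊆ T ω) := by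
          simp_rw [Finset.mul_sum]
          rw [Finset.sum_comm]
          exact Finset.sum_congr rfl fun _ _ => Finset.sum_congr rfl fun _ _ => by ring
      _ ≤ _ := by
          refine Finset.sum_le_sum fun Z _ => ?_
          rw [mul_comm]
          exact mul_le_mul_of_nonneg_right (hspread Z) (ind_nonneg _)
  refine (Ex_mono hρ0.le hρ fun B _ => s1 B).trans ?_
  rw [Ex_sum]
  have s2 : ∀ Z : Finset ι, Ex univ ρ (fun B => κ ^ #Z * g Z (B ∪ Z)) ≤
      Ex univ ρ (fun B => (κ / ρ) ^ #Z * g Z B) := by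
    intro Z
    rw [Ex_mul, Ex_mul, div_pow, div_mul_eq_mul_div, mul_div_assoc]
    refine mul_le_mul_of_nonneg_left ?_ (pow_nonneg hκ0 _)
    rw [le_div_iff₀ (pow_pos hρ0 _), mul_comm]
    exact Ex_union_le (Finset.subset_univ _) hρ0.le hρ fun _ => ind_nonneg _
  refine (Finset.sum_le_sum fun Z _ => s2 Z).trans ?_
  rw [← Ex_sum]
  refine Ex_le_const hρ0.le hρ fun B _ => ?_
  calc ∑ Z : Finset ι, (κ / ρ) ^ #Z * g Z B
      ≤ ∑ Z : Finset ι, if Z ∈ (D B).powerset then (κ / ρ) ^ (b + 1) else 0 := by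
        refine Finset.sum_le_sum fun Z _ => ?_
        rw [hg]; simp only
        by_cases h : b + 1 ≤ #Z ∧ Z ⊆ D B
        · rw [ind_true h, mul_one, if_pos (Finset.mem_powerset.2 h.2)]
          exact pow_le_pow_of_le_one hr0 hr1 h.1
        · rw [ind_false h, mul_zero]; split_ifs <;> positivity
    _ = 2 ^ #(D B) * (κ / ρ) ^ (b + 1) := by
        rw [← Finset.sum_filter]
        rw [Finset.filter_mem_eq_inter, Finset.univ_inter, Finset.sum_const, Finset.card_powerset,
          nsmul_eq_mul]
        push_cast; rfl
    _ ≤ _ := by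
        have := decSet_card T valid A C a B
        gcongr
        norm_num

/-- The density after `L` rounds. -/
noncomputable def piL (ρ : ℝ) (L : ℕ) : ℝ := 1 - (1 - ρ) ^ L

lemma piL_succ (ρ : ℝ) (L : ℕ) : piL ρ (L + 1) = piL ρ L + ρ - piL ρ L * ρ := by
  unfold piL; ring

lemma piL_nonneg {ρ : ℝ} (h0 : 0 ≤ ρ) (h1 : ρ ≤ 1) (L : ℕ) : 0 ≤ piL ρ L := by
  unfold piL
  have := pow_le_one₀ (n := L) (by linarith : 0 ≤ 1 - ρ) (by linarith)
  linarith

lemma piL_le_one {ρ : ℝ} (h1 : ρ ≤ 1) (L : ℕ) : piL ρ L ≤ 1 := by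
  unfold piL
  have := pow_nonneg (by linarith : 0 ≤ 1 - ρ) L
  linarith

lemma piL_le {ρ : ℝ} (h1 : ρ ≤ 1) (L : ℕ) : piL ρ L ≤ L * ρ := by
  unfold piL
  have := one_add_mul_le_pow (a := -ρ) (by linarith) L
  rw [← sub_eq_add_neg] at this
  linarith

lemma Ex_zero {α : Type*} [DecidableEq α] (s : Finset α) (f : Finset α → ℝ) :
    Ex s 0 f = f ∅ := by
  induction s using Finset.induction_on with
  | empty => rw [Ex_empty]
  | insert a s ha ih => rw [Ex_insert ha, ih]; ring

lemma fknp_multi {T : Ω → Finset ι} {valid : ι → Finset ι → Prop}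
    (hv : ∀ f A B, A ⊆ B → valid f B → valid f A) {μ : Ω → ℝ} (hμ : ∀ ω, 0 ≤ μ ω)
    {κ ρ : ℝ} (hκ0 : 0 ≤ κ) (hκ : κ ≤ ρ) (hρ0 : 0 < ρ) (hρ : ρ ≤ 1)
    (hspread : ∀ P : Finset ι, ∑ ω, μ ω * ind (P ⊆ T ω) ≤ κ ^ #P) (a : ℕ → ℕ) (L : ℕ) :
    ∀ C : Finset ι, Ex univ (piL ρ L) (fun W => ∑ ω, μ ω *
        ind (Repl1 T valid ∅ (W ∪ C) ω (a 0) ∧ ¬ Repl1 T valid W C ω (a L)))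
      ≤ ∑ i ∈ range L, 2 ^ a i * (κ / ρ) ^ (a (i + 1) + 1) := by
  induction L with
  | zero =>
    intro C
    have : piL ρ 0 = 0 := by simp [piL]
    rw [this, Ex_zero]
    simp [ind]
  | succ L ih =>
    intro C
    have q0 := piL_nonneg hρ0.le hρ L
    have q1 := piL_le_one hρ L
    rw [piL_succ, ← Ex_union, Finset.sum_range_succ]
    calc _ ≤ Ex univ (piL ρ L) (fun A => Ex univ ρ (fun B =>
          ∑ ω, μ ω * ind (Repl1 T valid ∅ (A ∪ (B ∪ C)) ω (a 0) ∧ ¬ Repl1 T valid A (B ∪ C) ω (a L)) +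
          ∑ ω, μ ω * ind (Repl1 T valid A (B ∪ C) ω (a L) ∧ ¬ Repl1 T valid (A ∪ B) C ω (a (L + 1))))) := by
          refine Ex_mono q0 q1 fun A _ => Ex_mono hρ0.le hρ fun B _ => ?_
          rw [← Finset.sum_add_distrib]
          refine Finset.sum_le_sum fun ω _ => ?_
          rw [← mul_add]
          refine mul_le_mul_of_nonneg_left ?_ (hμ ω)
          refine le_trans (ind_mono fun h => ?_) (ind_or_le _ _)
          rw [Finset.union_assoc] at h
          tauto
      _ = Ex univ ρ (fun B => Ex univ (piL ρ L) (fun A =>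
          ∑ ω, μ ω * ind (Repl1 T valid ∅ (A ∪ (B ∪ C)) ω (a 0) ∧ ¬ Repl1 T valid A (B ∪ C) ω (a L)))) +
          Ex univ (piL ρ L) (fun A => Ex univ ρ (fun B =>
          ∑ ω, μ ω * ind (Repl1 T valid A (B ∪ C) ω (a L) ∧ ¬ Repl1 T valid (A ∪ B) C ω (a (L + 1))))) := by
          simp only [Ex_add]
          rw [Ex_comm]
      _ ≤ _ := by
          refine add_le_add ?_ ?_
          · exact Ex_le_const hρ0.le hρ fun B _ => ih (B ∪ C)
          · exact Ex_le_const q0 q1 fun A _ =>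
              fknp_round hv hμ hκ0 hκ hρ0 hρ hspread A C _ _

lemma sum_half_pow_le (a : ℕ → ℕ) (L : ℕ) (h : ∀ i < L, a (i + 1) < a i) :
    ∑ i ∈ range L, ((1:ℝ) / 2) ^ a i ≤ (1 / 2) ^ (a L) := by
  induction L with
  | zero => simp
  | succ L ih =>
    rw [Finset.sum_range_succ]
    have h1 := ih fun i hi => h i (by omega)
    have h2 : ((1:ℝ) / 2) ^ a L ≤ (1 / 2) ^ (a (L + 1) + 1) :=
      pow_le_pow_of_le_one (by norm_num) (by norm_num) (h L (by omega))
    rw [pow_succ] at h2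
    linarith

/-- The fragmentation lemma with all rounds. -/
theorem fknp {T : Ω → Finset ι} {valid : ι → Finset ι → Prop}
    (hv : ∀ f A B, A ⊆ B → valid f B → valid f A) {μ : Ω → ℝ} (hμ : ∀ ω, 0 ≤ μ ω)
    {y ρ : ℝ} (hy0 : 0 ≤ y) (hy : y ≤ 1 / 4) (hρ0 : 0 < ρ) (hρ : ρ ≤ 1)
    (hspread : ∀ P : Finset ι, ∑ ω, μ ω * ind (P ⊆ T ω) ≤ (y ^ 2 * ρ) ^ #P) (a0 L : ℕ)
    (ha : ∀ i < L, 0 < a0 / 2 ^ i) (hT : ∀ ω, #(T ω) ≤ a0) :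
    Ex univ (piL ρ L) (fun W => ∑ ω, μ ω * ind (¬ Repl1 T valid W ∅ ω (a0 / 2 ^ L))) ≤
      y + Ex univ (piL ρ L) (fun W => ∑ ω, μ ω * ind (¬ ∀ f ∈ T ω, valid f (W ∪ T ω))) := by
  have hm := fknp_multi hv hμ (κ := y ^ 2 * ρ) (by positivity)
    (mul_le_of_le_one_left hρ0.le (by nlinarith)) hρ0 hρ hspread
    (fun i => a0 / 2 ^ i) L ∅
  have hy2 : y ^ 2 * ρ / ρ = y ^ 2 := by field_simp
  have hsum : ∑ i ∈ range L, (2:ℝ) ^ (a0 / 2 ^ i) * (y ^ 2 * ρ / ρ) ^ (a0 / 2 ^ (i + 1) + 1) ≤ y := by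
    rw [hy2]
    calc _ ≤ ∑ i ∈ range L, y * ((1:ℝ) / 2) ^ (a0 / 2 ^ i) := by
          refine Finset.sum_le_sum fun i _ => ?_
          rw [← pow_mul]
          have e : a0 / 2 ^ (i + 1) = (a0 / 2 ^ i) / 2 := by
            rw [pow_succ, Nat.div_div_eq_div_mul]
          have e2 : (a0 / 2 ^ i) + 1 ≤ 2 * (a0 / 2 ^ (i + 1) + 1) := by omega
          calc (2:ℝ) ^ (a0 / 2 ^ i) * y ^ (2 * (a0 / 2 ^ (i + 1) + 1))
              ≤ 2 ^ (a0 / 2 ^ i) * y ^ (a0 / 2 ^ i + 1) := by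
                gcongr 2 ^ (a0 / 2 ^ i) * ?_
                exact pow_le_pow_of_le_one hy0 (by linarith) e2
            _ = y * (2 * y) ^ (a0 / 2 ^ i) := by rw [mul_pow]; ring
            _ ≤ _ := by gcongr; linarith
      _ = y * ∑ i ∈ range L, ((1:ℝ) / 2) ^ (a0 / 2 ^ i) := by rw [Finset.mul_sum]
      _ ≤ y * 1 := by
          gcongr
          refine (sum_half_pow_le (fun i => a0 / 2 ^ i) L fun i hi => ?_).trans
            (pow_le_one₀ (by norm_num) (by norm_num))
          have := ha i hi
          simp only [pow_succ, ← Nat.div_div_eq_div_mul]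
          omega
      _ = y := mul_one y
  have q0 := piL_nonneg hρ0.le hρ L
  have q1 := piL_le_one hρ L
  calc _ ≤ Ex univ (piL ρ L) (fun W => (∑ ω, μ ω *
        ind (Repl1 T valid ∅ (W ∪ ∅) ω (a0 / 2 ^ 0) ∧ ¬ Repl1 T valid W ∅ ω (a0 / 2 ^ L))) +
        ∑ ω, μ ω * ind (¬ ∀ f ∈ T ω, valid f (W ∪ T ω))) := by
        refine Ex_mono q0 q1 fun W _ => ?_
        rw [← Finset.sum_add_distrib]
        refine Finset.sum_le_sum fun ω _ => ?_
        rw [← mul_add]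
        refine mul_le_mul_of_nonneg_left ?_ (hμ ω)
        refine le_trans (ind_mono fun h => ?_) (ind_or_le _ _)
        by_cases h2 : ∀ f ∈ T ω, valid f (W ∪ T ω)
        · left
          refine ⟨⟨ω, by simp, by simpa using hT ω, ?_⟩, h⟩
          simpa using h2
        · exact Or.inr h2
    _ ≤ _ := by
        rw [Ex_add]
        linarith [hm.trans hsum]

end FKNP

set_option linter.unusedSectionVars false

section Structure
open Finset
open scoped Classical
variable {V : Type} [Fintype V] [DecidableEq V] {m : ℕ}

/-- The edge of the copy `f` at `a`. -/
def edgeAt (f : V → Fin m) (a : Sym2 V) : Sym2 (V × Fin m) := a.map (fun x => (x, f x))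

lemma edgeAt_eq_iff (f g : V → Fin m) (a b : Sym2 V) :
    edgeAt f a = edgeAt g b ↔ a = b ∧ ∀ x ∈ a, f x = g x := by
  constructor
  · intro h
    have h1 : a = b := by
      have := congrArg (Sym2.map Prod.fst) h
      unfold edgeAt at this
      rw [Sym2.map_map, Sym2.map_map] at this
      have e : ∀ f : V → Fin m, (Prod.fst ∘ fun x => (x, f x)) = (id : V → V) := fun f => rfl
      rwa [e, e, Sym2.map_id, id, id] at this
    refine ⟨h1, fun x hx => ?_⟩
    subst h1
    have h2 : (x, f x) ∈ edgeAt g a := by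
      rw [← h]; exact Sym2.mem_map.2 ⟨x, hx, rfl⟩
    obtain ⟨z, _, hz2⟩ := Sym2.mem_map.1 h2
    simp only [Prod.mk.injEq] at hz2
    obtain ⟨rfl, h3⟩ := hz2
    exact h3.symm
  · rintro ⟨rfl, h⟩
    unfold edgeAt
    exact Sym2.map_congr fun x hx => by rw [h x hx]

/-- The edge set of the copy `f` of `H` in the partite model. -/
noncomputable def Fc (EH : Finset (Sym2 V)) (f : V → Fin m) : Finset (Sym2 (V × Fin m)) :=
  EH.image (edgeAt f)

lemma edgeAt_injective (f : V → Fin m) : Function.Injective (edgeAt f) :=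
  fun a b h => ((edgeAt_eq_iff f f a b).1 h).1

lemma Fc_card (EH : Finset (Sym2 V)) (f : V → Fin m) : #(Fc EH f) = #EH :=
  Finset.card_image_of_injective _ (edgeAt_injective f)

lemma edgeAt_mem_Fc (EH : Finset (Sym2 V)) (f g : V → Fin m) (a : Sym2 V) :
    edgeAt f a ∈ Fc EH g ↔ a ∈ EH ∧ ∀ x ∈ a, f x = g x := by
  unfold Fc
  rw [Finset.mem_image]
  constructor
  · rintro ⟨b, hb, h⟩
    rw [eq_comm, edgeAt_eq_iff] at h
    obtain ⟨rfl, h⟩ := h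
    exact ⟨hb, h⟩
  · rintro ⟨h1, h2⟩
    exact ⟨a, h1, ((edgeAt_eq_iff f g a a).2 ⟨rfl, h2⟩).symm⟩

lemma not_disjoint_Fc (EH : Finset (Sym2 V)) (f g : V → Fin m) :
    ¬ Disjoint (Fc EH f) (Fc EH g) ↔ ∃ a ∈ EH, ∀ x ∈ a, f x = g x := by
  rw [Finset.not_disjoint_iff]
  constructor
  · rintro ⟨z, h1, h2⟩
    obtain ⟨a, ha, rfl⟩ := Finset.mem_image.1 h1
    exact ⟨a, ha, ((edgeAt_mem_Fc EH f g a).1 h2).2⟩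
  · rintro ⟨a, ha, h⟩
    exact ⟨edgeAt f a, Finset.mem_image_of_mem _ ha, (edgeAt_mem_Fc EH f g a).2 ⟨ha, h⟩⟩

/-- Edges of `f` covered by copies in `Y`. -/
noncomputable def Jset (EH : Finset (Sym2 V)) (Y : Finset (V → Fin m)) (f : V → Fin m) :
    Finset (Sym2 V) := EH.filter fun a => ∃ g ∈ Y, ∀ x ∈ a, f x = g x

lemma Fc_sdiff_biUnion (EH : Finset (Sym2 V)) (Y : Finset (V → Fin m)) (f : V → Fin m) :
    Fc EH f \ Y.biUnion (Fc EH) = (EH \ Jset EH Y f).image (edgeAt f) := by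
  ext z
  simp only [Finset.mem_sdiff, Finset.mem_image, Finset.mem_biUnion]
  constructor
  · rintro ⟨h1, h2⟩
    obtain ⟨a, ha, rfl⟩ := Finset.mem_image.1 h1
    refine ⟨a, ⟨ha, fun hJ => ?_⟩, rfl⟩
    obtain ⟨g, hg, hgx⟩ := (Finset.mem_filter.1 hJ).2
    exact h2 ⟨g, hg, (edgeAt_mem_Fc EH f g a).2 ⟨ha, hgx⟩⟩
  · rintro ⟨a, ⟨ha, hJ⟩, rfl⟩
    refine ⟨Finset.mem_image_of_mem _ ha, ?_⟩
    rintro ⟨g, hg, h⟩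
    exact hJ (Finset.mem_filter.2 ⟨ha, g, hg, ((edgeAt_mem_Fc EH f g a).1 h).2⟩)

lemma Fc_sdiff_card (EH : Finset (Sym2 V)) (Y : Finset (V → Fin m)) (f : V → Fin m) :
    #(Fc EH f \ Y.biUnion (Fc EH)) = #(EH \ Jset EH Y f) := by
  rw [Fc_sdiff_biUnion, Finset.card_image_of_injective _ (edgeAt_injective f)]

lemma Jset_subset (EH : Finset (Sym2 V)) (Y : Finset (V → Fin m)) (f : V → Fin m) :
    Jset EH Y f ⊆ EH := Finset.filter_subset _ _

lemma Fc_subset_biUnion (EH : Finset (Sym2 V)) (Y : Finset (V → Fin m)) (f : V → Fin m) :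
    Fc EH f ⊆ Y.biUnion (Fc EH) ↔ Jset EH Y f = EH := by
  rw [← Finset.sdiff_eq_empty_iff_subset, ← Finset.card_eq_zero, Fc_sdiff_card,
    Finset.card_eq_zero, Finset.sdiff_eq_empty_iff_subset]
  exact ⟨fun h => Finset.Subset.antisymm (Jset_subset _ _ _) h, fun h => h.symm.le⟩

/-- The vertices touched by an edge set. -/
noncomputable def vs (A : Finset (Sym2 V)) : Finset V := Finset.univ.filter fun x => ∃ a ∈ A, x ∈ a

/-- Strict balancedness in integer form. -/
structure Bal (EH : Finset (Sym2 V)) : Prop where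
  nd : ∀ a ∈ EH, ¬ a.IsDiag
  ne : EH.Nonempty
  top : vs EH = Finset.univ
  bal : ∀ A ⊆ EH, A.Nonempty → A ≠ EH → #A * (Fintype.card V - 1) < #EH * (#(vs A) - 1)

/-- The graph spanned by an edge set. -/
def gr (J : Finset (Sym2 V)) : SimpleGraph V := SimpleGraph.fromEdgeSet (J : Set (Sym2 V))

/-- The number of connected components. -/
noncomputable def cc (J : Finset (Sym2 V)) : ℕ := Fintype.card (gr J).ConnectedComponent

lemma Bal.two_le {EH : Finset (Sym2 V)} (hB : Bal EH) {A : Finset (Sym2 V)} (hA : A ⊆ EH)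
    (hne : A.Nonempty) : 2 ≤ #(vs A) := by
  obtain ⟨a, ha⟩ := hne
  have hd := hB.nd a (hA ha)
  induction a using Sym2.ind with
  | _ x y =>
    rw [Sym2.mk_isDiag_iff] at hd
    rw [← Finset.card_pair hd]
    apply Finset.card_le_card
    intro z hz
    rw [vs, Finset.mem_filter]
    refine ⟨Finset.mem_univ _, s(x, y), ha, ?_⟩
    simpa using hz

lemma Bal.le {EH : Finset (Sym2 V)} (hB : Bal EH) {A : Finset (Sym2 V)} (hA : A ⊆ EH)
    (hne : A.Nonempty) : #A * (Fintype.card V - 1) ≤ #EH * (#(vs A) - 1) := by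
  by_cases h : A = EH
  · subst h; rw [hB.top, Finset.card_univ]
  · exact (hB.bal A hA hne h).le

lemma Bal.two_le_card {EH : Finset (Sym2 V)} (hB : Bal EH) : 2 ≤ Fintype.card V := by
  have := hB.two_le le_rfl hB.ne
  rwa [hB.top, Finset.card_univ] at this

lemma cc_key {EH : Finset (Sym2 V)} (hB : Bal EH) {J : Finset (Sym2 V)} (hJ : J ⊆ EH) :
    #J * (Fintype.card V - 1) + #EH * cc J ≤ #EH * Fintype.card V ∧
    (J.Nonempty → J ≠ EH →
      #J * (Fintype.card V - 1) + #EH * cc J + 1 ≤ #EH * Fintype.card V) := by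
  set CC := (gr J).ConnectedComponent
  set ev : Sym2 V → CC := fun a => (gr J).connectedComponentMk (Quot.out a).1 with hev
  have hmem : ∀ a ∈ J, ∀ x ∈ a, (gr J).connectedComponentMk x = ev a := by
    intro a ha x hx
    have hout : (Quot.out a).1 ∈ a := Sym2.out_fst_mem a
    by_cases h : x = (Quot.out a).1
    · rw [h]
    · have : a = s(x, (Quot.out a).1) := by
        exact ((Sym2.mem_and_mem_iff h).1 ⟨hx, hout⟩)
      apply SimpleGraph.ConnectedComponent.sound
      apply SimpleGraph.Adj.reachable
      rw [gr, SimpleGraph.fromEdgeSet_adj]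
      exact ⟨by rw [← this]; exact ha, h⟩
  set Jc : CC → Finset (Sym2 V) := fun c => J.filter fun a => ev a = c with hJc
  set Xc : CC → Finset V := fun c => Finset.univ.filter fun x => (gr J).connectedComponentMk x = c
    with hXc
  have hJsum : #J = ∑ c : CC, #(Jc c) :=
    Finset.card_eq_sum_card_fiberwise (fun _ _ => Finset.mem_coe.2 (Finset.mem_univ _))
  have hXsum : Fintype.card V = ∑ c : CC, #(Xc c) := by
    rw [← Finset.card_univ]
    exact Finset.card_eq_sum_card_fiberwise (fun _ _ => Finset.mem_coe.2 (Finset.mem_univ _))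
  have hXpos : ∀ c, 1 ≤ #(Xc c) := by
    intro c
    induction c using SimpleGraph.ConnectedComponent.ind with
    | _ x => exact Finset.card_pos.2 ⟨x, by rw [hXc]; simp⟩
  have hvs : ∀ c, vs (Jc c) ⊆ Xc c := by
    intro c x hx
    rw [vs, Finset.mem_filter] at hx
    obtain ⟨-, a, ha, hxa⟩ := hx
    rw [hJc, Finset.mem_filter] at ha
    rw [hXc, Finset.mem_filter]
    exact ⟨Finset.mem_univ _, by rw [hmem a ha.1 x hxa, ha.2]⟩
  have hsub : ∀ c, Jc c ⊆ J := fun c => Finset.filter_subset _ _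
  have hle : ∀ c, #(Jc c) * (Fintype.card V - 1) + #EH ≤ #EH * #(Xc c) := by
    intro c
    rcases (Jc c).eq_empty_or_nonempty with h | h
    · rw [h]; simpa using Nat.le_mul_of_pos_right _ (hXpos c)
    · have h1 := hB.le ((hsub c).trans hJ) h
      have h2 := Finset.card_le_card (hvs c)
      have h3 := hB.two_le ((hsub c).trans hJ) h
      calc _ ≤ #EH * (#(vs (Jc c)) - 1) + #EH := by omega
        _ = #EH * #(vs (Jc c)) := by
          rw [← Nat.mul_succ]; congr 1; omega
        _ ≤ _ := Nat.mul_le_mul_left _ h2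
  have hsum : #J * (Fintype.card V - 1) + #EH * cc J =
      ∑ c : CC, (#(Jc c) * (Fintype.card V - 1) + #EH) := by
    rw [Finset.sum_add_distrib, ← Finset.sum_mul, ← hJsum, Finset.sum_const, Finset.card_univ,
      smul_eq_mul, mul_comm (#EH)]
    rfl
  have hsum2 : #EH * Fintype.card V = ∑ c : CC, #EH * #(Xc c) := by
    rw [← Finset.mul_sum, ← hXsum]
  constructor
  · rw [hsum, hsum2]; exact Finset.sum_le_sum fun c _ => hle c
  · intro hne hJne
    rw [hsum, hsum2]
    apply Finset.sum_lt_sum (fun c _ => hle c)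
    obtain ⟨a, ha⟩ := hne
    refine ⟨ev a, Finset.mem_univ _, ?_⟩
    have hcne : (Jc (ev a)).Nonempty := ⟨a, by rw [hJc, Finset.mem_filter]; exact ⟨ha, rfl⟩⟩
    have hcE : Jc (ev a) ≠ EH := fun h => hJne
      (Finset.Subset.antisymm hJ (h ▸ hsub (ev a)))
    have h1 := hB.bal _ ((hsub _).trans hJ) hcne hcE
    have h2 := Finset.card_le_card (hvs (ev a))
    have h3 := hB.two_le ((hsub _).trans hJ) hcne
    calc _ < #EH * (#(vs (Jc (ev a))) - 1) + #EH := by omega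
      _ = #EH * #(vs (Jc (ev a))) := by
        rw [← Nat.mul_succ]; congr 1; omega
      _ ≤ _ := Nat.mul_le_mul_left _ h2

lemma gr_EH_preconnected {EH : Finset (Sym2 V)} (hB : Bal EH) (x y : V) : (gr EH).Reachable x y := by
  have h := (cc_key hB le_rfl).1
  have hpos : 0 < #EH := Finset.card_pos.2 hB.ne
  have h2 := hB.two_le_card
  have hc : cc EH ≤ 1 := by
    have : #EH * (Fintype.card V - 1 + cc EH) ≤ #EH * Fintype.card V := by rw [mul_add]; exact h
    have := Nat.le_of_mul_le_mul_left this hpos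
    omega
  rw [← SimpleGraph.ConnectedComponent.eq]
  rw [cc, Fintype.card_le_one_iff] at hc
  exact hc _ _

lemma cc_pos {J : Finset (Sym2 V)} (x : V) : 0 < cc J :=
  Fintype.card_pos_iff.2 ⟨(gr J).connectedComponentMk x⟩

/-- The basic inequality for covers: classes `P l`, `l ∈ I`, partitioning `EH \ J`. -/
lemma star_ineq {EH : Finset (Sym2 V)} (hB : Bal EH) {J : Finset (Sym2 V)} (hJ : J ⊆ EH)
    {κ : Type*} (I : Finset κ) (P : κ → Finset (Sym2 V)) (hP : ∀ l ∈ I, P l ⊆ EH)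
    (hPne : ∀ l ∈ I, (P l).Nonempty) (hPE : ∀ l ∈ I, P l ≠ EH) (hI : I.Nonempty)
    (hcard : #EH ≤ #J + ∑ l ∈ I, #(P l)) :
    cc J ≤ ∑ l ∈ I, (#(vs (P l)) - 1) := by
  have h1 := (cc_key hB hJ).1
  have hpos : 0 < #EH := Finset.card_pos.2 hB.ne
  have h2 : ∑ l ∈ I, #(P l) * (Fintype.card V - 1) < ∑ l ∈ I, #EH * (#(vs (P l)) - 1) := by
    apply Finset.sum_lt_sum_of_nonempty hI
    exact fun l hl => hB.bal _ (hP l hl) (hPne l hl) (hPE l hl)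
  rw [← Finset.sum_mul, ← Finset.mul_sum] at h2
  set S := ∑ l ∈ I, (#(vs (P l)) - 1)
  set Q := ∑ l ∈ I, #(P l)
  have hv := hB.two_le_card
  have h3 : #EH * (Fintype.card V - 1) ≤ #J * (Fintype.card V - 1) + Q * (Fintype.card V - 1) := by
    rw [← add_mul]; exact Nat.mul_le_mul_right _ hcard
  have h4 : #EH * (Fintype.card V - 1) + #EH * cc J < #EH * Fintype.card V + #EH * S := by omega
  have h5 : #EH * (Fintype.card V - 1 + cc J) < #EH * (Fintype.card V + S) := by
    rw [mul_add, mul_add]; exact h4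
  have h6 := Nat.lt_of_mul_lt_mul_left h5
  omega

end Structure

set_option linter.unusedSectionVars false

section Counting
open Finset
open scoped Classical
variable {V : Type} [Fintype V] [DecidableEq V] {m : ℕ}

/-- degree bound. -/
def Deg (Y : Finset (V → Fin m)) (D : ℕ) : Prop :=
  ∀ (x : V) (u : Fin m), #(Y.filter fun f => f x = u) ≤ D

/-- one step neighbourhood. -/
noncomputable def Nb (Y : Finset (V → Fin m)) (s : Finset (V × Fin m)) : Finset (V × Fin m) :=
  s ∪ s.biUnion fun q => (Y.filter fun f => f q.1 = q.2).biUnion fun g =>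
    Finset.univ.image fun y => (y, g y)

lemma Nb_card {Y : Finset (V → Fin m)} {D : ℕ} (hD : Deg Y D) (s : Finset (V × Fin m)) :
    #(Nb Y s) ≤ #s * (D * Fintype.card V + 1) := by
  unfold Nb
  refine (Finset.card_union_le _ _).trans ?_
  have : #(s.biUnion fun q => (Y.filter fun f => f q.1 = q.2).biUnion fun g =>
    Finset.univ.image fun y => (y, g y)) ≤ #s * (D * Fintype.card V) := by
    refine Finset.card_biUnion_le_card_mul _ _ _ fun q _ => ?_
    refine (Finset.card_biUnion_le_card_mul _ _ (Fintype.card V) fun g _ => ?_).trans ?_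
    · exact Finset.card_image_le
    · exact Nat.mul_le_mul_right _ (hD q.1 q.2)
  rw [mul_add, mul_one]; omega

lemma Nb_iter_card {Y : Finset (V → Fin m)} {D : ℕ} (hD : Deg Y D) (s : Finset (V × Fin m))
    (k : ℕ) : #((Nb Y)^[k] s) ≤ #s * (D * Fintype.card V + 1) ^ k := by
  induction k generalizing s with
  | zero => simp
  | succ k ih =>
    rw [Function.iterate_succ_apply]
    refine (ih _).trans ?_
    rw [pow_succ', ← mul_assoc]
    exact Nat.mul_le_mul_right _ (Nb_card hD s)

lemma Nb_iter_mono (Y : Finset (V → Fin m)) (s : Finset (V × Fin m)) {k l : ℕ} (h : k ≤ l) :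
    (Nb Y)^[k] s ⊆ (Nb Y)^[l] s := by
  induction l, h using Nat.le_induction with
  | base => exact le_rfl
  | succ l _ ih =>
    rw [Function.iterate_succ_apply']
    exact ih.trans Finset.subset_union_left

lemma walk_mem {EH J : Finset (Sym2 V)} {Y : Finset (V → Fin m)} {f : V → Fin m}
    (hJ : J ⊆ Jset EH Y f) {r x : V} (w : (gr J).Walk r x) :
    ∀ s : Finset (V × Fin m), (r, f r) ∈ s → (x, f x) ∈ (Nb Y)^[w.length] s := by
  induction w with
  | nil => intro s hs; simpa using hs
  | cons h w ih =>
    intro s hs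
    rw [SimpleGraph.Walk.length_cons, Function.iterate_succ_apply]
    apply ih
    rw [gr, SimpleGraph.fromEdgeSet_adj] at h
    obtain ⟨g, hg, hgx⟩ := (Finset.mem_filter.1 (hJ h.1)).2
    apply Finset.mem_union_right
    rw [Finset.mem_biUnion]
    refine ⟨_, hs, ?_⟩
    rw [Finset.mem_biUnion]
    refine ⟨g, Finset.mem_filter.2 ⟨hg, (hgx _ (Sym2.mem_mk_left _ _)).symm⟩, ?_⟩
    rw [Finset.mem_image]
    exact ⟨_, Finset.mem_univ _, by rw [hgx _ (Sym2.mem_mk_right _ _)]⟩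

lemma count_lemma {EH J : Finset (Sym2 V)} {Y : Finset (V → Fin m)} {D : ℕ} (hD : Deg Y D)
    (x0 : V) (u0 : Fin m) :
    #(Finset.univ.filter fun f : V → Fin m => f x0 = u0 ∧ J ⊆ Jset EH Y f) ≤
      m ^ (cc J - 1) * ((D * Fintype.card V + 1) ^ Fintype.card V) ^ Fintype.card V := by
  set CC := (gr J).ConnectedComponent
  set c0 : CC := (gr J).connectedComponentMk x0 with hc0
  set rep : CC → V := fun c => if c = c0 then x0 else Quot.out c with hrep
  have hrepc : ∀ c, (gr J).connectedComponentMk (rep c) = c := by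
    intro c
    by_cases h : c = c0
    · rw [hrep]; simp only [h, if_true]; rfl
    · rw [hrep]; simp only [h, if_false]; exact Quot.out_eq c
  have hrep0 : rep c0 = x0 := by rw [hrep]; simp
  set S : V → Fin m → Finset (Fin m) := fun x u => Finset.univ.filter fun w =>
    (x, w) ∈ (Nb Y)^[Fintype.card V] {(rep ((gr J).connectedComponentMk x), u)} with hS
  have hScard : ∀ x u, #(S x u) ≤ (D * Fintype.card V + 1) ^ Fintype.card V := by
    intro x u
    have h1 := Nb_iter_card hD {(rep ((gr J).connectedComponentMk x), u)} (Fintype.card V)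
    rw [Finset.card_singleton, one_mul] at h1
    refine le_trans ?_ h1
    apply Finset.card_le_card_of_injOn (fun w => (x, w))
    · intro w hw
      exact (Finset.mem_filter.1 hw).2
    · intro a _ b _ h
      exact (Prod.mk.inj h).2
  set HH : Finset (CC → Fin m) := Fintype.piFinset fun c => if c = c0 then {u0} else Finset.univ
    with hHH
  have hHcard : #HH = m ^ (cc J - 1) := by
    rw [hHH, Fintype.card_piFinset]
    have : ∀ c : CC, #(if c = c0 then ({u0} : Finset (Fin m)) else Finset.univ) =
        if c = c0 then 1 else m := by
      intro c; split_ifs <;> simp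
    simp_rw [this]
    rw [Finset.prod_ite]
    simp only [Finset.prod_const, one_pow, one_mul]
    congr 1
    rw [Finset.filter_ne', Finset.card_erase_of_mem (Finset.mem_univ _), Finset.card_univ]; rfl
  have hsub : (Finset.univ.filter fun f : V → Fin m => f x0 = u0 ∧ J ⊆ Jset EH Y f) ⊆
      HH.biUnion fun h => Fintype.piFinset fun x => S x (h ((gr J).connectedComponentMk x)) := by
    intro f hf
    rw [Finset.mem_filter] at hf
    obtain ⟨-, hf0, hfJ⟩ := hf
    rw [Finset.mem_biUnion]
    refine ⟨fun c => f (rep c), ?_, ?_⟩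
    · rw [hHH, Fintype.mem_piFinset]
      intro c
      by_cases h : c = c0
      · simp only [h, if_true, hrep0, hf0, Finset.mem_singleton]
      · simp [h]
    · rw [Fintype.mem_piFinset]
      intro x
      rw [hS, Finset.mem_filter]
      refine ⟨Finset.mem_univ _, ?_⟩
      have hr : (gr J).Reachable (rep ((gr J).connectedComponentMk x)) x := by
        rw [← SimpleGraph.ConnectedComponent.eq]; exact hrepc _
      obtain ⟨w, hw⟩ := hr.exists_isPath
      exact Nb_iter_mono Y _ hw.length_lt.le (walk_mem hfJ w _ (Finset.mem_singleton_self _))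
  refine (Finset.card_le_card hsub).trans ?_
  rw [← hHcard]
  refine Finset.card_biUnion_le_card_mul _ _ _ fun h _ => ?_
  rw [Fintype.card_piFinset]
  refine (Finset.prod_le_prod' fun x _ => hScard x _).trans ?_
  rw [Finset.prod_const, Finset.card_univ]

lemma pow_bound {e v k c m : ℕ} {p Θ s : ℝ} (hm : 1 ≤ m) (h0 : 0 ≤ p) (hΘ : 1 ≤ Θ) (hs : 0 ≤ s)
    (hse : 1 ≤ s ^ e * m) (hp : p ^ e * (m:ℝ) ^ (v - 1) ≤ Θ) (hke : k < e) (hv : 1 ≤ v) (hc : 1 ≤ c)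
    (hkey : k * (v - 1) + e * c + 1 ≤ e * v) :
    p ^ (e - k) * (m:ℝ) ^ (c - 1) ≤ Θ * s := by
  have he : e ≠ 0 := by omega
  have hm1 : (1:ℝ) ≤ m := by exact_mod_cast hm
  have hm0 : (0:ℝ) < m := by linarith
  refine le_of_pow_le_pow_left₀ he (by positivity) ?_
  rw [mul_pow, mul_pow, ← pow_mul, ← pow_mul]
  have e1 : p ^ ((e - k) * e) * (m:ℝ) ^ ((v - 1) * (e - k)) ≤ Θ ^ e := by
    calc _ = (p ^ e * (m:ℝ) ^ (v - 1)) ^ (e - k) := by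
          rw [mul_pow, ← pow_mul, ← pow_mul, mul_comm e (e - k)]
      _ ≤ Θ ^ (e - k) := by gcongr
      _ ≤ Θ ^ e := pow_le_pow_right₀ hΘ (Nat.sub_le _ _)
  have e2 : (c - 1) * e + 1 ≤ (v - 1) * (e - k) := by
    obtain ⟨v', rfl⟩ : ∃ v', v = v' + 1 := ⟨v - 1, by omega⟩
    obtain ⟨c', rfl⟩ : ∃ c', c = c' + 1 := ⟨c - 1, by omega⟩
    obtain ⟨d, rfl⟩ : ∃ d, e = k + d := ⟨e - k, by omega⟩
    simp only [Nat.add_sub_cancel, Nat.add_sub_cancel_left] at *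
    nlinarith
  have e3 : (m:ℝ) ^ ((c - 1) * e) * m ≤ (m:ℝ) ^ ((v - 1) * (e - k)) := by
    rw [← pow_succ]; exact pow_le_pow_right₀ hm1 e2
  have hx : 0 ≤ p ^ ((e - k) * e) := by positivity
  have e4 : p ^ ((e - k) * e) * (m:ℝ) ^ ((c - 1) * e) * m ≤ Θ ^ e := by
    refine le_trans ?_ e1
    rw [mul_assoc]; gcongr
  have e5 : Θ ^ e ≤ Θ ^ e * (s ^ e * m) := le_mul_of_one_le_right (by positivity) hse
  have e6 : p ^ ((e - k) * e) * (m:ℝ) ^ ((c - 1) * e) * m ≤ Θ ^ e * s ^ e * m := by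
    rw [mul_assoc (Θ ^ e)]; linarith
  exact le_of_mul_le_mul_right e6 hm0

lemma q2 {EH : Finset (Sym2 V)} (hB : Bal EH) {Y : Finset (V → Fin m)} {D : ℕ} (hD : Deg Y D)
    (hm : 1 ≤ m) {j : V → Fin m} (hj : j ∈ Y) {p Θ s : ℝ} (h0 : 0 ≤ p) (hΘ : 1 ≤ Θ)
    (hs : 0 ≤ s) (hse : 1 ≤ s ^ #EH * m) (hp : p ^ #EH * (m:ℝ) ^ (Fintype.card V - 1) ≤ Θ) :
    ∑ f ∈ Finset.univ.filter (fun f : V → Fin m => ¬ Disjoint (Fc EH f) (Fc EH j) ∧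
      ¬ Fc EH f ⊆ Y.biUnion (Fc EH)), p ^ #(Fc EH f \ Y.biUnion (Fc EH)) ≤
    Fintype.card V * 2 ^ #EH *
      ((D * Fintype.card V + 1 : ℝ) ^ Fintype.card V) ^ Fintype.card V * (Θ * s) := by
  set Bd : ℝ := ((D * Fintype.card V + 1 : ℝ) ^ Fintype.card V) ^ Fintype.card V with hBd
  have hBd0 : 0 ≤ Bd := by positivity
  have hv := hB.two_le_card
  set PP := EH.powerset.filter fun J => J.Nonempty ∧ J ≠ EH with hPP
  calc _ ≤ ∑ f : V → Fin m, ∑ x : V, ∑ J ∈ PP,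
        (if f x = j x ∧ J ⊆ Jset EH Y f then p ^ (#EH - #J) else 0) := by
        rw [Finset.sum_filter]
        refine Finset.sum_le_sum fun f _ => ?_
        have hnn : ∀ x J, 0 ≤ (if f x = j x ∧ J ⊆ Jset EH Y f then p ^ (#EH - #J) else 0) := by
          intro x J; split_ifs <;> positivity
        split_ifs with h
        · obtain ⟨h1, h2⟩ := h
          rw [not_disjoint_Fc] at h1
          obtain ⟨a, ha, hax⟩ := h1
          rw [Fc_subset_biUnion] at h2
          rw [Fc_sdiff_card, Finset.card_sdiff_of_subset (Jset_subset _ _ _)]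
          have hout : (Quot.out a).1 ∈ a := Sym2.out_fst_mem a
          have hJ : Jset EH Y f ∈ PP := by
            rw [hPP, Finset.mem_filter, Finset.mem_powerset]
            exact ⟨Jset_subset _ _ _, ⟨a, Finset.mem_filter.2 ⟨ha, j, hj, hax⟩⟩, h2⟩
          calc p ^ (#EH - #(Jset EH Y f)) = (if f (Quot.out a).1 = j (Quot.out a).1 ∧
                Jset EH Y f ⊆ Jset EH Y f then p ^ (#EH - #(Jset EH Y f)) else 0) := by
                rw [if_pos ⟨hax _ hout, le_rfl⟩]
            _ ≤ ∑ J ∈ PP, (if f (Quot.out a).1 = j (Quot.out a).1 ∧ J ⊆ Jset EH Y f then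
                p ^ (#EH - #J) else 0) :=
                Finset.single_le_sum (f := fun J => (if f (Quot.out a).1 = j (Quot.out a).1 ∧
                J ⊆ Jset EH Y f then p ^ (#EH - #J) else 0)) (fun J _ => hnn _ J) hJ
            _ ≤ _ := Finset.single_le_sum (f := fun x => ∑ J ∈ PP, (if f x = j x ∧
                J ⊆ Jset EH Y f then p ^ (#EH - #J) else 0))
                (fun x _ => Finset.sum_nonneg fun J _ => hnn x J) (Finset.mem_univ _)
        · exact Finset.sum_nonneg fun x _ => Finset.sum_nonneg fun J _ => hnn x J
    _ = ∑ x : V, ∑ J ∈ PP, ∑ f : V → Fin m,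
        (if f x = j x ∧ J ⊆ Jset EH Y f then p ^ (#EH - #J) else 0) := by
        rw [Finset.sum_comm]
        exact Finset.sum_congr rfl fun x _ => Finset.sum_comm
    _ ≤ ∑ x : V, ∑ J ∈ PP, Bd * (Θ * s) := by
        refine Finset.sum_le_sum fun x _ => Finset.sum_le_sum fun J hJ => ?_
        rw [hPP, Finset.mem_filter, Finset.mem_powerset] at hJ
        obtain ⟨hJE, hJne, hJneE⟩ := hJ
        rw [← Finset.sum_filter, Finset.sum_const, nsmul_eq_mul]
        have hc := count_lemma (EH := EH) (J := J) hD x (j x)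
        have hc' : ((#(Finset.univ.filter fun f : V → Fin m => f x = j x ∧ J ⊆ Jset EH Y f) : ℕ) : ℝ)
            ≤ (m:ℝ) ^ (cc J - 1) * Bd := by
          rw [hBd]; exact_mod_cast hc
        have hlt : #J < #EH := Finset.card_lt_card (Finset.ssubset_iff_subset_ne.2 ⟨hJE, hJneE⟩)
        have hpb := pow_bound (k := #J) (c := cc J) hm h0 hΘ hs hse hp hlt (by omega) (cc_pos x)
          ((cc_key hB hJE).2 hJne hJneE)
        calc _ ≤ (m:ℝ) ^ (cc J - 1) * Bd * p ^ (#EH - #J) := by gcongr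
          _ = Bd * (p ^ (#EH - #J) * (m:ℝ) ^ (cc J - 1)) := by ring
          _ ≤ _ := by gcongr
    _ = (Fintype.card V : ℝ) * (#PP * (Bd * (Θ * s))) := by
        simp [Finset.sum_const, Finset.card_univ]
    _ ≤ Fintype.card V * ((2:ℝ) ^ #EH * (Bd * (Θ * s))) := by
        have : #PP ≤ 2 ^ #EH := by
          rw [← Finset.card_powerset]; exact Finset.card_le_card (Finset.filter_subset _ _)
        have : (#PP : ℝ) ≤ 2 ^ #EH := by exact_mod_cast this
        gcongr
    _ = _ := by ring

end Counting

set_option linter.unusedSectionVars false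

section Cover
open Finset
open scoped Classical
variable {V : Type} [Fintype V] [DecidableEq V] {m : ℕ}

/-- all edges of `f` in `A0` are covered by members of `W` inside `𝒢`. -/
def Cov (A0 : Finset (Sym2 V)) (𝒢 : Finset (V → Fin m)) (f : V → Fin m)
    (W : Finset (V → Fin m)) : Prop :=
  ∀ a ∈ A0, ∃ g ∈ W, g ∈ 𝒢 ∧ ∀ x ∈ a, f x = g x

/-- classes of a map `τ`. -/
noncomputable def cls (A0 : Finset (Sym2 V)) (τ : A0 → A0) (l : A0) : Finset (Sym2 V) :=
  (Finset.univ.filter fun a => τ a = l).map (Function.Embedding.subtype _)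

/-- copies agreeing with `f` on a class. -/
noncomputable def Gcls (A0 : Finset (Sym2 V)) (𝒢 : Finset (V → Fin m)) (f : V → Fin m)
    (τ : A0 → A0) (l : A0) : Finset (V → Fin m) :=
  𝒢.filter fun g => ∀ a : A0, τ a = l → ∀ x ∈ a.1, f x = g x

lemma cover_lemma (A0 : Finset (Sym2 V)) (hne : A0.Nonempty) (𝒢 : Finset (V → Fin m))
    (f : V → Fin m) {q : ℝ} (hq0 : 0 ≤ q) (hq1 : q ≤ 1) :
    Ex univ q (fun W => ind (Cov A0 𝒢 f W)) ≤
      ∑ τ : A0 → A0, ∏ l ∈ Finset.univ.image τ, (q * #(Gcls A0 𝒢 f τ l)) := by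
  have : Nonempty A0 := ⟨⟨hne.choose, hne.choose_spec⟩⟩
  set Φ : Finset (A0 → (V → Fin m)) := Finset.univ.filter fun φ =>
    ∀ a : A0, φ a ∈ 𝒢 ∧ ∀ x ∈ a.1, f x = φ a x with hΦ
  set tau : (A0 → (V → Fin m)) → (A0 → A0) := fun φ a => Function.invFun φ (φ a) with htau
  have ht1 : ∀ (φ : A0 → (V → Fin m)) (a : A0), φ (tau φ a) = φ a := fun φ a => Function.invFun_eq ⟨a, rfl⟩
  have hcardim : ∀ φ : A0 → (V → Fin m), #(Finset.univ.image φ) = #(Finset.univ.image (tau φ)) := by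
    intro φ
    have e1 : Finset.univ.image φ = (Finset.univ.image (tau φ)).image φ := by
      rw [Finset.image_image]
      refine Finset.image_congr fun a _ => ?_
      exact (ht1 φ a).symm
    rw [e1]
    apply Finset.card_image_of_injOn
    intro l hl k hk h
    obtain ⟨a, _, rfl⟩ := Finset.mem_image.1 (Finset.mem_coe.1 hl)
    obtain ⟨b, _, rfl⟩ := Finset.mem_image.1 (Finset.mem_coe.1 hk)
    simp only [ht1] at h
    rw [htau]; simp only; rw [h]
  calc Ex univ q (fun W => ind (Cov A0 𝒢 f W))
      ≤ Ex univ q (fun W => ∑ φ ∈ Φ, ind (Finset.univ.image φ ⊆ W)) := by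
        refine Ex_mono hq0 hq1 fun W _ => ?_
        refine le_trans (ind_mono ?_) (ind_exists_le Φ fun φ => Finset.univ.image φ ⊆ W)
        intro h
        choose g hgW hg𝒢 hgx using h
        refine ⟨fun a => g a.1 a.2, ?_, ?_⟩
        · rw [hΦ, Finset.mem_filter]
          exact ⟨Finset.mem_univ _, fun a => ⟨hg𝒢 a.1 a.2, hgx a.1 a.2⟩⟩
        · intro z hz
          obtain ⟨a, _, rfl⟩ := Finset.mem_image.1 hz
          exact hgW a.1 a.2
    _ = ∑ φ ∈ Φ, q ^ #(Finset.univ.image (tau φ)) := by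
        rw [Ex_sum]
        refine Finset.sum_congr rfl fun φ _ => ?_
        rw [Ex_subset (Finset.subset_univ _), hcardim]
    _ = ∑ τ : A0 → A0, ∑ φ ∈ Φ.filter (fun φ => tau φ = τ), q ^ #(Finset.univ.image (tau φ)) := by
        rw [Finset.sum_fiberwise]
    _ ≤ _ := by
        refine Finset.sum_le_sum fun τ _ => ?_
        rw [Finset.prod_mul_distrib, Finset.prod_const]
        have e2 : ∑ φ ∈ Φ.filter (fun φ => tau φ = τ), q ^ #(Finset.univ.image (tau φ)) =
            #(Φ.filter (fun φ => tau φ = τ)) * q ^ #(Finset.univ.image τ) := by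
          rw [← nsmul_eq_mul, ← Finset.sum_const]
          refine Finset.sum_congr rfl fun φ hφ => ?_
          rw [(Finset.mem_filter.1 hφ).2]
        rw [e2, mul_comm]
        refine mul_le_mul_of_nonneg_left ?_ (pow_nonneg hq0 _)
        rw [← Nat.cast_prod, Nat.cast_le, ← Finset.card_pi]
        apply Finset.card_le_card_of_injOn (fun φ l _ => φ l)
        · intro φ hφ
          rw [Finset.mem_coe, Finset.mem_filter, hΦ, Finset.mem_filter] at hφ
          obtain ⟨⟨-, hφ1⟩, rfl⟩ := hφ
          rw [Finset.mem_coe, Finset.mem_pi]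
          intro l _
          rw [Gcls, Finset.mem_filter]
          refine ⟨(hφ1 l).1, fun a ha x hx => ?_⟩
          show f x = φ l x
          rw [← ha, ht1 φ a]
          exact (hφ1 a).2 x hx
        · intro φ hφ ψ hψ h
          rw [Finset.mem_coe, Finset.mem_filter] at hφ hψ
          funext a
          rw [← ht1 φ a, ← ht1 ψ a, hφ.2, hψ.2]
          exact congrFun (congrFun h (τ a)) (Finset.mem_image_of_mem _ (Finset.mem_univ _))

lemma card_agree (X : Finset V) (f : V → Fin m) :
    #(Finset.univ.filter fun g : V → Fin m => ∀ x ∈ X, f x = g x) = m ^ (Fintype.card V - #X) := by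
  have : (Finset.univ.filter fun g : V → Fin m => ∀ x ∈ X, f x = g x) =
      Fintype.piFinset fun x => if x ∈ X then {f x} else Finset.univ := by
    ext g
    simp only [Finset.mem_filter, Finset.mem_univ, true_and, Fintype.mem_piFinset]
    refine forall_congr' fun x => ?_
    split_ifs with h
    · simp [h, eq_comm]
    · simp [h]
  rw [this, Fintype.card_piFinset]
  have : ∀ x : V, #(if x ∈ X then ({f x} : Finset (Fin m)) else Finset.univ) =
      if x ∈ X then 1 else m := by
    intro c; split_ifs <;> simp
  simp_rw [this]
  rw [Finset.prod_ite]
  simp only [Finset.prod_const, one_pow, one_mul]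
  congr 1
  rw [Finset.filter_notMem_eq_sdiff, Finset.card_sdiff_of_subset (Finset.subset_univ _),
    Finset.card_univ]

lemma cover_bound {EH : Finset (Sym2 V)} (hB : Bal EH) {A0 : Finset (Sym2 V)} (hA : A0 ⊆ EH)
    (hne : A0.Nonempty) (𝒢 : Finset (V → Fin m)) (f : V → Fin m) (hG : A0 = EH → f ∉ 𝒢)
    {q Θ : ℝ} (hq0 : 0 ≤ q) (hq1 : q ≤ 1) (hΘ : 1 ≤ Θ) (hm : 1 ≤ m)
    (hq : q * (m:ℝ) ^ (Fintype.card V - 1) ≤ Θ) :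
    Ex univ q (fun W => ind (Cov A0 𝒢 f W)) * (m:ℝ) ^ cc (EH \ A0) ≤ (#EH : ℝ) ^ #EH * Θ ^ #EH := by
  have hm1 : (1:ℝ) ≤ m := by exact_mod_cast hm
  have hm0 : (0:ℝ) < m := by linarith
  have hmain : ∀ τ : A0 → A0, (∏ l ∈ Finset.univ.image τ, (q * #(Gcls A0 𝒢 f τ l))) *
      (m:ℝ) ^ cc (EH \ A0) ≤ Θ ^ #EH := by
    intro τ
    by_cases hbad : ∃ l ∈ Finset.univ.image τ, cls A0 τ l = EH
    · obtain ⟨l, hl, hlE⟩ := hbad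
      have hAE : A0 = EH := by
        refine Finset.Subset.antisymm hA ?_
        rw [← hlE]
        intro a ha
        obtain ⟨b, _, rfl⟩ := Finset.mem_map.1 ha
        exact b.2
      have hz : Gcls A0 𝒢 f τ l = ∅ := by
        rw [Finset.eq_empty_iff_forall_notMem]
        intro g hg
        rw [Gcls, Finset.mem_filter] at hg
        have : f = g := by
          funext x
          have hx : x ∈ vs EH := by rw [hB.top]; exact Finset.mem_univ _
          rw [vs, Finset.mem_filter] at hx
          obtain ⟨-, a, ha, hxa⟩ := hx
          rw [← hlE] at ha
          obtain ⟨b, hb, rfl⟩ := Finset.mem_map.1 ha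
          exact hg.2 b (Finset.mem_filter.1 hb).2 x hxa
        exact hG hAE (this ▸ hg.1)
      rw [Finset.prod_eq_zero hl (by rw [hz]; simp), zero_mul]
      positivity
    · push Not at hbad
      have hsub : ∀ l, cls A0 τ l ⊆ EH := by
        intro l a ha
        obtain ⟨b, _, rfl⟩ := Finset.mem_map.1 ha
        exact hA b.2
      have hcne : ∀ l ∈ Finset.univ.image τ, (cls A0 τ l).Nonempty := by
        intro l hl
        obtain ⟨a, _, rfl⟩ := Finset.mem_image.1 hl
        exact ⟨a.1, Finset.mem_map.2 ⟨a, Finset.mem_filter.2 ⟨Finset.mem_univ _, rfl⟩, rfl⟩⟩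
      have hcardA : #A0 = ∑ l ∈ Finset.univ.image τ, #(cls A0 τ l) := by
        have h1 : #A0 = #(Finset.univ : Finset A0) := by
          rw [Finset.card_univ, Fintype.card_coe]
        rw [h1, Finset.card_eq_sum_card_image τ]
        exact Finset.sum_congr rfl fun l _ => by rw [cls, Finset.card_map]
      have hstar := star_ineq hB (J := EH \ A0) Finset.sdiff_subset (Finset.univ.image τ)
        (cls A0 τ) (fun l _ => hsub l) hcne hbad
        (by obtain ⟨a, ha⟩ := hne; exact ⟨τ ⟨a, ha⟩, Finset.mem_image_of_mem _ (Finset.mem_univ _)⟩)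
        (by rw [← hcardA, Finset.card_sdiff_of_subset hA]; omega)
      have hfac : ∀ l ∈ Finset.univ.image τ,
          q * #(Gcls A0 𝒢 f τ l) ≤ Θ / (m:ℝ) ^ (#(vs (cls A0 τ l)) - 1) := by
        intro l hl
        have h2 := hB.two_le (hsub l) (hcne l hl)
        have h3 : #(vs (cls A0 τ l)) ≤ Fintype.card V := Finset.card_le_univ _
        have h4 : #(Gcls A0 𝒢 f τ l) ≤ m ^ (Fintype.card V - #(vs (cls A0 τ l))) := by
          rw [← card_agree _ f]
          apply Finset.card_le_card
          intro g hg
          rw [Gcls, Finset.mem_filter] at hg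
          rw [Finset.mem_filter]
          refine ⟨Finset.mem_univ _, fun x hx => ?_⟩
          rw [vs, Finset.mem_filter] at hx
          obtain ⟨-, a, ha, hxa⟩ := hx
          obtain ⟨b, hb, rfl⟩ := Finset.mem_map.1 ha
          exact hg.2 b (Finset.mem_filter.1 hb).2 x hxa
        have h4' : (#(Gcls A0 𝒢 f τ l) : ℝ) ≤ (m:ℝ) ^ (Fintype.card V - #(vs (cls A0 τ l))) := by
          exact_mod_cast h4
        rw [le_div_iff₀ (by positivity)]
        calc _ ≤ q * (m:ℝ) ^ (Fintype.card V - #(vs (cls A0 τ l))) *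
              (m:ℝ) ^ (#(vs (cls A0 τ l)) - 1) := by gcongr
          _ = q * (m:ℝ) ^ (Fintype.card V - 1) := by
              rw [mul_assoc, ← pow_add]; congr 2; omega
          _ ≤ Θ := hq
      calc _ ≤ (∏ l ∈ Finset.univ.image τ, Θ / (m:ℝ) ^ (#(vs (cls A0 τ l)) - 1)) *
            (m:ℝ) ^ cc (EH \ A0) := by
            refine mul_le_mul_of_nonneg_right ?_ (by positivity)
            exact Finset.prod_le_prod (fun l _ => by positivity) hfac
        _ = Θ ^ #(Finset.univ.image τ) / (m:ℝ) ^ (∑ l ∈ Finset.univ.image τ,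
            (#(vs (cls A0 τ l)) - 1)) * (m:ℝ) ^ cc (EH \ A0) := by
            rw [Finset.prod_div_distrib, Finset.prod_const, Finset.prod_pow_eq_pow_sum]
        _ ≤ Θ ^ #(Finset.univ.image τ) := by
            rw [div_mul_eq_mul_div, div_le_iff₀ (by positivity)]
            gcongr
        _ ≤ Θ ^ #EH := by
            refine pow_le_pow_right₀ hΘ ?_
            refine (Finset.card_le_univ _).trans ?_
            rw [Fintype.card_coe]
            exact Finset.card_le_card hA
  calc _ ≤ (∑ τ : A0 → A0, ∏ l ∈ Finset.univ.image τ, (q * #(Gcls A0 𝒢 f τ l))) *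
        (m:ℝ) ^ cc (EH \ A0) := by
        gcongr
        exact cover_lemma A0 hne 𝒢 f hq0 hq1
    _ = ∑ τ : A0 → A0, (∏ l ∈ Finset.univ.image τ, (q * #(Gcls A0 𝒢 f τ l))) *
        (m:ℝ) ^ cc (EH \ A0) := by rw [Finset.sum_mul]
    _ ≤ ∑ τ : A0 → A0, Θ ^ #EH := Finset.sum_le_sum fun τ _ => hmain τ
    _ = (#A0 : ℝ) ^ #A0 * Θ ^ #EH := by
        rw [Finset.sum_const, Finset.card_univ, Fintype.card_fun, Fintype.card_coe, nsmul_eq_mul]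
        push_cast; rfl
    _ ≤ _ := by
        have h1 : #A0 ≤ #EH := Finset.card_le_card hA
        have h2 : 1 ≤ #EH := Finset.card_pos.2 hB.ne
        have : #A0 ^ #A0 ≤ #EH ^ #EH :=
          (Nat.pow_le_pow_left h1 _).trans (Nat.pow_le_pow_right h2 h1)
        have : (#A0 : ℝ) ^ #A0 ≤ (#EH : ℝ) ^ #EH := by exact_mod_cast this
        gcongr

lemma cc_empty : cc (∅ : Finset (Sym2 V)) = Fintype.card V := by
  have h : gr (∅ : Finset (Sym2 V)) = ⊥ := by simp [gr]
  apply le_antisymm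
  · exact Fintype.card_le_of_surjective (fun x => (gr (∅ : Finset (Sym2 V))).connectedComponentMk x)
      Quot.mk_surjective
  · refine Fintype.card_le_of_injective
      (fun x => (gr (∅ : Finset (Sym2 V))).connectedComponentMk x) ?_
    intro x y hxy
    have := SimpleGraph.ConnectedComponent.exact hxy
    rw [h] at this
    simpa using this

/-- Phase A: unwanted copies. -/
lemma q1A {EH : Finset (Sym2 V)} (hB : Bal EH) {σ q Θ : ℝ} (hσ0 : 0 ≤ σ) (hσ1 : σ ≤ 1)
    (hq0 : 0 ≤ q) (hq1 : q ≤ 1) (hΘ : 1 ≤ Θ) (hm : 1 ≤ m)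
    (hq : σ * q * (m:ℝ) ^ (Fintype.card V - 1) ≤ Θ) :
    Ex univ σ (fun I => Ex univ q (fun Y =>
      ind (∃ f : V → Fin m, f ∈ I ∧ f ∉ I ∩ Y ∧ Jset EH (I ∩ Y) f = EH))) ≤
      σ * ((#EH : ℝ) ^ #EH * Θ ^ #EH) := by
  have hm1 : (1:ℝ) ≤ m := by exact_mod_cast hm
  have hm0 : (0:ℝ) < m := by linarith
  have hf : ∀ f : V → Fin m, Ex univ σ (fun I => Ex univ q (fun Y =>
      ind (f ∈ I) * ind (Cov EH (univ.erase f) f (I ∩ Y)))) ≤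
      σ * ((#EH : ℝ) ^ #EH * Θ ^ #EH / (m:ℝ) ^ Fintype.card V) := by
    intro f
    simp_rw [Ex_mul]
    rw [Ex_coord_eq (g := fun I => Ex univ q (fun Y => ind (Cov EH (univ.erase f) f (I ∩ Y))))
      (Finset.mem_univ f), Ex_inter univ σ q (fun W => ind (Cov EH (univ.erase f) f W))]
    · refine mul_le_mul_of_nonneg_left ?_ hσ0
      rw [le_div_iff₀ (by positivity)]
      have := cover_bound hB le_rfl hB.ne (univ.erase f) f (fun _ => Finset.notMem_erase _ _)
        (mul_nonneg hσ0 hq0) (mul_le_one₀ hσ1 hq0 hq1) hΘ hm hq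
      rwa [Finset.sdiff_self, cc_empty] at this
    · intro A hA
      refine Ex_congr fun Y _ => ind_congr ?_
      refine forall₂_congr fun a _ => exists_congr fun g => ?_
      simp only [Finset.mem_inter, Finset.mem_insert, Finset.mem_erase]
      constructor
      · rintro ⟨⟨h1 | h1, h2⟩, h3, h4⟩
        · exact absurd h1 h3.1
        · exact ⟨⟨h1, h2⟩, h3, h4⟩
      · rintro ⟨⟨h1, h2⟩, h3, h4⟩
        exact ⟨⟨Or.inr h1, h2⟩, h3, h4⟩
  calc _ ≤ Ex univ σ (fun I => Ex univ q (fun Y => ∑ f : V → Fin m,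
        ind (f ∈ I) * ind (Cov EH (univ.erase f) f (I ∩ Y)))) := by
        refine Ex_mono hσ0 hσ1 fun I _ => Ex_mono hq0 hq1 fun Y _ => ?_
        simp_rw [← ind_and]
        refine le_trans (ind_mono ?_) (ind_exists_le univ
          fun f => f ∈ I ∧ Cov EH (univ.erase f) f (I ∩ Y))
        rintro ⟨f, h1, h2, h3⟩
        refine ⟨f, Finset.mem_univ _, h1, fun a ha => ?_⟩
        rw [← h3, Jset, Finset.mem_filter] at ha
        obtain ⟨-, g, hg, hgx⟩ := ha
        exact ⟨g, hg, Finset.mem_erase.2 ⟨fun h => h2 (h ▸ hg), Finset.mem_univ _⟩, hgx⟩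
    _ = ∑ f : V → Fin m, Ex univ σ (fun I => Ex univ q (fun Y =>
        ind (f ∈ I) * ind (Cov EH (univ.erase f) f (I ∩ Y)))) := by
        simp_rw [Ex_sum]
    _ ≤ ∑ f : V → Fin m, σ * ((#EH : ℝ) ^ #EH * Θ ^ #EH / (m:ℝ) ^ Fintype.card V) :=
        Finset.sum_le_sum fun f _ => hf f
    _ = _ := by
        rw [Finset.sum_const, Finset.card_univ, Fintype.card_fun, Fintype.card_fin, nsmul_eq_mul]
        push_cast
        field_simp

/-- partial matchings. -/
def IsPM (T : Finset (V → Fin m)) : Prop := ∀ g ∈ T, ∀ h ∈ T, ∀ x, g x = h x → g = h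

lemma IsPM.deg {T : Finset (V → Fin m)} (hT : IsPM T) : Deg T 1 := by
  intro x u
  rw [Finset.card_le_one]
  intro g hg h hh
  rw [Finset.mem_filter] at hg hh
  exact hT g hg.1 h hh.1 x (hg.2.trans hh.2.symm)

lemma IsPM.Jset_ne {EH : Finset (Sym2 V)} (hB : Bal EH) {T : Finset (V → Fin m)} (hT : IsPM T)
    {f j : V → Fin m} (hj : j ∈ T) (hfj : f ≠ j) (x0 : V) (hx0 : f x0 = j x0) :
    Jset EH T f ≠ EH := by
  intro hJ
  apply hfj
  funext y
  obtain ⟨w⟩ := gr_EH_preconnected hB x0 y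
  induction w with
  | nil => exact hx0
  | cons h w ih =>
    refine ih ?_
    rw [gr, SimpleGraph.fromEdgeSet_adj] at h
    have h1 := h.1
    rw [Finset.mem_coe, ← hJ, Jset, Finset.mem_filter] at h1
    obtain ⟨-, g, hg, hgx⟩ := h1
    have e1 := hgx _ (Sym2.mem_mk_left _ _)
    have e2 := hgx _ (Sym2.mem_mk_right _ _)
    have : g = j := hT g hg j hj _ (e1.symm.trans hx0)
    rw [e2, this]

/-- Phase B: unwanted copies. -/
lemma q1B {EH : Finset (Sym2 V)} (hB : Bal EH) {q Θ : ℝ}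
    (hq0 : 0 ≤ q) (hq1 : q ≤ 1) (hΘ : 1 ≤ Θ) (hm : 1 ≤ m)
    (hq : q * (m:ℝ) ^ (Fintype.card V - 1) ≤ Θ) {T : Finset (V → Fin m)} (hT : IsPM T)
    {j : V → Fin m} (hj : j ∈ T) :
    ∑ f ∈ Finset.univ.filter (fun f : V → Fin m => f ≠ j ∧ ¬ Disjoint (Fc EH f) (Fc EH j)),
      Ex univ q (fun W => ind (Jset EH (W ∪ T) f = EH)) ≤
    Fintype.card V * 2 ^ #EH * ((1 * Fintype.card V + 1 : ℝ) ^ Fintype.card V) ^ Fintype.card V *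
      ((#EH : ℝ) ^ #EH * Θ ^ #EH / m) := by
  have hm1 : (1:ℝ) ≤ m := by exact_mod_cast hm
  have hm0 : (0:ℝ) < m := by linarith
  set Bd : ℝ := ((1 * Fintype.card V + 1 : ℝ) ^ Fintype.card V) ^ Fintype.card V with hBd
  have hBd0 : 0 ≤ Bd := by positivity
  set K : ℝ := (#EH : ℝ) ^ #EH * Θ ^ #EH with hK
  have hK0 : 0 ≤ K := by positivity
  set PP := EH.powerset with hPP
  calc _ ≤ ∑ f : V → Fin m, ∑ x : V, ∑ J ∈ PP,
        (if f x = j x ∧ J ⊆ Jset EH T f then K / (m:ℝ) ^ cc J else 0) := by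
        rw [Finset.sum_filter]
        refine Finset.sum_le_sum fun f _ => ?_
        have hnn : ∀ x J, 0 ≤ (if f x = j x ∧ J ⊆ Jset EH T f then K / (m:ℝ) ^ cc J else 0) := by
          intro x J; split_ifs <;> positivity
        split_ifs with h
        · obtain ⟨h2, h1⟩ := h
          rw [not_disjoint_Fc] at h1
          obtain ⟨a, ha, hax⟩ := h1
          have hout : (Quot.out a).1 ∈ a := Sym2.out_fst_mem a
          have hJ : Jset EH T f ∈ PP := Finset.mem_powerset.2 (Jset_subset _ _ _)
          have hJne : Jset EH T f ≠ EH := hT.Jset_ne hB hj h2 _ (hax _ hout)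
          have hJn : (Jset EH T f).Nonempty := ⟨a, Finset.mem_filter.2 ⟨ha, j, hj, hax⟩⟩
          calc Ex univ q (fun W => ind (Jset EH (W ∪ T) f = EH))
              ≤ Ex univ q (fun W => ind (Cov (EH \ Jset EH T f) univ f W)) := by
                refine Ex_mono hq0 hq1 fun W _ => ind_mono fun h => ?_
                intro b hb
                rw [Finset.mem_sdiff] at hb
                have hb1 := hb.1
                rw [← h, Jset, Finset.mem_filter] at hb1
                obtain ⟨-, g, hg, hgx⟩ := hb1
                rcases Finset.mem_union.1 hg with hg | hg
                · exact ⟨g, hg, Finset.mem_univ _, hgx⟩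
                · exact absurd (Finset.mem_filter.2 ⟨hb.1, g, hg, hgx⟩) hb.2
            _ ≤ K / (m:ℝ) ^ cc (Jset EH T f) := by
                rw [le_div_iff₀ (by positivity)]
                have := cover_bound hB (A0 := EH \ Jset EH T f) Finset.sdiff_subset
                  (Finset.sdiff_nonempty.2 fun hh => hJne
                    (Finset.Subset.antisymm (Jset_subset _ _ _) hh)) univ f
                  (fun hh => absurd hh (by
                    intro hh
                    obtain ⟨b, hb⟩ := hJn
                    have hb2 := Jset_subset _ _ _ hb
                    rw [← hh, Finset.mem_sdiff] at hb2
                    exact hb2.2 hb)) hq0 hq1 hΘ hm hq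
                rwa [Finset.sdiff_sdiff_eq_self (Jset_subset _ _ _)] at this
            _ = (if f (Quot.out a).1 = j (Quot.out a).1 ∧
                Jset EH T f ⊆ Jset EH T f then K / (m:ℝ) ^ cc (Jset EH T f) else 0) := by
                rw [if_pos ⟨hax _ hout, le_rfl⟩]
            _ ≤ ∑ J ∈ PP, (if f (Quot.out a).1 = j (Quot.out a).1 ∧ J ⊆ Jset EH T f then
                K / (m:ℝ) ^ cc J else 0) :=
                Finset.single_le_sum (f := fun J => (if f (Quot.out a).1 = j (Quot.out a).1 ∧
                J ⊆ Jset EH T f then K / (m:ℝ) ^ cc J else 0)) (fun J _ => hnn _ J) hJ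
            _ ≤ _ := Finset.single_le_sum (f := fun x => ∑ J ∈ PP, (if f x = j x ∧
                J ⊆ Jset EH T f then K / (m:ℝ) ^ cc J else 0))
                (fun x _ => Finset.sum_nonneg fun J _ => hnn x J) (Finset.mem_univ _)
        · exact Finset.sum_nonneg fun x _ => Finset.sum_nonneg fun J _ => hnn x J
    _ = ∑ x : V, ∑ J ∈ PP, ∑ f : V → Fin m,
        (if f x = j x ∧ J ⊆ Jset EH T f then K / (m:ℝ) ^ cc J else 0) := by
        rw [Finset.sum_comm]
        exact Finset.sum_congr rfl fun x _ => Finset.sum_comm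
    _ ≤ ∑ x : V, ∑ J ∈ PP, Bd * (K / m) := by
        refine Finset.sum_le_sum fun x _ => Finset.sum_le_sum fun J hJ => ?_
        rw [← Finset.sum_filter, Finset.sum_const, nsmul_eq_mul]
        have hc := count_lemma (EH := EH) (J := J) hT.deg x (j x)
        have hc' : ((#(Finset.univ.filter fun f : V → Fin m => f x = j x ∧ J ⊆ Jset EH T f) : ℕ) : ℝ)
            ≤ (m:ℝ) ^ (cc J - 1) * Bd := by
          rw [hBd]; exact_mod_cast hc
        have hpos := cc_pos (J := J) x
        have hcc : (m:ℝ) ^ cc J = (m:ℝ) ^ (cc J - 1) * m := by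
          rw [← pow_succ]; congr 1; omega
        calc _ ≤ (m:ℝ) ^ (cc J - 1) * Bd * (K / (m:ℝ) ^ cc J) := by gcongr
          _ = Bd * (K / m) := by rw [hcc]; field_simp
    _ = (Fintype.card V : ℝ) * (#PP * (Bd * (K / m))) := by
        simp [Finset.sum_const, Finset.card_univ]
    _ = _ := by
        rw [hPP, Finset.card_powerset]; push_cast; ring

lemma Ex_two_pow {α : Type*} [DecidableEq α] (s : Finset α) (p : ℝ) :
    Ex s p (fun A => (2:ℝ) ^ #A) = (1 + p) ^ #s := by
  induction s using Finset.induction_on with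
  | empty => simp [Ex_empty]
  | insert a s ha ih =>
    rw [Ex_insert ha]
    have : Ex s p (fun A => (2:ℝ) ^ #(insert a A)) = Ex s p (fun A => 2 * (2:ℝ) ^ #A) :=
      Ex_congr fun A hA => by rw [card_insert_of_notMem fun h => ha (hA h), pow_succ]; ring
    rw [this, Ex_mul, ih, card_insert_of_notMem ha]; ring

lemma deg_tail {q Θ : ℝ} (hq0 : 0 ≤ q) (hq1 : q ≤ 1)
    (hq : q * (m:ℝ) ^ (Fintype.card V - 1) ≤ Θ) (D : ℕ) :
    Ex univ q (fun W : Finset (V → Fin m) => ind (¬ Deg W D)) ≤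
      Fintype.card V * m * (Real.exp Θ / 2 ^ D) := by
  have h1 : ∀ (x : V) (u : Fin m), Ex univ q (fun W : Finset (V → Fin m) =>
      ind (D < #(W.filter fun f => f x = u))) ≤ Real.exp Θ / 2 ^ D := by
    intro x u
    set t : Finset (V → Fin m) := Finset.univ.filter fun f => f x = u with ht
    have hcard : #t = m ^ (Fintype.card V - 1) := by
      have := card_agree {x} (fun _ : V => u)
      rw [Finset.card_singleton] at this
      rw [← this, ht]
      congr 1
      ext f; simp [eq_comm]
    rw [le_div_iff₀ (by positivity), mul_comm, ← Ex_mul]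
    calc _ ≤ Ex univ q (fun W : Finset (V → Fin m) => (2:ℝ) ^ #(W ∩ t)) := by
          refine Ex_mono hq0 hq1 fun W _ => ?_
          have e : W.filter (fun f => f x = u) = W ∩ t := by
            ext f; simp [ht]
          rw [e]
          by_cases h : D < #(W ∩ t)
          · rw [ind_true h, mul_one]; exact pow_le_pow_right₀ (by norm_num) h.le
          · rw [ind_false h, mul_zero]; positivity
      _ = (1 + q) ^ #t := by
          rw [Ex_restrict (Finset.subset_univ t) q (fun A => (2:ℝ) ^ #A), Ex_two_pow]
      _ ≤ Real.exp q ^ #t := by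
          gcongr; rw [add_comm]; exact Real.add_one_le_exp q
      _ = Real.exp (q * (m:ℝ) ^ (Fintype.card V - 1)) := by
          rw [← Real.exp_nat_mul, hcard]; push_cast; rw [mul_comm]
      _ ≤ _ := Real.exp_le_exp.2 hq
  calc _ ≤ Ex univ q (fun W : Finset (V → Fin m) => ∑ x : V, ∑ u : Fin m,
        ind (D < #(W.filter fun f => f x = u))) := by
        refine Ex_mono hq0 hq1 fun W _ => ?_
        rw [← Finset.sum_product']
        refine le_trans (ind_mono ?_) (ind_exists_le (univ ×ˢ univ)
          fun b : V × Fin m => D < #(W.filter fun f => f b.1 = b.2))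
        intro h
        unfold Deg at h
        push Not at h
        obtain ⟨x, u, h⟩ := h
        exact ⟨(x, u), by simp, h⟩
    _ = ∑ x : V, ∑ u : Fin m, Ex univ q (fun W : Finset (V → Fin m) =>
        ind (D < #(W.filter fun f => f x = u))) := by
        rw [Ex_sum]; simp_rw [Ex_sum]
    _ ≤ ∑ x : V, ∑ u : Fin m, Real.exp Θ / 2 ^ D :=
        Finset.sum_le_sum fun x _ => Finset.sum_le_sum fun u _ => h1 x u
    _ = _ := by simp [Finset.sum_const, Finset.card_univ]; ring

lemma Deg.union {W T : Finset (V → Fin m)} {D : ℕ} (hW : Deg W D) (hT : IsPM T) :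
    Deg (W ∪ T) (D + 1) := by
  intro x u
  rw [Finset.filter_union]
  exact (Finset.card_union_le _ _).trans (add_le_add (hW x u) (hT.deg x u))

end Cover

set_option linter.unusedSectionVars false

section PMs
open Finset
open scoped Classical

lemma fact_bound (k t : ℕ) :
    ((k + t : ℕ) : ℝ) ^ t * (k.factorial : ℝ) ≤ Real.exp 1 ^ t * ((k + t).factorial : ℝ) := by
  induction t with
  | zero => simp
  | succ t ih =>
    have h1 : ((k + t + 1 : ℕ) : ℝ) ^ t ≤ Real.exp 1 * ((k + t : ℕ) : ℝ) ^ t := by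
      rcases Nat.eq_zero_or_pos (k + t) with h | h
      · have : t = 0 := by omega
        subst this
        simp only [pow_zero, mul_one]
        exact Real.one_le_exp zero_le_one
      · have hp : (0:ℝ) < ((k + t : ℕ) : ℝ) := by exact_mod_cast h
        have h2 : ((k + t + 1 : ℕ) : ℝ) ≤ Real.exp (1 / ((k + t : ℕ) : ℝ)) * ((k + t : ℕ) : ℝ) := by
          have := Real.add_one_le_exp (1 / ((k + t : ℕ) : ℝ))
          calc ((k + t + 1 : ℕ) : ℝ) = (1 / ((k + t : ℕ) : ℝ) + 1) * ((k + t : ℕ) : ℝ) := by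
                field_simp; push_cast; ring
            _ ≤ _ := by gcongr
        calc ((k + t + 1 : ℕ) : ℝ) ^ t ≤ (Real.exp (1 / ((k + t : ℕ) : ℝ)) * ((k + t : ℕ) : ℝ)) ^ t := by
              gcongr
          _ = Real.exp (t * (1 / ((k + t : ℕ) : ℝ))) * ((k + t : ℕ) : ℝ) ^ t := by
              rw [mul_pow, ← Real.exp_nat_mul]
          _ ≤ _ := by
              gcongr
              rw [mul_one_div, div_le_one hp]
              exact_mod_cast Nat.le_add_left t k
    have e : k + (t + 1) = k + t + 1 := by omega
    rw [e, Nat.factorial_succ, pow_succ]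
    push_cast at *
    calc _ = ((k:ℝ) + t + 1) * (((k:ℝ) + t + 1) ^ t * k.factorial) := by ring
      _ ≤ ((k:ℝ) + t + 1) * ((Real.exp 1 * ((k:ℝ) + t) ^ t) * k.factorial) := by gcongr
      _ = ((k:ℝ) + t + 1) * Real.exp 1 * (((k:ℝ) + t) ^ t * k.factorial) := by ring
      _ ≤ ((k:ℝ) + t + 1) * Real.exp 1 * (Real.exp 1 ^ t * (k + t).factorial) := by gcongr
      _ = _ := by ring

lemma fact_bound' {m t : ℕ} (hm : 1 ≤ m) (ht : t ≤ m) :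
    ((m - t).factorial : ℝ) / (m.factorial : ℝ) ≤ (Real.exp 1 / m) ^ t := by
  have := fact_bound (m - t) t
  rw [Nat.sub_add_cancel ht] at this
  have hm0 : (0:ℝ) < m := by exact_mod_cast hm
  have hf : (0:ℝ) < (m.factorial : ℝ) := by exact_mod_cast Nat.factorial_pos m
  rw [div_pow, div_le_div_iff₀ hf (by positivity)]
  linarith

lemma card_perm_prescribed {m : ℕ} (A : Finset (Fin m)) (g : Fin m → Fin m) :
    #(Finset.univ.filter fun π : Equiv.Perm (Fin m) => ∀ i ∈ A, π i = g i) ≤ (m - #A).factorial := by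
  rcases (Finset.univ.filter fun π : Equiv.Perm (Fin m) => ∀ i ∈ A, π i = g i).eq_empty_or_nonempty
    with h | ⟨π0, h0⟩
  · rw [h]; simp
  · rw [Finset.mem_filter] at h0
    have hc : Fintype.card {f : Equiv.Perm (Fin m) // ∀ a, ¬ (a ∉ A) → f a = a} = (m - #A).factorial := by
      rw [← Fintype.card_congr (Equiv.Perm.subtypeEquivSubtypePerm (fun a => a ∉ A)),
        Fintype.card_perm]
      congr 1
      rw [Fintype.card_subtype_compl, Fintype.card_fin, Fintype.card_coe]
    rw [← hc, ← Fintype.card_coe]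
    refine Fintype.card_le_of_injective (fun π => ⟨π0⁻¹ * π.1, ?_⟩) ?_
    · intro a ha
      rw [not_not] at ha
      have := (Finset.mem_filter.1 π.2).2 a ha
      rw [Equiv.Perm.mul_apply, this, ← h0.2 a ha]
      simp
    · intro π π' h
      have := congrArg Subtype.val h
      exact Subtype.ext (mul_left_cancel this)

variable {V : Type} [Fintype V] [DecidableEq V] {m : ℕ}

/-- perfect matching from permutations. -/
noncomputable def pmSet (x0 : V) (σ : V → Equiv.Perm (Fin m)) : Finset (V → Fin m) :=
  Finset.univ.image fun i : Fin m => fun x => if x = x0 then i else σ x i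

lemma mem_pmSet {x0 : V} {σ : V → Equiv.Perm (Fin m)} {f : V → Fin m} :
    f ∈ pmSet x0 σ ↔ ∀ x, x ≠ x0 → f x = σ x (f x0) := by
  rw [pmSet, Finset.mem_image]
  constructor
  · rintro ⟨i, -, rfl⟩ x hx
    simp [hx]
  · intro h
    refine ⟨f x0, Finset.mem_univ _, ?_⟩
    funext x
    by_cases hx : x = x0
    · simp [hx]
    · simp [hx, h x hx]

lemma pmSet_isPM (x0 : V) (σ : V → Equiv.Perm (Fin m)) : IsPM (pmSet x0 σ) := by
  intro g hg h hh x hx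
  rw [mem_pmSet] at hg hh
  have h0 : g x0 = h x0 := by
    by_cases hxx : x = x0
    · rw [← hxx]; exact hx
    · rw [hg x hxx, hh x hxx] at hx
      exact (σ x).injective hx
  funext z
  by_cases hz : z = x0
  · rw [hz, h0]
  · rw [hg z hz, hh z hz, h0]

lemma pmSet_card (x0 : V) (σ : V → Equiv.Perm (Fin m)) : #(pmSet x0 σ) = m := by
  rw [pmSet, Finset.card_image_of_injective, Finset.card_univ, Fintype.card_fin]
  intro i j h
  have := congrFun h x0
  simpa using this

/-- the uniform weight. -/
noncomputable def muU (V : Type) [Fintype V] (m : ℕ) : ℝ := 1 / (m.factorial : ℝ) ^ Fintype.card V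

lemma muU_nonneg : 0 ≤ muU V m := by unfold muU; positivity

lemma muU_sum : ∑ _σ : V → Equiv.Perm (Fin m), muU V m = 1 := by
  rw [Finset.sum_const, Finset.card_univ, Fintype.card_fun, Fintype.card_perm, Fintype.card_fin,
    nsmul_eq_mul, muU]
  have : (0:ℝ) < (m.factorial : ℝ) := by exact_mod_cast Nat.factorial_pos m
  push_cast
  field_simp

lemma pm_spread (x0 : V) (hm : 1 ≤ m) (P : Finset (V → Fin m)) :
    ∑ σ : V → Equiv.Perm (Fin m), muU V m * ind (P ⊆ pmSet x0 σ) ≤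
      ((Real.exp 1 / m) ^ (Fintype.card V - 1)) ^ #P := by
  by_cases hP : ∃ σ : V → Equiv.Perm (Fin m), P ⊆ pmSet x0 σ
  · obtain ⟨σ0, h0⟩ := hP
    have hf : (0:ℝ) < (m.factorial : ℝ) := by exact_mod_cast Nat.factorial_pos m
    set A := P.image fun f => f x0 with hA
    have hAc : #A = #P := Finset.card_image_of_injOn fun f hf g hg h =>
      pmSet_isPM x0 σ0 f (h0 hf) g (h0 hg) x0 h
    have hPm : #P ≤ m := (Finset.card_le_card h0).trans (pmSet_card x0 σ0).le
    have hcount : #(Finset.univ.filter fun σ : V → Equiv.Perm (Fin m) => P ⊆ pmSet x0 σ) ≤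
        m.factorial * (m - #P).factorial ^ (Fintype.card V - 1) := by
      calc _ ≤ #(Fintype.piFinset fun x : V => Finset.univ.filter fun π : Equiv.Perm (Fin m) =>
              x ≠ x0 → ∀ i ∈ A, π i = σ0 x i) := by
            refine Finset.card_le_card fun σ hσ => ?_
            rw [Finset.mem_filter] at hσ
            rw [Fintype.mem_piFinset]
            intro x
            rw [Finset.mem_filter]
            refine ⟨Finset.mem_univ _, fun hx i hi => ?_⟩
            obtain ⟨f, hf, rfl⟩ := Finset.mem_image.1 hi
            rw [← mem_pmSet.1 (hσ.2 hf) x hx, ← mem_pmSet.1 (h0 hf) x hx]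
        _ = ∏ x : V, #(Finset.univ.filter fun π : Equiv.Perm (Fin m) =>
              x ≠ x0 → ∀ i ∈ A, π i = σ0 x i) := Fintype.card_piFinset _
        _ ≤ ∏ x : V, (if x = x0 then m.factorial else (m - #P).factorial) := by
            refine Finset.prod_le_prod' fun x _ => ?_
            split_ifs with h
            · refine (Finset.card_le_univ _).trans ?_
              rw [Fintype.card_perm, Fintype.card_fin]
            · rw [← hAc]
              refine le_trans (le_of_eq ?_) (card_perm_prescribed A (σ0 x))
              congr 1
              refine Finset.filter_congr fun π _ => ?_
              simp [h]
        _ = _ := by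
            rw [Finset.prod_ite, Finset.prod_const, Finset.prod_const, Finset.filter_eq', if_pos
              (Finset.mem_univ _), Finset.card_singleton, pow_one, Finset.filter_ne',
              Finset.card_erase_of_mem (Finset.mem_univ _), Finset.card_univ]
    have hv : 1 ≤ Fintype.card V := Fintype.card_pos_iff.2 ⟨x0⟩
    calc _ = muU V m * #(Finset.univ.filter fun σ : V → Equiv.Perm (Fin m) => P ⊆ pmSet x0 σ) := by
          rw [← Finset.mul_sum]
          congr 1
          rw [Finset.card_filter]
          push_cast
          exact Finset.sum_congr rfl fun σ _ => by unfold ind; congr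
      _ ≤ muU V m * (m.factorial * (m - #P).factorial ^ (Fintype.card V - 1)) := by
          refine mul_le_mul_of_nonneg_left ?_ muU_nonneg
          exact_mod_cast hcount
      _ = (((m - #P).factorial : ℝ) / m.factorial) ^ (Fintype.card V - 1) := by
          rw [muU, div_pow]
          have : (m.factorial : ℝ) ^ Fintype.card V = m.factorial * (m.factorial : ℝ) ^ (Fintype.card V - 1) := by
            rw [← pow_succ', Nat.sub_add_cancel hv]
          rw [this]
          field_simp
      _ ≤ ((Real.exp 1 / m) ^ #P) ^ (Fintype.card V - 1) := by
          gcongr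
          exact fact_bound' hm hPm
      _ = _ := by rw [← pow_mul, ← pow_mul, mul_comm]
  · push Not at hP
    rw [Finset.sum_eq_zero]
    · positivity
    · intro σ _
      rw [ind_false (hP σ), mul_zero]

end PMs

set_option linter.unusedSectionVars false

section Phases
open Finset
open scoped Classical
variable {V : Type} [Fintype V] [DecidableEq V] {m : ℕ}

/-- the copies present in `G`. -/
noncomputable def copies (EH : Finset (Sym2 V)) (G : Finset (Sym2 (V × Fin m))) :
    Finset (V → Fin m) := Finset.univ.filter fun f => Fc EH f ⊆ G

/-- `σ` can be replaced with respect to `R`. -/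
def AA (x0 : V) (a : ℕ) (R : Finset (V → Fin m)) (σ : V → Equiv.Perm (Fin m)) : Prop :=
  ∃ σ' : V → Equiv.Perm (Fin m), pmSet x0 σ' ⊆ R ∪ pmSet x0 σ ∧ #(pmSet x0 σ' \ R) ≤ a

lemma AA_mono {x0 : V} {a : ℕ} {R R' : Finset (V → Fin m)} (h : R ⊆ R')
    {σ : V → Equiv.Perm (Fin m)} (hA : AA x0 a R σ) : AA x0 a R' σ := by
  obtain ⟨σ', h1, h2⟩ := hA
  exact ⟨σ', h1.trans (Finset.union_subset_union_left h),
    (Finset.card_le_card (Finset.sdiff_subset_sdiff le_rfl h)).trans h2⟩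

/-- most `σ` can be replaced. -/
def UA (x0 : V) (a : ℕ) (R : Finset (V → Fin m)) : Prop :=
  1 / 2 ≤ ∑ σ : V → Equiv.Perm (Fin m), muU V m * ind (AA x0 a R σ)

lemma UA_mono {x0 : V} {a : ℕ} {R R' : Finset (V → Fin m)} (h : R ⊆ R') (hA : UA x0 a R) :
    UA x0 a R' := by
  refine le_trans hA ?_
  exact Finset.sum_le_sum fun σ _ => mul_le_mul_of_nonneg_left (ind_mono (AA_mono h)) muU_nonneg

lemma not_UA_le (x0 : V) (a : ℕ) (R : Finset (V → Fin m)) :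
    ind (¬ UA x0 a R) ≤
      2 * ∑ σ : V → Equiv.Perm (Fin m), muU V m * ind (¬ AA x0 a R σ) := by
  have h0 : 0 ≤ ∑ σ : V → Equiv.Perm (Fin m), muU V m * ind (¬ AA x0 a R σ) :=
    Finset.sum_nonneg fun σ _ => mul_nonneg muU_nonneg (ind_nonneg _)
  by_cases h : UA x0 a R
  · rw [ind_false (not_not.2 h)]; linarith
  · rw [ind_true h]
    unfold UA at h
    push Not at h
    have : ∑ σ : V → Equiv.Perm (Fin m), muU V m * ind (¬ AA x0 a R σ) =
        1 - ∑ σ : V → Equiv.Perm (Fin m), muU V m * ind (AA x0 a R σ) := by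
      rw [← muU_sum (V := V) (m := m), ← Finset.sum_sub_distrib]
      exact Finset.sum_congr rfl fun σ _ => by rw [ind_not]; ring
    linarith

/-- the error bound of `q2`. -/
noncomputable def bd2 (v e D : ℕ) (x : ℝ) : ℝ :=
  v * 2 ^ e * ((D * v + 1 : ℝ) ^ v) ^ v * x

lemma phaseA {EH : Finset (Sym2 V)} (hB : Bal EH) (x0 : V) (hm : 1 ≤ m)
    {y ρ σ q p Θ Θ' s : ℝ} {L D : ℕ} (hy0 : 0 ≤ y) (hy : y ≤ 1 / 4) (hρ0 : 0 < ρ) (hρ : ρ ≤ 1)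
    (hsp : (Real.exp 1 / m) ^ (Fintype.card V - 1) ≤ y ^ 2 * ρ)
    (hL : ∀ i < L, 0 < m / 2 ^ i) (hσ0 : 0 ≤ σ) (hσ1 : σ ≤ 1) (hq0 : 0 ≤ q) (hq1 : q ≤ 1)
    (hσq : σ * q = piL ρ L) (hp0 : 0 ≤ p) (hp1 : p ≤ 1) (hqp : q ≤ p ^ #EH / 2)
    (hΘ : 1 ≤ Θ) (hqΘ : σ * q * (m:ℝ) ^ (Fintype.card V - 1) ≤ Θ) (hΘ' : 1 ≤ Θ')
    (hpΘ : p ^ #EH * (m:ℝ) ^ (Fintype.card V - 1) ≤ Θ') (hs : 0 ≤ s) (hse : 1 ≤ s ^ #EH * m)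
    (hbd : bd2 (Fintype.card V) #EH D (Θ' * s) ≤ 1 / 2) :
    Ex (univ : Finset (Sym2 (V × Fin m))) p (fun G => ind (¬ UA x0 (m / 2 ^ L) (copies EH G))) ≤
      2 * y + σ * ((#EH : ℝ) ^ #EH * Θ ^ #EH) + Fintype.card V * m * (Real.exp Θ / 2 ^ D) := by
  set U : Finset (V → Fin m) → Prop := UA x0 (m / 2 ^ L) with hUdef
  have hUm : ∀ A B, A ⊆ B → U A → U B := fun A B h => UA_mono h
  -- coupling for each I
  have hc : ∀ I : Finset (V → Fin m),
      Ex (univ : Finset (Sym2 (V × Fin m))) p (fun G => ind (¬ U (copies EH G))) ≤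
      Ex univ q (fun Y => ind (¬ U ((I ∩ Y).filter (goodSet (Fc EH) p I (I ∩ Y))))) := by
    intro I
    have h1 := coupling (E := (univ : Finset (Sym2 (V × Fin m)))) (F := Fc EH) hp0 hp1
      (fun i => Finset.subset_univ _) I hq0 hq1 (fun j _ => by rw [Fc_card]; exact hqp) U hUm
    have h2 : Ex (univ : Finset (Sym2 (V × Fin m))) p
        (fun G => ind (U (I.filter fun j => Fc EH j ⊆ G))) ≤
        Ex (univ : Finset (Sym2 (V × Fin m))) p (fun G => ind (U (copies EH G))) := by
      refine Ex_mono hp0 hp1 fun G _ => ind_mono (hUm _ _ ?_)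
      exact Finset.filter_subset_filter _ (Finset.subset_univ _)
    rw [← Ex_restrict (Finset.subset_univ I)] at h1
    rw [Ex_ind_not, Ex_ind_not]
    have h3 : Ex univ q (fun Y => ind (U ((I ∩ Y).filter (goodSet (Fc EH) p I (I ∩ Y))))) =
      Ex univ q (fun Y => ind (U ((Y ∩ I).filter (goodSet (Fc EH) p I (Y ∩ I))))) :=
        Ex_congr fun Y _ => by rw [Finset.inter_comm]
    linarith
  have hpt : ∀ I Y : Finset (V → Fin m),
      ind (¬ U ((I ∩ Y).filter (goodSet (Fc EH) p I (I ∩ Y)))) ≤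
      ind (¬ U (I ∩ Y)) +
        ind (∃ f : V → Fin m, f ∈ I ∧ f ∉ I ∩ Y ∧ Jset EH (I ∩ Y) f = EH) +
        ind (¬ Deg (I ∩ Y) D) := by
    intro I Y
    refine le_trans (ind_mono ?_) ((ind_or_le (¬ U (I ∩ Y) ∨ ∃ f : V → Fin m, f ∈ I ∧ f ∉ I ∩ Y ∧
      Jset EH (I ∩ Y) f = EH) (¬ Deg (I ∩ Y) D)).trans
      (add_le_add (ind_or_le _ _) le_rfl))
    intro hnU
    by_contra hcon
    push Not at hcon
    obtain ⟨⟨hU, hno⟩, hDeg⟩ := hcon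
    apply hnU
    refine hUm (I ∩ Y) _ (fun j hj => ?_) hU
    rw [Finset.mem_filter]
    refine ⟨hj, ?_⟩
    unfold goodSet
    have hq2 := q2 hB hDeg hm hj hp0 hΘ' hs hse hpΘ
    refine le_trans ?_ (hq2.trans hbd)
    have hsub : Fc EH j ∪ (I ∩ Y).biUnion (Fc EH) = (I ∩ Y).biUnion (Fc EH) :=
      Finset.union_eq_right.2 (Finset.subset_biUnion_of_mem (Fc EH) hj)
    rw [hsub]
    refine Finset.sum_le_sum_of_subset_of_nonneg ?_ fun _ _ _ => pow_nonneg hp0 _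
    intro f hf
    rw [Finset.mem_filter, Finset.mem_sdiff] at hf
    rw [Finset.mem_filter]
    refine ⟨Finset.mem_univ _, hf.2, fun hsub' => ?_⟩
    rw [Fc_subset_biUnion] at hsub'
    exact hno f hf.1.1 hf.1.2 hsub'
  have hpi0 : 0 ≤ piL ρ L := by rw [← hσq]; exact mul_nonneg hσ0 hq0
  have hpi1 : piL ρ L ≤ 1 := by rw [← hσq]; exact mul_le_one₀ hσ1 hq0 hq1
  calc _ = Ex (univ : Finset (V → Fin m)) σ (fun _ =>
        Ex (univ : Finset (Sym2 (V × Fin m))) p (fun G => ind (¬ U (copies EH G)))) := by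
        rw [Ex_const]
    _ ≤ Ex univ σ (fun I => Ex univ q (fun Y => ind (¬ U (I ∩ Y)) +
        ind (∃ f : V → Fin m, f ∈ I ∧ f ∉ I ∩ Y ∧ Jset EH (I ∩ Y) f = EH) +
        ind (¬ Deg (I ∩ Y) D))) := by
        refine Ex_mono hσ0 hσ1 fun I _ => (hc I).trans ?_
        exact Ex_mono hq0 hq1 fun Y _ => hpt I Y
    _ = Ex univ (piL ρ L) (fun W => ind (¬ U W)) +
        Ex univ σ (fun I => Ex univ q (fun Y =>
          ind (∃ f : V → Fin m, f ∈ I ∧ f ∉ I ∩ Y ∧ Jset EH (I ∩ Y) f = EH))) +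
        Ex univ (piL ρ L) (fun W => ind (¬ Deg W D)) := by
        simp_rw [Ex_add]
        rw [Ex_inter univ σ q (fun W => ind (¬ U W)),
          Ex_inter univ σ q (fun W => ind (¬ Deg W D)), hσq]
    _ ≤ _ := by
        refine add_le_add (add_le_add ?_ (q1A hB hσ0 hσ1 hq0 hq1 hΘ hm hqΘ)) ?_
        · have hf := fknp (T := pmSet (m := m) x0) (valid := fun _ _ => True)
            (fun _ _ _ _ h => h) (μ := fun _ => muU V m) (fun _ => muU_nonneg) hy0 hy hρ0 hρ
            (fun P => (pm_spread x0 hm P).trans (by gcongr)) m L hL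
            (fun ω => (pmSet_card x0 ω).le)
          have hz : Ex univ (piL ρ L) (fun _W : Finset (V → Fin m) => ∑ ω : V → Equiv.Perm (Fin m),
              muU V m * ind (¬ ∀ f ∈ pmSet x0 ω, True)) = 0 := by
            rw [← Ex_const (univ : Finset (V → Fin m)) (piL ρ L) 0]
            refine Ex_congr fun W _ => Finset.sum_eq_zero fun ω _ => ?_
            rw [ind_false (by simp), mul_zero]
          rw [hz, add_zero] at hf
          calc _ ≤ Ex univ (piL ρ L) (fun W => 2 * ∑ ω : V → Equiv.Perm (Fin m), muU V m *
                ind (¬ Repl1 (pmSet x0) (fun _ _ => True) W ∅ ω (m / 2 ^ L))) := by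
                refine Ex_mono hpi0 hpi1 fun W _ => (not_UA_le x0 _ W).trans (le_of_eq ?_)
                congr 1
                refine Finset.sum_congr rfl fun ω _ => ?_
                congr 1
                apply ind_congr
                simp [AA, Repl1]
            _ ≤ 2 * y := by
                rw [Ex_mul]; linarith
        · refine deg_tail hpi0 hpi1 ?_ D
          rw [← hσq]; exact hqΘ

/-- the strong validity. -/
def vld (EH : Finset (Sym2 V)) (p : ℝ) (j : V → Fin m) (Y : Finset (V → Fin m)) : Prop :=
  ∑ i ∈ Finset.univ.filter (fun i : V → Fin m => i ≠ j ∧ ¬ Disjoint (Fc EH i) (Fc EH j)),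
    p ^ #(Fc EH i \ (Fc EH j ∪ Y.biUnion (Fc EH))) ≤ 1 / 2

lemma phaseB {EH : Finset (Sym2 V)} (hB : Bal EH) (x0 : V) (hm : 1 ≤ m)
    {y ρ p Θ Θ' s : ℝ} {L D a : ℕ} (hy0 : 0 ≤ y) (hy : y ≤ 1 / 4) (hρ0 : 0 < ρ) (hρ : ρ ≤ 1)
    (hsp : (Real.exp 1 / m) ^ (Fintype.card V - 1) ≤ y ^ 2 * ρ)
    (hL : ∀ i < L, 0 < a / 2 ^ i) (hLa : a / 2 ^ L = 0)
    (hp0 : 0 ≤ p) (hp1 : p ≤ 1) (hqp : piL ρ L ≤ p ^ #EH / 2)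
    (hΘ : 1 ≤ Θ) (hqΘ : piL ρ L * (m:ℝ) ^ (Fintype.card V - 1) ≤ Θ) (hΘ' : 1 ≤ Θ')
    (hpΘ : p ^ #EH * (m:ℝ) ^ (Fintype.card V - 1) ≤ Θ') (hs : 0 ≤ s) (hse : 1 ≤ s ^ #EH * m)
    (hbd : bd2 (Fintype.card V) #EH (D + 1) (Θ' * s) ≤ 1 / 2)
    {R : Finset (V → Fin m)} (hR : UA x0 a R) :
    Ex (univ : Finset (Sym2 (V × Fin m))) p (fun G => ind (¬ ∃ σ' : V → Equiv.Perm (Fin m),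
      pmSet x0 σ' ⊆ R ∪ copies EH G)) ≤
      2 * (y + (Fintype.card V * m * (Real.exp Θ / 2 ^ D) +
        a * bd2 (Fintype.card V) #EH 1 ((#EH : ℝ) ^ #EH * Θ ^ #EH / m))) := by
  have hpi0 : 0 ≤ piL ρ L := piL_nonneg hρ0.le hρ L
  have hpi1 : piL ρ L ≤ 1 := piL_le_one hρ L
  set U : Finset (V → Fin m) → Prop := fun X => ∃ σ' : V → Equiv.Perm (Fin m),
      pmSet x0 σ' ⊆ R ∪ X with hUdef
  have hUm : ∀ A B, A ⊆ B → U A → U B := by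
    rintro A B h ⟨σ', h'⟩
    exact ⟨σ', h'.trans (Finset.union_subset_union_right h)⟩
  have hc := coupling (E := (univ : Finset (Sym2 (V × Fin m)))) (F := Fc EH) hp0 hp1
      (fun i => Finset.subset_univ _) (univ : Finset (V → Fin m)) hpi0 hpi1
      (fun j _ => by rw [Fc_card]; exact hqp) U hUm
  set Ω := {σ : V → Equiv.Perm (Fin m) // AA x0 a R σ} with hΩ
  choose st hst1 hst2 using (fun ω : Ω => ω.2)
  set T : Ω → Finset (V → Fin m) := fun ω => pmSet x0 (st ω) \ R with hT
  have hTsub : ∀ ω, T ω ⊆ pmSet x0 ω.1 := by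
    intro ω f hf
    rw [hT, Finset.mem_sdiff] at hf
    rcases Finset.mem_union.1 (hst1 ω hf.1) with h | h
    · exact absurd h hf.2
    · exact h
  have hTpm : ∀ ω, IsPM (T ω) := fun ω g hg h hh =>
    pmSet_isPM x0 ω.1 g (hTsub ω hg) h (hTsub ω hh)
  have hμΩ : 1 / 2 ≤ ∑ _ω : Ω, muU V m := by
    refine le_trans hR (le_of_eq ?_)
    rw [← Finset.sum_subtype (Finset.univ.filter fun σ => AA x0 a R σ) (by simp)
      (fun _ => muU V m), Finset.sum_filter]
    refine Finset.sum_congr rfl fun σ _ => ?_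
    by_cases h : AA x0 a R σ
    · rw [ind_true h, if_pos h, mul_one]
    · rw [ind_false h, if_neg h, mul_zero]
  have hμΩ1 : ∑ _ω : Ω, muU V m ≤ 1 := by
    rw [← Finset.sum_subtype (Finset.univ.filter fun σ => AA x0 a R σ) (by simp)
      (fun _ => muU V m), ← muU_sum (V := V) (m := m)]
    exact Finset.sum_le_sum_of_subset_of_nonneg (Finset.filter_subset _ _)
      fun _ _ _ => muU_nonneg
  have hspread : ∀ P : Finset (V → Fin m), ∑ ω : Ω, muU V m * ind (P ⊆ T ω) ≤
      (y ^ 2 * ρ) ^ #P := by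
    intro P
    calc ∑ ω : Ω, muU V m * ind (P ⊆ T ω) ≤ ∑ ω : Ω, muU V m * ind (P ⊆ pmSet x0 ω.1) :=
          Finset.sum_le_sum fun ω _ => mul_le_mul_of_nonneg_left
            (ind_mono fun h => h.trans (hTsub ω)) muU_nonneg
      _ = ∑ σ ∈ Finset.univ.filter (fun σ => AA x0 a R σ), muU V m * ind (P ⊆ pmSet x0 σ) :=
          (Finset.sum_subtype (Finset.univ.filter fun σ => AA x0 a R σ) (by simp)
            (fun σ => muU V m * ind (P ⊆ pmSet x0 σ))).symm
      _ ≤ ∑ σ, muU V m * ind (P ⊆ pmSet x0 σ) :=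
          Finset.sum_le_sum_of_subset_of_nonneg (Finset.filter_subset _ _)
            fun _ _ _ => mul_nonneg muU_nonneg (ind_nonneg _)
      _ ≤ _ := (pm_spread x0 hm P).trans (by gcongr)
  have hvld : ∀ f A B, A ⊆ B → vld (m := m) EH p f B → vld EH p f A := by
    intro f A B h hv
    refine le_trans (Finset.sum_le_sum fun i _ => ?_) hv
    refine pow_le_pow_of_le_one hp0 hp1 (Finset.card_le_card ?_)
    exact Finset.sdiff_subset_sdiff le_rfl (Finset.union_subset_union_right
      (Finset.biUnion_subset_biUnion_of_subset_left _ h))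
  have hf := fknp (T := T) (valid := vld EH p) hvld (μ := fun _ => muU V m) (fun _ => muU_nonneg)
    hy0 hy hρ0 hρ hspread a L hL hst2
  rw [hLa] at hf
  -- the bad event for one ω
  have hbad : ∀ ω : Ω, Ex univ (piL ρ L) (fun W => ind (¬ ∀ f ∈ T ω, vld EH p f (W ∪ T ω))) ≤
      Fintype.card V * m * (Real.exp Θ / 2 ^ D) +
        a * bd2 (Fintype.card V) #EH 1 ((#EH : ℝ) ^ #EH * Θ ^ #EH / m) := by
    intro ω
    have hpt : ∀ W : Finset (V → Fin m), ind (¬ ∀ f ∈ T ω, vld EH p f (W ∪ T ω)) ≤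
        ind (¬ Deg W D) + ∑ j ∈ T ω, ∑ f ∈ Finset.univ.filter (fun f : V → Fin m =>
          f ≠ j ∧ ¬ Disjoint (Fc EH f) (Fc EH j)), ind (Jset EH (W ∪ T ω) f = EH) := by
      intro W
      refine le_trans (ind_mono (Q := ¬ Deg W D ∨ ∃ j ∈ T ω, ∃ f ∈ Finset.univ.filter
        (fun f : V → Fin m => f ≠ j ∧ ¬ Disjoint (Fc EH f) (Fc EH j)),
          Jset EH (W ∪ T ω) f = EH) ?_) ((ind_or_le _ _).trans (add_le_add le_rfl
          ((ind_exists_le _ _).trans (Finset.sum_le_sum fun j _ => ind_exists_le _ _))))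
      intro hnv
      by_contra hcon
      push Not at hcon
      obtain ⟨hDeg, hno⟩ := hcon
      apply hnv
      intro j hj
      have hjY : j ∈ W ∪ T ω := Finset.mem_union_right _ hj
      have hq2 := q2 hB (hDeg.union (hTpm ω)) hm hjY hp0 hΘ' hs hse hpΘ
      unfold vld
      have hsub : Fc EH j ∪ (W ∪ T ω).biUnion (Fc EH) = (W ∪ T ω).biUnion (Fc EH) :=
        Finset.union_eq_right.2 (Finset.subset_biUnion_of_mem (Fc EH) hjY)
      rw [hsub]
      refine le_trans ?_ (hq2.trans hbd)
      refine Finset.sum_le_sum_of_subset_of_nonneg ?_ fun _ _ _ => pow_nonneg hp0 _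
      intro f hf
      have hf' := Finset.mem_filter.1 hf
      rw [Finset.mem_filter]
      refine ⟨Finset.mem_univ _, hf'.2.2, fun hsub' => ?_⟩
      rw [Fc_subset_biUnion] at hsub'
      exact hno j hj f hf hsub'
    refine (Ex_mono hpi0 hpi1 fun W _ => hpt W).trans ?_
    rw [Ex_add, Ex_sum]
    refine add_le_add (deg_tail hpi0 hpi1 hqΘ D) ?_
    have h1 : ∀ j ∈ T ω, Ex univ (piL ρ L) (fun W => ∑ f ∈ Finset.univ.filter
        (fun f : V → Fin m => f ≠ j ∧ ¬ Disjoint (Fc EH f) (Fc EH j)),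
          ind (Jset EH (W ∪ T ω) f = EH)) ≤
        bd2 (Fintype.card V) #EH 1 ((#EH : ℝ) ^ #EH * Θ ^ #EH / m) := by
      intro j hj
      rw [Ex_sum]
      have := q1B hB hpi0 hpi1 hΘ hm hqΘ (hTpm ω) hj
      unfold bd2
      push_cast
      exact this
    have hΘ0 : 0 ≤ Θ := by linarith
    have hb0 : 0 ≤ bd2 (Fintype.card V) #EH 1 ((#EH : ℝ) ^ #EH * Θ ^ #EH / m) := by
      unfold bd2; positivity
    calc _ ≤ ∑ j ∈ T ω, bd2 (Fintype.card V) #EH 1 ((#EH : ℝ) ^ #EH * Θ ^ #EH / m) :=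
          Finset.sum_le_sum h1
      _ = #(T ω) * bd2 (Fintype.card V) #EH 1 ((#EH : ℝ) ^ #EH * Θ ^ #EH / m) := by
          rw [Finset.sum_const, nsmul_eq_mul]
      _ ≤ _ := by
          refine mul_le_mul_of_nonneg_right ?_ hb0
          exact_mod_cast hst2 ω
  set η := Fintype.card V * m * (Real.exp Θ / 2 ^ D) +
        a * bd2 (Fintype.card V) #EH 1 ((#EH : ℝ) ^ #EH * Θ ^ #EH / m) with hη
  have hη0 : 0 ≤ η := by
    have hΘ0 : 0 ≤ Θ := by linarith
    rw [hη]; unfold bd2; positivity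
  have hf2 : Ex univ (piL ρ L) (fun W => ∑ ω : Ω, muU V m *
      ind (¬ ∀ f ∈ T ω, vld EH p f (W ∪ T ω))) ≤ η := by
    rw [Ex_sum]
    calc _ ≤ ∑ _ω : Ω, muU V m * η := by
          refine Finset.sum_le_sum fun ω _ => ?_
          rw [Ex_mul]
          exact mul_le_mul_of_nonneg_left (hbad ω) muU_nonneg
      _ = (∑ _ω : Ω, muU V m) * η := by rw [Finset.sum_mul]
      _ ≤ 1 * η := mul_le_mul_of_nonneg_right hμΩ1 hη0
      _ = η := one_mul _
  have hpt : ∀ W : Finset (V → Fin m),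
      ind (¬ U (W.filter (goodSet (Fc EH) p univ W))) ≤
      2 * ∑ ω : Ω, muU V m * ind (¬ Repl1 T (vld EH p) W ∅ ω 0) := by
    intro W
    by_cases h : ∃ ω, Repl1 T (vld EH p) W ∅ ω 0
    · obtain ⟨ω, ω', h1, h2, h3⟩ := h
      rw [ind_false]
      · refine mul_nonneg zero_le_two (Finset.sum_nonneg fun ω _ => mul_nonneg muU_nonneg (ind_nonneg _))
      · rw [not_not]
        refine ⟨st ω', fun f hf => ?_⟩
        by_cases hfR : f ∈ R
        · exact Finset.mem_union_left _ hfR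
        · refine Finset.mem_union_right _ ?_
          have hfT : f ∈ T ω' := Finset.mem_sdiff.2 ⟨hf, hfR⟩
          have hTW : T ω' ⊆ W := by
            rw [← Finset.sdiff_eq_empty_iff_subset, ← Finset.card_eq_zero]; omega
          rw [Finset.mem_filter]
          refine ⟨hTW hfT, ?_⟩
          have hv := h3 f hfT
          rw [Finset.union_empty, Finset.union_eq_left.2 hTW] at hv
          unfold vld at hv
          unfold goodSet
          refine le_trans ?_ hv
          refine Finset.sum_le_sum_of_subset_of_nonneg ?_ fun _ _ _ => pow_nonneg hp0 _
          intro i hi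
          rw [Finset.mem_filter, Finset.mem_sdiff] at hi
          rw [Finset.mem_filter]
          exact ⟨Finset.mem_univ _, fun h => hi.1.2 (h ▸ hTW hfT), hi.2⟩
    · push Not at h
      have : ∑ ω : Ω, muU V m * ind (¬ Repl1 T (vld EH p) W ∅ ω 0) = ∑ _ω : Ω, muU V m :=
        Finset.sum_congr rfl fun ω _ => by rw [ind_true (h ω), mul_one]
      rw [this]
      linarith [ind_le_one (¬ U (W.filter (goodSet (Fc EH) p univ W)))]
  have hfin : Ex univ (piL ρ L) (fun W => ind (¬ U (W.filter (goodSet (Fc EH) p univ W)))) ≤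
      2 * (y + η) := by
    refine (Ex_mono hpi0 hpi1 fun W _ => hpt W).trans ?_
    rw [Ex_mul]
    linarith
  have hgoal : Ex (univ : Finset (Sym2 (V × Fin m))) p (fun G => ind (¬ U (copies EH G))) ≤
      2 * (y + η) := by
    rw [Ex_ind_not] at hfin ⊢
    have : Ex (univ : Finset (Sym2 (V × Fin m))) p (fun G => ind (U (copies EH G))) =
        Ex (univ : Finset (Sym2 (V × Fin m))) p
          (fun G => ind (U (univ.filter fun j => Fc EH j ⊆ G))) := rfl
    linarith
  exact hgoal

end Phases

set_option linter.unusedSectionVars false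

section Core
open Finset
open scoped Classical
variable {V : Type} [Fintype V] [DecidableEq V]

lemma copies_mono {m : ℕ} (EH : Finset (Sym2 V)) {G G' : Finset (Sym2 (V × Fin m))} (h : G ⊆ G') :
    copies EH G ⊆ copies EH G' := by
  intro f hf
  rw [copies, Finset.mem_filter] at *
  exact ⟨hf.1, hf.2.trans h⟩

/-- conditions on the parameter `t`. -/
structure TCond (v e : ℕ) (δ C : ℝ) (k t : ℕ) : Prop where
  E1 : (e * (C * ((e + 1) * (Nat.log 2 t + 1 : ℕ)))) ^ e / Real.sqrt t ≤ δ / 8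
  E2 : ((e + 1) * (Nat.log 2 t + 1 : ℕ) : ℝ) ≤ Real.sqrt t
  E3 : (2 * t) ^ (e + 1) ≤ 2 ^ (t - 1)
  E4 : C * t ≤ 2 ^ (t - 1)
  E5 : (v : ℝ) / 2 ^ t ≤ δ / 16
  E6 : bd2 v e 1 ((e:ℝ) ^ e * C ^ e / t) ≤ δ / 16
  E7 : bd2 v e (k * t + 1) (2 * C * t * ((2:ℝ)⁻¹ ^ ((e:ℝ)⁻¹)) ^ (t - 1)) ≤ 1 / 2

set_option maxHeartbeats 2000000 in
lemma core_det {EH : Finset (Sym2 V)} (hB : Bal EH) (x0 : V) {δ y C : ℝ} (hδ0 : 0 < δ) (hδ1 : δ ≤ 1)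
    (hy : y = δ / 16) (hC : C = Real.exp 1 ^ (Fintype.card V - 1) / y ^ 2)
    {k : ℕ} (hk : 4 * Real.exp C ≤ 2 ^ k) {m t : ℕ} (hm : 1 ≤ m) (ht : t = Nat.log 2 m + 1)
    (hT : TCond (Fintype.card V) #EH δ C k t) {p : ℝ} (hp0 : 0 ≤ p) (hp1 : p ≤ 1)
    (hp : 2 ^ #EH * (2 * C) * t ≤ p ^ #EH * (m:ℝ) ^ (Fintype.card V - 1)) :
    Ex (univ : Finset (Sym2 (V × Fin m))) p (fun G => ind (¬ ∃ σ' : V → Equiv.Perm (Fin m),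
      pmSet x0 σ' ⊆ copies EH G)) ≤ δ := by
  set v := Fintype.card V with hv
  set e := #EH with he
  have he1 : 1 ≤ e := Finset.card_pos.2 hB.ne
  have he0 : e ≠ 0 := by omega
  have hv2 : 2 ≤ v := hB.two_le_card
  have hy0 : 0 < y := by rw [hy]; positivity
  have hm0 : (0:ℝ) < m := by exact_mod_cast hm
  have hm1 : (1:ℝ) ≤ m := by exact_mod_cast hm
  have ht1 : 1 ≤ t := by omega
  have htr : (1:ℝ) ≤ t := by exact_mod_cast ht1
  have ht0 : (0:ℝ) < t := by linarith
  have hC0 : 0 < C := by rw [hC]; positivity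
  have hC1 : 1 ≤ C := by
    rw [hC, le_div_iff₀ (by positivity), one_mul]
    calc y ^ 2 ≤ 1 := by rw [hy]; nlinarith
      _ ≤ _ := one_le_pow₀ (Real.one_le_exp zero_le_one)
  set md : ℝ := (m:ℝ) ^ (v - 1) with hmd
  have hmd0 : 0 < md := by positivity
  have hmmd : (m:ℝ) ≤ md := by
    rw [hmd]
    calc (m:ℝ) = (m:ℝ) ^ 1 := (pow_one _).symm
      _ ≤ _ := pow_le_pow_right₀ hm1 (by omega)
  have h2m : 2 ^ (t - 1) ≤ m := by
    rw [ht, Nat.add_sub_cancel]; exact Nat.pow_log_le_self 2 (by omega)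
  have hm2 : m < 2 ^ t := by rw [ht]; exact Nat.lt_pow_succ_log_self (by norm_num) m
  have h2mr : (2:ℝ) ^ (t - 1) ≤ m := by exact_mod_cast h2m
  have hm2r : (m:ℝ) ≤ 2 ^ t := by exact_mod_cast hm2.le
  set ρ : ℝ := C / md with hρ
  have hρ0 : 0 < ρ := by positivity
  have hCt : C * t ≤ md := hT.E4.trans (h2mr.trans hmmd)
  have hρ1 : ρ ≤ 1 := by
    rw [hρ, div_le_one hmd0]; nlinarith
  have hsp : (Real.exp 1 / m) ^ (v - 1) ≤ y ^ 2 * ρ := by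
    rw [hρ, hC, div_pow, ← hmd]
    apply le_of_eq
    field_simp
  set LA : ℕ := (e + 1) * (Nat.log 2 t + 1) with hLA
  have hLA1 : 1 ≤ LA := by rw [hLA]; nlinarith [Nat.zero_le (Nat.log 2 t)]
  have hLAr : (1:ℝ) ≤ LA := by exact_mod_cast hLA1
  have hsq0 : 0 < Real.sqrt t := Real.sqrt_pos.2 ht0
  have hsq1 : 1 ≤ Real.sqrt t := Real.one_le_sqrt.2 htr
  have hsqt : Real.sqrt t * Real.sqrt t = t := Real.mul_self_sqrt ht0.le
  have hLAs : (LA:ℝ) ≤ Real.sqrt t := by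
    have := hT.E2
    rw [hLA]; push_cast at *; exact this
  have hLAt : Real.sqrt t * LA ≤ t := by
    calc Real.sqrt t * LA ≤ Real.sqrt t * Real.sqrt t := by gcongr
      _ = t := hsqt
  have hLAt' : (LA:ℝ) ≤ t := by nlinarith
  have h2LA : t ^ (e + 1) ≤ 2 ^ LA := by
    rw [hLA, mul_comm, pow_mul]
    exact Nat.pow_le_pow_left (Nat.lt_pow_succ_log_self (by norm_num) t).le _
  have h2LA' : 2 ^ LA ≤ m := by
    refine le_trans ?_ (hT.E3.trans h2m)
    rw [hLA, mul_comm, pow_mul]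
    refine Nat.pow_le_pow_left ?_ _
    rw [pow_succ, mul_comm]
    exact Nat.mul_le_mul_left 2 (Nat.pow_log_le_self 2 (by omega))
  set D := k * t with hD
  set r : ℝ := (2:ℝ)⁻¹ ^ ((e:ℝ)⁻¹) with hr
  set s : ℝ := r ^ (t - 1) with hs
  have hr0 : 0 ≤ r := Real.rpow_nonneg (by norm_num) _
  have hs0 : 0 ≤ s := pow_nonneg hr0 _
  have hse : 1 ≤ s ^ e * m := by
    have h1 : r ^ e = 2⁻¹ := by rw [hr]; exact Real.rpow_inv_natCast_pow (by norm_num) he0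
    rw [hs, ← pow_mul, mul_comm (t - 1) e, pow_mul, h1, inv_pow, mul_comm, ← div_eq_mul_inv,
      le_div_iff₀ (by positivity), one_mul]
    exact h2mr
  have hΘ' : 1 ≤ 2 * C * t := by nlinarith
  have htail : ∀ Θ : ℝ, Θ ≤ C * t → ∀ D', D ≤ D' → v * m * (Real.exp Θ / 2 ^ D') ≤ δ / 16 := by
    intro Θ hΘ D' hD'
    refine le_trans ?_ hT.E5
    have h1 : (4:ℝ) ^ t * Real.exp (C * t) ≤ 2 ^ D' := by
      calc (4:ℝ) ^ t * Real.exp (C * t) = (4 * Real.exp C) ^ t := by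
            rw [mul_pow, ← Real.exp_nat_mul, mul_comm C]
        _ ≤ (2 ^ k) ^ t := by gcongr
        _ = 2 ^ D := by rw [← pow_mul]
        _ ≤ _ := pow_le_pow_right₀ (by norm_num) hD'
    have h2 : Real.exp Θ / 2 ^ D' ≤ 1 / 4 ^ t := by
      rw [div_le_div_iff₀ (by positivity) (by positivity), one_mul, mul_comm]
      refine le_trans ?_ h1
      gcongr
    calc v * m * (Real.exp Θ / 2 ^ D') ≤ v * 2 ^ t * (1 / 4 ^ t) := by gcongr
      _ = v / 2 ^ t := by
          have : (4:ℝ) ^ t = 2 ^ t * 2 ^ t := by rw [← mul_pow]; norm_num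
          rw [this]; field_simp
  -- phase A parameters
  have hpiA0 : 0 ≤ piL ρ LA := piL_nonneg hρ0.le hρ1 LA
  have hpiA : piL ρ LA ≤ LA * ρ := piL_le hρ1 LA
  set pA : ℝ := (2 * (Real.sqrt t * (C * LA) / md)) ^ ((e:ℝ)⁻¹) with hpA
  have hpAe : pA ^ e = 2 * (Real.sqrt t * (C * LA) / md) :=
    Real.rpow_inv_natCast_pow (by positivity) he0
  have hpA0 : 0 ≤ pA := Real.rpow_nonneg (by positivity) _
  have hhalf : 2 * (C * t) / md ≤ (p / 2) ^ e := by
    rw [div_pow, div_le_div_iff₀ hmd0 (by positivity)]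
    calc _ = 2 ^ e * (2 * C) * t := by ring
      _ ≤ _ := hp
  have hpA2 : pA ≤ p / 2 := by
    refine le_of_pow_le_pow_left₀ he0 (by linarith) ?_
    rw [hpAe]
    refine le_trans ?_ hhalf
    rw [← mul_div_assoc]
    gcongr 2 * ?_ / _
    calc Real.sqrt t * (C * LA) = C * (Real.sqrt t * LA) := by ring
      _ ≤ _ := by gcongr
  have hpAΘ : pA ^ e * md ≤ 2 * C * t := by
    rw [hpAe]
    calc 2 * (Real.sqrt t * (C * LA) / md) * md = 2 * C * (Real.sqrt t * LA) := by field_simp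
      _ ≤ _ := by gcongr
  have hA := phaseA hB x0 hm (y := y) (ρ := ρ) (σ := 1 / Real.sqrt t) (q := Real.sqrt t * piL ρ LA)
    (p := pA) (Θ := C * LA) (Θ' := 2 * C * t) (s := s) (L := LA) (D := D + 1) hy0.le
    (by rw [hy]; linarith) hρ0 hρ1 hsp
    (fun i hi => Nat.div_pos ((Nat.pow_le_pow_right (by norm_num) hi.le).trans h2LA') (by positivity))
    (by positivity) (by rw [div_le_one hsq0]; exact hsq1) (by positivity)
    (by
      calc Real.sqrt t * piL ρ LA ≤ Real.sqrt t * (LA * ρ) := by gcongr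
        _ = C * (Real.sqrt t * LA) / md := by rw [hρ]; ring
        _ ≤ C * t / md := by gcongr
        _ ≤ 1 := by rw [div_le_one hmd0]; exact hCt)
    (by field_simp) hpA0 (by linarith)
    (by
      rw [hpAe]
      calc Real.sqrt t * piL ρ LA ≤ Real.sqrt t * (LA * ρ) := by gcongr
        _ = _ := by rw [hρ]; ring)
    (by nlinarith)
    (by
      calc 1 / Real.sqrt t * (Real.sqrt t * piL ρ LA) * md = piL ρ LA * md := by field_simp
        _ ≤ (LA * ρ) * md := by gcongr
        _ = C * LA := by rw [hρ]; field_simp)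
    hΘ' hpAΘ hs0 hse hT.E7
  set a := m / 2 ^ LA with ha
  have ha1 : 1 ≤ a := Nat.div_pos h2LA' (by positivity)
  have ham : (a:ℝ) * t ^ (e + 1) ≤ m := by
    have : a * t ^ (e + 1) ≤ m :=
      (Nat.mul_le_mul_left a h2LA).trans (Nat.div_mul_le_self m (2 ^ LA))
    exact_mod_cast this
  -- phase B parameters
  set LB := Nat.log 2 a + 1 with hLB
  have hLBt : LB ≤ t := by
    rw [hLB, ht]
    exact Nat.succ_le_succ (Nat.log_mono_right (Nat.div_le_self _ _))
  have hLBr : (LB:ℝ) ≤ t := by exact_mod_cast hLBt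
  have hpiB0 : 0 ≤ piL ρ LB := piL_nonneg hρ0.le hρ1 LB
  have hpiB : piL ρ LB ≤ C * t / md := by
    refine (piL_le hρ1 LB).trans ?_
    calc LB * ρ ≤ t * ρ := by gcongr
      _ = _ := by rw [hρ]; ring
  set pB : ℝ := (2 * (C * t / md)) ^ ((e:ℝ)⁻¹) with hpB
  have hpBe : pB ^ e = 2 * (C * t / md) := Real.rpow_inv_natCast_pow (by positivity) he0
  have hpB0 : 0 ≤ pB := Real.rpow_nonneg (by positivity) _
  have hpB2 : pB ≤ p / 2 := by
    refine le_of_pow_le_pow_left₀ he0 (by linarith) ?_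
    rw [hpBe, ← mul_div_assoc]
    exact hhalf
  have hBB : ∀ R : Finset (V → Fin m), UA x0 a R → _ := fun R hR =>
    phaseB hB x0 hm (y := y) (ρ := ρ) (p := pB) (Θ := C * t) (Θ' := 2 * C * t) (s := s)
    (L := LB) (D := D) hy0.le (by rw [hy]; linarith) hρ0 hρ1 hsp
    (fun i hi => Nat.div_pos ((Nat.pow_le_pow_right (by norm_num) (Nat.lt_succ_iff.1 hi)).trans
      (Nat.pow_log_le_self 2 (by omega))) (by positivity))
    (Nat.div_eq_of_lt (Nat.lt_pow_succ_log_self (by norm_num) a)) hpB0 (by linarith)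
    (by rw [hpBe]; linarith) (by nlinarith)
    (by
      calc piL ρ LB * md ≤ C * t / md * md := by gcongr
        _ = _ := by field_simp)
    hΘ' (by rw [hpBe, ← hv, ← hmd]; apply le_of_eq; field_simp) hs0 hse hT.E7 hR
  have hb6 : a * bd2 v e 1 ((e:ℝ) ^ e * (C * t) ^ e / m) ≤ δ / 16 := by
    refine le_trans ?_ hT.E6
    unfold bd2
    have h1 : a * ((e:ℝ) ^ e * (C * t) ^ e / m) ≤ (e:ℝ) ^ e * C ^ e / t := by
      rw [← mul_div_assoc, div_le_div_iff₀ hm0 ht0]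
      calc _ = ((e:ℝ) ^ e * C ^ e) * (a * t ^ (e + 1)) := by rw [mul_pow, pow_succ]; ring
        _ ≤ _ := by gcongr
    calc _ = v * 2 ^ e * (((1:ℕ) * v + 1 : ℝ) ^ v) ^ v * (a * ((e:ℝ) ^ e * (C * t) ^ e / m)) := by ring
      _ ≤ _ := by gcongr
  have hmono : ∀ A B : Finset (Sym2 (V × Fin m)), A ⊆ B →
      ind (∃ σ' : V → Equiv.Perm (Fin m), pmSet x0 σ' ⊆ copies EH A) ≤
      ind (∃ σ' : V → Equiv.Perm (Fin m), pmSet x0 σ' ⊆ copies EH B) := fun A B h =>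
    ind_mono fun ⟨σ', h'⟩ => ⟨σ', h'.trans (copies_mono EH h)⟩
  have hpA1 : pA ≤ 1 := by linarith
  have hpB1 : pB ≤ 1 := by linarith
  have hst : Ex (univ : Finset (Sym2 (V × Fin m))) p (fun G => ind (¬ ∃ σ' : V → Equiv.Perm (Fin m),
      pmSet x0 σ' ⊆ copies EH G)) ≤ Ex (univ : Finset (Sym2 (V × Fin m))) (pA + pB - pA * pB)
      (fun G => ind (¬ ∃ σ' : V → Equiv.Perm (Fin m), pmSet x0 σ' ⊆ copies EH G)) := by
    rw [Ex_ind_not, Ex_ind_not]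
    have := Ex_mono_p (s := (univ : Finset (Sym2 (V × Fin m)))) (p := pA + pB - pA * pB) (q := p)
      (by nlinarith) (by nlinarith) hp1 hmono
    linarith
  refine hst.trans ?_
  rw [← Ex_union]
  set EB := 2 * (y + (v * m * (Real.exp (C * t) / 2 ^ D) +
        a * bd2 v e 1 ((e : ℝ) ^ e * (C * t) ^ e / m))) with hEB
  have hEB0 : 0 ≤ EB := by rw [hEB]; unfold bd2; positivity
  calc _ ≤ Ex (univ : Finset (Sym2 (V × Fin m))) pA (fun G =>
        ind (¬ UA x0 a (copies EH G)) + EB) := by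
        refine Ex_mono hpA0 hpA1 fun G1 _ => ?_
        by_cases hU : UA x0 a (copies EH G1)
        · rw [ind_false (not_not.2 hU), zero_add]
          refine le_trans (Ex_mono hpB0 hpB1 fun G2 _ => ind_mono ?_) (hBB _ hU)
          intro hno hyes
          apply hno
          obtain ⟨σ', h'⟩ := hyes
          exact ⟨σ', h'.trans (Finset.union_subset (copies_mono EH Finset.subset_union_left)
            (copies_mono EH Finset.subset_union_right))⟩
        · rw [ind_true hU]
          refine (Ex_le_const hpB0 hpB1 fun G2 _ => ind_le_one _).trans (by linarith)
    _ ≤ _ := by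
        rw [Ex_add, Ex_const]
        have h1 : 1 / Real.sqrt t * ((e:ℝ) ^ e * (C * LA) ^ e) ≤ δ / 8 := by
          refine le_trans (le_of_eq ?_) hT.E1
          rw [hLA]
          push_cast
          rw [mul_pow (e:ℝ)]
          ring
        have h2 := htail (C * LA) (by gcongr) (D + 1) (Nat.le_succ _)
        have h3 := htail (C * t) le_rfl D le_rfl
        rw [hEB]
        linarith

end Core

set_option linter.unusedSectionVars false

section CoreAsym
open Finset
open scoped Classical

lemma pow_geom_ev (N : ℕ) {r : ℝ} (hr0 : 0 ≤ r) (hr1 : r < 1) (c ε : ℝ) (hε : 0 < ε) :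
    ∀ᶠ n : ℕ in atTop, c * ((n:ℝ) ^ N * r ^ n) ≤ ε := by
  have h := tendsto_pow_const_mul_const_pow_of_abs_lt_one N (r := r) (by rwa [abs_of_nonneg hr0])
  have h2 := h.const_mul c
  rw [mul_zero] at h2
  exact (h2.eventually (gt_mem_nhds hε)).mono fun n hn => hn.le

lemma tendsto_natlog : Tendsto (fun n : ℕ => Nat.log 2 n) atTop atTop := by
  rw [tendsto_atTop]
  intro b
  filter_upwards [eventually_ge_atTop (2 ^ b)] with n hn
  exact Nat.le_log_of_pow_le (by norm_num) hn

lemma log_sqrt_ev (N : ℕ) (c ε : ℝ) (hc : 0 ≤ c) (hε : 0 < ε) :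
    ∀ᶠ t : ℕ in atTop, c * ((Nat.log 2 t + 1 : ℕ) : ℝ) ^ N / Real.sqrt t ≤ ε := by
  have hs : 1 < Real.sqrt 2 := by rw [Real.lt_sqrt] <;> norm_num
  have hs0 : 0 < Real.sqrt 2 := by linarith
  have h := pow_geom_ev N (r := (Real.sqrt 2)⁻¹) (by positivity) (inv_lt_one_of_one_lt₀ hs)
    (c * Real.sqrt 2) ε hε
  have ht : Tendsto (fun t : ℕ => Nat.log 2 t + 1) atTop atTop :=
    (tendsto_add_atTop_nat 1).comp tendsto_natlog
  filter_upwards [ht.eventually h, eventually_ge_atTop 1] with t h1 h2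
  refine le_trans ?_ h1
  have h3 : (Real.sqrt 2) ^ (Nat.log 2 t) ≤ Real.sqrt t := by
    apply Real.le_sqrt_of_sq_le
    rw [← pow_mul, mul_comm, pow_mul, Real.sq_sqrt (by norm_num)]
    exact_mod_cast Nat.pow_log_le_self 2 (by omega)
  have h4 : (0:ℝ) < Real.sqrt 2 ^ (Nat.log 2 t) := by positivity
  calc c * ((Nat.log 2 t + 1 : ℕ) : ℝ) ^ N / Real.sqrt t
      ≤ c * ((Nat.log 2 t + 1 : ℕ) : ℝ) ^ N / Real.sqrt 2 ^ (Nat.log 2 t) := by gcongr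
    _ = _ := by
      rw [inv_pow, pow_succ (Real.sqrt 2)]
      field_simp

lemma tcond_ev (v e k : ℕ) {δ C : ℝ} (hδ : 0 < δ) (hC : 0 < C) (he : e ≠ 0) :
    ∀ᶠ t : ℕ in atTop, TCond v e δ C k t := by
  set r : ℝ := (2:ℝ)⁻¹ ^ ((e:ℝ)⁻¹) with hr
  have hr0 : 0 < r := Real.rpow_pos_of_pos (by norm_num) _
  have hr1 : r < 1 := Real.rpow_lt_one (by norm_num) (by norm_num) (by positivity)
  have h1 := log_sqrt_ev e ((e * (C * (e + 1))) ^ e) (δ / 8) (by positivity) (by positivity)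
  have h2 := log_sqrt_ev 1 (e + 1) 1 (by positivity) (by positivity)
  have h3 := pow_geom_ev (e + 1) (r := 1 / 2) (by norm_num) (by norm_num) (2 ^ (e + 1) * 2) 1 one_pos
  have h4 := pow_geom_ev 1 (r := 1 / 2) (by norm_num) (by norm_num) (C * 2) 1 one_pos
  have h5 := pow_geom_ev 0 (r := 1 / 2) (by norm_num) (by norm_num) v (δ / 16) (by positivity)
  have h6 : ∀ᶠ t : ℕ in atTop, bd2 v e 1 ((e:ℝ) ^ e * C ^ e / t) ≤ δ / 16 := by
    have : Tendsto (fun t : ℕ => bd2 v e 1 ((e:ℝ) ^ e * C ^ e) / (t:ℝ)) atTop (𝓝 0) :=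
      tendsto_const_div_atTop_nhds_zero_nat _
    filter_upwards [this.eventually (gt_mem_nhds (show (0:ℝ) < δ / 16 by positivity))] with t ht
    refine le_trans (le_of_eq ?_) ht.le
    unfold bd2; ring
  have h7 := pow_geom_ev (v * v + 1) hr0.le hr1
    (v * 2 ^ e * ((((k + 1) * v + 1 : ℝ)) ^ v) ^ v * (2 * C) * r⁻¹) (1 / 2) (by norm_num)
  have hpow : ∀ t : ℕ, 1 ≤ t → ∀ x : ℝ, x ^ t = x ^ (t - 1) * x := by
    intro t ht x
    rw [← pow_succ, Nat.sub_add_cancel ht]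
  filter_upwards [h1, h2, h3, h4, h5, h6, h7, eventually_ge_atTop 1] with t h1 h2 h3 h4 h5 h6 h7 ht
  have htr : (1:ℝ) ≤ t := by exact_mod_cast ht
  have hs0 : 0 < Real.sqrt t := Real.sqrt_pos.2 (by linarith)
  have h20 : (0:ℝ) < 2 ^ (t - 1) := by positivity
  refine ⟨?_, ?_, ?_, ?_, ?_, h6, ?_⟩
  · refine le_trans (le_of_eq ?_) h1
    rw [← mul_pow]; congr 2; ring
  · rw [pow_one, div_le_one hs0] at h2
    exact h2
  · have : ((2:ℝ) * t) ^ (e + 1) ≤ 2 ^ (t - 1) := by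
      rw [hpow t ht, one_div, inv_pow] at h3
      have : 2 ^ (e + 1) * 2 * ((t:ℝ) ^ (e + 1) * (((2:ℝ) ^ (t - 1))⁻¹ * 2⁻¹)) =
        ((2:ℝ) * t) ^ (e + 1) / 2 ^ (t - 1) := by rw [mul_pow]; field_simp
      rw [this, div_le_one h20] at h3
      exact h3
    exact_mod_cast this
  · rw [hpow t ht, one_div, inv_pow, pow_one] at h4
    have : C * 2 * ((t:ℝ) * (((2:ℝ) ^ (t - 1))⁻¹ * 2⁻¹)) = C * t / 2 ^ (t - 1) := by field_simp
    rw [this, div_le_one h20] at h4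
    exact h4
  · refine le_trans (le_of_eq ?_) h5
    rw [pow_zero, one_mul, one_div, inv_pow, div_eq_mul_inv]
  · refine le_trans ?_ h7
    unfold bd2
    have hk : (((k * t + 1 : ℕ) : ℝ) * v + 1) ≤ ((k + 1) * v + 1) * t := by
      push_cast
      have : (0:ℝ) ≤ v := by positivity
      nlinarith [mul_le_mul_of_nonneg_left htr this]
    calc v * 2 ^ e * ((((k * t + 1 : ℕ) : ℝ) * v + 1) ^ v) ^ v * (2 * C * t * r ^ (t - 1))
        ≤ v * 2 ^ e * ((((k + 1) * v + 1) * t) ^ v) ^ v * (2 * C * t * r ^ (t - 1)) := by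
          gcongr
      _ = _ := by
          rw [hpow t ht r, mul_pow, mul_pow, ← pow_mul (t:ℝ), pow_succ (t:ℝ)]
          field_simp

variable {V : Type} [Fintype V] [DecidableEq V]

theorem core {EH : Finset (Sym2 V)} (hB : Bal EH) (x0 : V) {δ : ℝ} (hδ0 : 0 < δ) (hδ1 : δ ≤ 1) :
    ∃ K : ℝ, 0 < K ∧ ∀ᶠ m : ℕ in atTop, ∀ p : ℝ, 0 ≤ p → p ≤ 1 →
      K * (Nat.log 2 m + 1 : ℕ) ≤ p ^ #EH * (m:ℝ) ^ (Fintype.card V - 1) →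
      Ex (univ : Finset (Sym2 (V × Fin m))) p (fun G => ind (¬ ∃ σ' : V → Equiv.Perm (Fin m),
        pmSet x0 σ' ⊆ copies EH G)) ≤ δ := by
  set C := Real.exp 1 ^ (Fintype.card V - 1) / (δ / 16) ^ 2 with hC
  have hC0 : 0 < C := by rw [hC]; positivity
  obtain ⟨k, hk⟩ := pow_unbounded_of_one_lt (4 * Real.exp C) (one_lt_two)
  refine ⟨2 ^ #EH * (2 * C), by positivity, ?_⟩
  have hev := tcond_ev (Fintype.card V) #EH k hδ0 hC0 (Finset.card_pos.2 hB.ne).ne'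
  have ht : Tendsto (fun t : ℕ => Nat.log 2 t + 1) atTop atTop :=
    (tendsto_add_atTop_nat 1).comp tendsto_natlog
  filter_upwards [ht.eventually hev, eventually_ge_atTop 1] with m hT hm p hp0 hp1 hp
  exact core_det hB x0 hδ0 hδ1 rfl hC hk.le hm rfl hT hp0 hp1 hp

end CoreAsym

set_option linter.unusedSectionVars false

section Transfer
open Finset
open scoped Classical
variable {V : Type} [Fintype V]

/-- graph with a given finite edge set. -/
def gOf {n : ℕ} (A : Finset (Sym2 (Fin n))) : SimpleGraph (Fin n) :=
  SimpleGraph.fromEdgeSet (A : Set (Sym2 (Fin n)))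

lemma HasFactor.mono {H : SimpleGraph V} {n : ℕ} {G G' : SimpleGraph (Fin n)} (h : G ≤ G')
    (hG : HasFactor H G) : HasFactor H G' := by
  obtain ⟨f, hf, hadj⟩ := hG
  exact ⟨f, hf, fun i u v huv => h (hadj i huv)⟩

lemma gOf_mono {n : ℕ} {A B : Finset (Sym2 (Fin n))} (h : A ⊆ B) : gOf A ≤ gOf B :=
  SimpleGraph.fromEdgeSet_mono (by exact_mod_cast h)

lemma factor_of_pm {H : SimpleGraph V} {EH : Finset (Sym2 V)}
    (hEH : ∀ u v, H.Adj u v → s(u, v) ∈ EH) (x0 : V) {n : ℕ}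
    (φ : V × Fin (n / Fintype.card V) ↪ Fin n) (A : Finset (Sym2 (V × Fin (n / Fintype.card V))))
    (h : ∃ σ' : V → Equiv.Perm (Fin (n / Fintype.card V)), pmSet x0 σ' ⊆ copies EH A) :
    HasFactor H (gOf (A.map φ.sym2Map)) := by
  obtain ⟨σ', hσ⟩ := h
  refine ⟨fun z => φ (z.2, if z.2 = x0 then z.1 else σ' z.2 z.1), ?_, ?_⟩
  · rintro ⟨i, x⟩ ⟨j, z⟩ hij
    have h1 := φ.injective hij
    simp only [Prod.mk.injEq] at h1
    obtain ⟨rfl, h2⟩ := h1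
    split_ifs at h2 with hx
    · rw [h2]
    · rw [(σ' x).injective h2]
  · intro i u w huw
    set f : V → Fin (n / Fintype.card V) := fun x => if x = x0 then i else σ' x i with hf
    have hfm : f ∈ pmSet x0 σ' := Finset.mem_image_of_mem _ (Finset.mem_univ i)
    have hc := (Finset.mem_filter.1 (hσ hfm)).2
    have hmem : edgeAt f s(u, w) ∈ A := hc (Finset.mem_image_of_mem _ (hEH u w huw))
    rw [gOf, SimpleGraph.fromEdgeSet_adj]
    constructor
    · rw [Finset.mem_coe, Finset.mem_map]
      exact ⟨_, hmem, rfl⟩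
    · intro hcon
      have := φ.injective hcon
      exact huw.ne (congrArg Prod.fst this)

lemma one_ineq {H : SimpleGraph V} {EH : Finset (Sym2 V)}
    (hEH : ∀ u v, H.Adj u v → s(u, v) ∈ EH) (x0 : V) (n : ℕ) {p : ℝ} (hp0 : 0 ≤ p) (hp1 : p ≤ 1) :
    Ex (univ : Finset (Sym2 (Fin n))) p (fun A => ind (¬ HasFactor H (gOf A))) ≤
    Ex (univ : Finset (Sym2 (V × Fin (n / Fintype.card V)))) p
      (fun G => ind (¬ ∃ σ' : V → Equiv.Perm (Fin (n / Fintype.card V)),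
        pmSet x0 σ' ⊆ copies EH G)) := by
  have hc : Fintype.card (V × Fin (n / Fintype.card V)) ≤ Fintype.card (Fin n) := by
    rw [Fintype.card_prod, Fintype.card_fin, Fintype.card_fin]
    exact Nat.mul_div_le n _
  obtain ⟨φ⟩ := Function.Embedding.nonempty_of_card_le hc
  set t : Finset (Sym2 (Fin n)) := (univ : Finset (Sym2 (V × Fin (n / Fintype.card V)))).map φ.sym2Map
    with ht
  calc _ ≤ Ex (univ : Finset (Sym2 (Fin n))) p (fun A => ind (¬ HasFactor H (gOf (A ∩ t)))) := by
        refine Ex_mono hp0 hp1 fun A _ => ind_mono fun h h' => h ?_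
        exact h'.mono (gOf_mono Finset.inter_subset_left)
    _ = Ex t p (fun A => ind (¬ HasFactor H (gOf A))) :=
        Ex_restrict (Finset.subset_univ t) p (fun A => ind (¬ HasFactor H (gOf A)))
    _ = Ex (univ : Finset (Sym2 (V × Fin (n / Fintype.card V)))) p
        (fun A => ind (¬ HasFactor H (gOf (A.map φ.sym2Map)))) := by
        rw [ht, Ex_map]
    _ ≤ _ := by
        refine Ex_mono hp0 hp1 fun A _ => ind_mono fun h h' => h ?_
        exact factor_of_pm hEH x0 φ A h'

theorem one_stmt {H : SimpleGraph V} {EH : Finset (Sym2 V)} (hB : Bal EH)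
    (hEH : ∀ u v, H.Adj u v → s(u, v) ∈ EH) {p : ℕ → ℝ} (hp : ∀ n, 0 ≤ p n ∧ p n ≤ 1)
    (h : Tendsto (fun n : ℕ => p n ^ #EH * (n:ℝ) ^ (Fintype.card V - 1) / Real.log n) atTop atTop) :
    Tendsto (fun n : ℕ => Ex (univ : Finset (Sym2 (Fin n))) (p n)
      (fun A => ind (¬ HasFactor H (gOf A)))) atTop (𝓝 0) := by
  have hv2 := hB.two_le_card
  obtain ⟨x0⟩ : Nonempty V := Fintype.card_pos_iff.1 (by omega)
  set v := Fintype.card V with hv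
  rw [Metric.tendsto_atTop']
  intro ε hε
  set δ := min (ε / 2) 1 with hδ
  have hδ0 : 0 < δ := by rw [hδ]; positivity
  obtain ⟨K, hK, hev⟩ := core hB x0 hδ0 (min_le_right _ _)
  have hdiv : Tendsto (fun n : ℕ => n / v) atTop atTop :=
    Nat.tendsto_div_const_atTop (by omega)
  have hall : ∀ᶠ n : ℕ in atTop, Ex (univ : Finset (Sym2 (Fin n))) (p n)
      (fun A => ind (¬ HasFactor H (gOf A))) < ε := by
    filter_upwards [hdiv.eventually hev, h.eventually_ge_atTop (K * 3 * (2 * v) ^ (v - 1)),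
      eventually_ge_atTop (2 * v), eventually_ge_atTop 3] with n h1 h2 h3 h4
    refine lt_of_le_of_lt (one_ineq hEH x0 n (hp n).1 (hp n).2) ?_
    refine lt_of_le_of_lt (h1 (p n) (hp n).1 (hp n).2 ?_) ?_
    · have hn3 : (3:ℝ) ≤ n := by exact_mod_cast h4
      have hlog1 : 1 ≤ Real.log n := by
        rw [Real.le_log_iff_exp_le (by linarith)]
        linarith [Real.exp_one_lt_d9]
      have hlog : ((Nat.log 2 (n / v) + 1 : ℕ) : ℝ) ≤ 3 * Real.log n := by
        have e1 : (Nat.log 2 (n / v) : ℝ) ≤ Nat.log 2 n := by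
          exact_mod_cast Nat.log_mono_right (Nat.div_le_self n v)
        have e2 : (Nat.log 2 n : ℝ) * Real.log 2 ≤ Real.log n := by
          rw [← Real.log_pow]
          apply Real.log_le_log (by positivity)
          exact_mod_cast Nat.pow_log_le_self 2 (by omega)
        have e3 := Real.log_two_gt_d9
        push_cast
        have e4 : (0:ℝ) ≤ Nat.log 2 n := by positivity
        nlinarith
      have hmn : (n:ℝ) ≤ 2 * v * (n / v : ℕ) := by
        have e1 : n < v * (n / v) + v := by
          have := Nat.div_add_mod n v
          have := Nat.mod_lt n (show v > 0 by omega)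
          omega
        have e2 : n ≤ 2 * (v * (n / v)) := by omega
        have : (n:ℝ) ≤ 2 * (v * (n / v : ℕ)) := by exact_mod_cast e2
        linarith
      rw [le_div_iff₀ (by linarith)] at h2
      have hvp : (0:ℝ) < (2 * v) ^ (v - 1) := by
        have : 0 < v := by omega
        positivity
      have h5 : (n:ℝ) ^ (v - 1) ≤ (2 * v) ^ (v - 1) * ((n / v : ℕ) : ℝ) ^ (v - 1) := by
        rw [← mul_pow]; gcongr
      have h6 : K * 3 * Real.log n * (2 * v) ^ (v - 1) ≤
          p n ^ #EH * ((n / v : ℕ) : ℝ) ^ (v - 1) * (2 * v) ^ (v - 1) := by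
        calc _ = K * 3 * (2 * v) ^ (v - 1) * Real.log n := by ring
          _ ≤ _ := h2
          _ ≤ p n ^ #EH * ((2 * v) ^ (v - 1) * ((n / v : ℕ) : ℝ) ^ (v - 1)) :=
              mul_le_mul_of_nonneg_left h5 (pow_nonneg (hp n).1 _)
          _ = _ := by ring
      have h7 := le_of_mul_le_mul_right h6 hvp
      calc K * ((Nat.log 2 (n / v) + 1 : ℕ) : ℝ) ≤ K * (3 * Real.log n) := by gcongr
        _ = K * 3 * Real.log n := by ring
        _ ≤ _ := h7
    · calc δ ≤ ε / 2 := min_le_left _ _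
        _ < ε := by linarith
  obtain ⟨N, hN⟩ := eventually_atTop.1 hall
  refine ⟨N, fun n hn => ?_⟩
  rw [Real.dist_eq, sub_zero, abs_of_nonneg]
  · exact hN n hn.le
  · exact Ex_nonneg (hp n).1 (hp n).2 fun _ _ => ind_nonneg _

end Transfer

set_option linter.unusedSectionVars false

section ZeroGen
open Finset
open scoped Classical
variable {α ι : Type*} [Fintype α] [DecidableEq α]

lemma Ex_prod_le {p : ℝ} (hp0 : 0 ≤ p) (hp1 : p ≤ 1) (g : Finset ι) (s0 : Finset α)
    (st : ι → Finset α)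
    (hd0 : ∀ u ∈ g, Disjoint s0 (st u))
    (hd : ∀ u ∈ g, ∀ u' ∈ g, u ≠ u' → Disjoint (st u') (st u))
    (c : ι → Finset α → Finset α → ℝ) (hc0 : ∀ u A B, 0 ≤ c u A B)
    (q : Finset α → ℝ) (hq : ∀ A, 0 ≤ q A)
    (hcq : ∀ u ∈ g, ∀ A0, Ex (st u) p (c u A0) ≤ q A0)
    (φ : Finset α → ℝ) (hφ : ∀ A, 0 ≤ φ A) :
    Ex univ p (fun A => φ (A ∩ s0) * ∏ u ∈ g, c u (A ∩ s0) (A ∩ st u)) ≤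
      Ex univ p (fun A => φ (A ∩ s0) * q (A ∩ s0) ^ #g) := by
  induction g using Finset.induction_on generalizing φ with
  | empty => simp
  | insert u g hu ih =>
    have ih' := ih (fun u hu => hd0 u (Finset.mem_insert_of_mem hu))
      (fun u hu u' hu' => hd u (Finset.mem_insert_of_mem hu) u' (Finset.mem_insert_of_mem hu'))
      (fun u hu => hcq u (Finset.mem_insert_of_mem hu)) (fun A => φ A * q A)
      (fun A => mul_nonneg (hφ A) (hq A))
    have hd0u := hd0 u (Finset.mem_insert_self _ _)
    have hsplit : (univ : Finset α) = (univ \ st u) ∪ st u := by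
      rw [Finset.sdiff_union_of_subset (Finset.subset_univ _)]
    have hi : ∀ (t A B : Finset α), Disjoint t (st u) → B ⊆ st u → (A ∪ B) ∩ t = A ∩ t := by
      intro t A B ht hB
      ext x
      simp only [Finset.mem_inter, Finset.mem_union]
      constructor
      · rintro ⟨h1 | h1, h2⟩
        · exact ⟨h1, h2⟩
        · exact absurd (hB h1) (Finset.disjoint_left.1 ht h2)
      · rintro ⟨h1, h2⟩; exact ⟨Or.inl h1, h2⟩
    have hiu : ∀ (A B : Finset α), A ⊆ univ \ st u → B ⊆ st u → (A ∪ B) ∩ st u = B := by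
      intro A B hA hB
      ext x
      simp only [Finset.mem_inter, Finset.mem_union]
      constructor
      · rintro ⟨h1 | h1, h2⟩
        · exact absurd h2 (Finset.mem_sdiff.1 (hA h1)).2
        · exact h1
      · intro h; exact ⟨Or.inr h, hB h⟩
    have hprod : ∀ (A B : Finset α), B ⊆ st u →
        ∏ u' ∈ g, c u' ((A ∪ B) ∩ s0) ((A ∪ B) ∩ st u') = ∏ u' ∈ g, c u' (A ∩ s0) (A ∩ st u') := by
      intro A B hB
      refine Finset.prod_congr rfl fun u' hu' => ?_
      rw [hi s0 A B hd0u hB, hi (st u') A B (hd u (Finset.mem_insert_self _ _) u'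
        (Finset.mem_insert_of_mem hu') (fun h => hu (h ▸ hu'))) hB]
    calc Ex univ p (fun A => φ (A ∩ s0) * ∏ u ∈ insert u g, c u (A ∩ s0) (A ∩ st u))
        = Ex (univ \ st u) p (fun A => (φ (A ∩ s0) * ∏ u ∈ g, c u (A ∩ s0) (A ∩ st u)) *
            Ex (st u) p (c u (A ∩ s0))) := by
          conv_lhs => rw [hsplit]
          rw [Ex_disj_union Finset.sdiff_disjoint]
          refine Ex_congr fun A hA => ?_
          rw [← Ex_mul]
          refine Ex_congr fun B hB => ?_
          rw [Finset.prod_insert hu, hprod A B hB, hi s0 A B hd0u hB, hiu A B hA hB]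
          ring
      _ ≤ Ex (univ \ st u) p (fun A => (φ (A ∩ s0) * ∏ u ∈ g, c u (A ∩ s0) (A ∩ st u)) *
            q (A ∩ s0)) := by
          refine Ex_mono hp0 hp1 fun A hA => ?_
          refine mul_le_mul_of_nonneg_left (hcq u (Finset.mem_insert_self _ _) _) ?_
          exact mul_nonneg (hφ _) (Finset.prod_nonneg fun _ _ => hc0 _ _ _)
      _ = Ex univ p (fun A => (φ (A ∩ s0) * q (A ∩ s0)) * ∏ u ∈ g, c u (A ∩ s0) (A ∩ st u)) := by
          conv_rhs => rw [hsplit]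
          rw [Ex_disj_union Finset.sdiff_disjoint]
          refine Ex_congr fun A hA => ?_
          rw [← Ex_const (st u) p (φ (A ∩ s0) * (∏ u ∈ g, c u (A ∩ s0) (A ∩ st u)) * q (A ∩ s0))]
          refine Ex_congr fun B hB => ?_
          rw [hprod A B hB, hi s0 A B hd0u hB]
          ring
      _ ≤ _ := ih'
      _ = _ := by
          rw [Finset.card_insert_of_notMem hu]
          refine Ex_congr fun A _ => ?_
          ring

/-- Harris-type lower bound. -/
lemma harris_prod {p : ℝ} (hp0 : 0 ≤ p) (hp1 : p ≤ 1) (T : Finset ι) (s : Finset α)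
    (Z : ι → Finset α) (hZ : ∀ i ∈ T, Z i ⊆ s) :
    ∏ i ∈ T, (1 - p ^ #(Z i)) ≤ Ex s p (fun B => ind (∀ i ∈ T, ¬ Z i ⊆ B)) := by
  induction T using Finset.induction_on with
  | empty =>
    rw [Finset.prod_empty, ← Ex_const s p 1]
    exact (Ex_congr fun A _ => by rw [ind_true]; simp).le
  | insert i T hi ih =>
    have ih' := ih fun j hj => hZ j (Finset.mem_insert_of_mem hj)
    have hpow : p ^ #(Z i) ≤ 1 := pow_le_one₀ hp0 hp1
    have h1 : Ex s p (fun B => ind (Z i ⊆ B) * ind (∀ i ∈ T, ¬ Z i ⊆ B)) ≤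
        p ^ #(Z i) * Ex s p (fun B => ind (∀ i ∈ T, ¬ Z i ⊆ B)) :=
      Ex_subset_le (hZ i (Finset.mem_insert_self _ _)) hp0 hp1
        fun z _ A _ => ind_mono fun h j hj hs => h j hj (hs.trans (Finset.subset_insert _ _))
    calc ∏ i ∈ insert i T, (1 - p ^ #(Z i)) = (1 - p ^ #(Z i)) * ∏ i ∈ T, (1 - p ^ #(Z i)) :=
          Finset.prod_insert hi
      _ ≤ (1 - p ^ #(Z i)) * Ex s p (fun B => ind (∀ i ∈ T, ¬ Z i ⊆ B)) :=
          mul_le_mul_of_nonneg_left ih' (by linarith)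
      _ = Ex s p (fun B => ind (∀ i ∈ T, ¬ Z i ⊆ B)) -
          p ^ #(Z i) * Ex s p (fun B => ind (∀ i ∈ T, ¬ Z i ⊆ B)) := by ring
      _ ≤ Ex s p (fun B => ind (∀ i ∈ T, ¬ Z i ⊆ B)) -
          Ex s p (fun B => ind (Z i ⊆ B) * ind (∀ i ∈ T, ¬ Z i ⊆ B)) := by linarith
      _ = _ := by
          rw [← Ex_sub]
          refine Ex_congr fun B _ => ?_
          have : ind (∀ j ∈ insert i T, ¬ Z j ⊆ B) = ind (¬ Z i ⊆ B ∧ ∀ j ∈ T, ¬ Z j ⊆ B) :=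
            ind_congr (by simp)
          rw [this, ind_and, ind_not]; ring

lemma exp_le_one_sub {t : ℝ} (h0 : 0 ≤ t) (h1 : t ≤ 1 / 2) : Real.exp (-2 * t) ≤ 1 - t := by
  have h2 : 1 + 2 * t ≤ Real.exp (2 * t) := by linarith [Real.add_one_le_exp (2 * t)]
  have h3 : Real.exp (-2 * t) * Real.exp (2 * t) = 1 := by
    rw [← Real.exp_add]; simp
  have h4 := Real.exp_pos (-2 * t)
  have h5 : Real.exp (-2 * t) * (1 + 2 * t) ≤ 1 := by
    calc _ ≤ Real.exp (-2 * t) * Real.exp (2 * t) := mul_le_mul_of_nonneg_left h2 h4.le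
      _ = 1 := h3
  have h6 : (1:ℝ) ≤ (1 - t) * (1 + 2 * t) := by nlinarith
  have h7 : 0 < 1 + 2 * t := by linarith
  exact le_of_mul_le_mul_right (h5.trans h6) h7

end ZeroGen

set_option linter.unusedSectionVars false

section ZeroCov
open Finset
open scoped Classical
variable {V W : Type} [Fintype V] [Fintype W] [DecidableEq W]

/-- image of an edge set. -/
noncomputable def emg (f : V → W) (J : Finset (Sym2 V)) : Finset (Sym2 W) := J.image (Sym2.map f)

noncomputable def inE (EH : Finset (Sym2 V)) (x : V) : Finset (Sym2 V) := EH.filter (x ∉ ·)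
noncomputable def stE (EH : Finset (Sym2 V)) (x : V) : Finset (Sym2 V) := EH.filter (x ∈ ·)

lemma inE_stE_card (EH : Finset (Sym2 V)) (x : V) : #(stE EH x) + #(inE EH x) = #EH :=
  Finset.card_filter_add_card_filter_not _

lemma sym2_map_congr {f g : V → W} {a : Sym2 V} (h : ∀ x ∈ a, f x = g x) :
    Sym2.map f a = Sym2.map g a := Sym2.map_congr h

lemma sym2_map_injOn {f : V → W} {S : Set V} (hf : Set.InjOn f S) {a b : Sym2 V}
    (ha : ∀ x ∈ a, x ∈ S) (hb : ∀ x ∈ b, x ∈ S) (h : Sym2.map f a = Sym2.map f b) : a = b := by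
  induction a using Sym2.ind with
  | _ a1 a2 =>
  induction b using Sym2.ind with
  | _ b1 b2 =>
  simp only [Sym2.mem_iff, forall_eq_or_imp, forall_eq] at ha hb
  simp only [Sym2.map_mk, Sym2.eq_iff] at h ⊢
  rcases h with ⟨h1, h2⟩ | ⟨h1, h2⟩
  · exact Or.inl ⟨hf ha.1 hb.1 h1, hf ha.2 hb.2 h2⟩
  · exact Or.inr ⟨hf ha.1 hb.2 h1, hf ha.2 hb.1 h2⟩

noncomputable def Hset (U : Finset W) (w0 : W) : Finset (V × (V → W)) :=
  univ.filter (fun z => z.2 z.1 = w0 ∧ (∀ y, y ≠ z.1 → z.2 y ∉ U) ∧ Set.InjOn z.2 {z.1}ᶜ)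

lemma Hset_card (U : Finset W) (w0 : W) :
    #(Hset (V := V) U w0) ≤ Fintype.card V * Fintype.card W ^ (Fintype.card V - 1) := by
  have hsub : Hset (V := V) U w0 ⊆ (univ : Finset V).biUnion (fun x =>
      (Fintype.piFinset (fun y => if y = x then {w0} else (univ : Finset W))).image (Prod.mk x)) := by
    rintro ⟨x, h⟩ hz
    have hz' := (Finset.mem_filter.1 hz).2
    refine Finset.mem_biUnion.2 ⟨x, Finset.mem_univ _, Finset.mem_image.2 ⟨h, ?_, rfl⟩⟩
    rw [Fintype.mem_piFinset]
    intro y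
    split_ifs with hy
    · subst hy; exact Finset.mem_singleton.2 hz'.1
    · exact Finset.mem_univ _
  refine (Finset.card_le_card hsub).trans (Finset.card_biUnion_le.trans ?_)
  have : ∀ x ∈ (univ : Finset V), #((Fintype.piFinset (fun y => if y = x then {w0} else (univ : Finset W))).image (Prod.mk x)) ≤ Fintype.card W ^ (Fintype.card V - 1) := by
    intro x _
    refine Finset.card_image_le.trans ?_
    rw [Fintype.card_piFinset]
    apply le_of_eq
    rw [← Finset.mul_prod_erase univ _ (Finset.mem_univ x), if_pos rfl, Finset.card_singleton, one_mul,
      Finset.prod_congr rfl (g := fun _ => Fintype.card W)]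
    · rw [Finset.prod_const, Finset.card_erase_of_mem (Finset.mem_univ x), Finset.card_univ]
    · intro y hy
      rw [if_neg (Finset.ne_of_mem_erase hy), Finset.card_univ]
  refine (Finset.sum_le_sum this).trans ?_
  simp

lemma two_card (U : Finset W) {x y : V} (hxy : x ≠ y) :
    #((univ : Finset (V → W)).filter (fun f => f x ∈ U ∧ f y ∈ U)) ≤
      #U ^ 2 * Fintype.card W ^ (Fintype.card V - 2) := by
  have hsub : (univ : Finset (V → W)).filter (fun f => f x ∈ U ∧ f y ∈ U) ⊆
      Fintype.piFinset (fun z => if z = x then U else if z = y then U else (univ : Finset W)) := by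
    intro f hf
    have hf' := (Finset.mem_filter.1 hf).2
    rw [Fintype.mem_piFinset]
    intro z
    split_ifs with h1 h2
    · subst h1; exact hf'.1
    · subst h2; exact hf'.2
    · exact Finset.mem_univ _
  refine (Finset.card_le_card hsub).trans ?_
  rw [Fintype.card_piFinset]
  apply le_of_eq
  have hy : y ∈ (univ : Finset V).erase x := Finset.mem_erase.2 ⟨hxy.symm, Finset.mem_univ _⟩
  rw [← Finset.mul_prod_erase univ _ (Finset.mem_univ x), if_pos rfl,
    ← Finset.mul_prod_erase _ _ hy, if_neg hxy.symm, if_pos rfl,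
      Finset.prod_congr rfl (g := fun _ => Fintype.card W)]
  · rw [Finset.prod_const, Finset.card_erase_of_mem hy,
      Finset.card_erase_of_mem (Finset.mem_univ x), Finset.card_univ, Nat.sub_sub]
    ring
  · intro z hz
    have h1 := Finset.mem_erase.1 hz
    rw [if_neg (Finset.mem_erase.1 h1.2).1, if_neg h1.1, Finset.card_univ]

lemma Hset_em_in_card {U : Finset W} {w0 : W} {z : V × (V → W)} (hz : z ∈ Hset U w0)
    (EH : Finset (Sym2 V)) : #(emg z.2 (inE EH z.1)) = #(inE EH z.1) := by
  have hz' := (Finset.mem_filter.1 hz).2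
  refine Finset.card_image_of_injOn ?_
  intro a ha b hb hab
  refine sym2_map_injOn hz'.2.2 ?_ ?_ hab
  · intro x hx h
    rw [Set.mem_singleton_iff] at h
    exact (Finset.mem_filter.1 ha).2 (h ▸ hx)
  · intro x hx h
    rw [Set.mem_singleton_iff] at h
    exact (Finset.mem_filter.1 hb).2 (h ▸ hx)

lemma Hset_update_inj {U : Finset W} {w0 u : W} (hu : u ∈ U) {z : V × (V → W)}
    (hz : z ∈ Hset U w0) : Function.Injective (Function.update z.2 z.1 u) := by
  have hz' := (Finset.mem_filter.1 hz).2
  intro a b hab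
  by_cases ha : a = z.1 <;> by_cases hb : b = z.1
  · rw [ha, hb]
  · subst ha
    rw [Function.update_self, Function.update_of_ne hb] at hab
    exact absurd (hab ▸ hu) (hz'.2.1 b hb)
  · subst hb
    rw [Function.update_self, Function.update_of_ne ha] at hab
    exact absurd (hab ▸ hu) (hz'.2.1 a ha)
  · rw [Function.update_of_ne ha, Function.update_of_ne hb] at hab
    exact hz'.2.2 ha hb hab

lemma Hset_em_st_card {U : Finset W} {w0 u : W} (hu : u ∈ U) {z : V × (V → W)}
    (hz : z ∈ Hset U w0) (EH : Finset (Sym2 V)) :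
    #(emg (Function.update z.2 z.1 u) (stE EH z.1)) = #(stE EH z.1) :=
  Finset.card_image_of_injective _ (Sym2.map.injective (Hset_update_inj hu hz))

/-- edges avoiding `U`. -/
noncomputable def s0 (U : Finset W) : Finset (Sym2 W) := univ.filter (fun e => ∀ w ∈ e, w ∉ U)
/-- star edges. -/
noncomputable def sta (U : Finset W) (u : W) : Finset (Sym2 W) :=
  univ.filter (fun e => u ∈ e ∧ ∀ w ∈ e, w = u ∨ w ∉ U)

lemma s0_sta {U : Finset W} {u : W} (hu : u ∈ U) : Disjoint (s0 U) (sta U u) := by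
  rw [Finset.disjoint_left]
  intro e h1 h2
  exact (Finset.mem_filter.1 h1).2 u (Finset.mem_filter.1 h2).2.1 hu

lemma sta_sta {U : Finset W} {u u' : W} (hu : u ∈ U) (h : u ≠ u') :
    Disjoint (sta U u') (sta U u) := by
  rw [Finset.disjoint_left]
  intro e h1 h2
  rcases (Finset.mem_filter.1 h1).2.2 u (Finset.mem_filter.1 h2).2.1 with h3 | h3
  · exact h h3
  · exact h3 hu

lemma em_in_sub {U : Finset W} {w0 : W} {z : V × (V → W)} (hz : z ∈ Hset U w0)
    (EH : Finset (Sym2 V)) : emg z.2 (inE EH z.1) ⊆ s0 U := by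
  have hz' := (Finset.mem_filter.1 hz).2
  intro e he
  obtain ⟨a, ha, rfl⟩ := Finset.mem_image.1 he
  refine Finset.mem_filter.2 ⟨Finset.mem_univ _, ?_⟩
  intro w hw
  obtain ⟨y, hy, rfl⟩ := Sym2.mem_map.1 hw
  exact hz'.2.1 y fun h => (Finset.mem_filter.1 ha).2 (h ▸ hy)

lemma em_st_sub {U : Finset W} {w0 u : W} {z : V × (V → W)} (hz : z ∈ Hset U w0)
    (EH : Finset (Sym2 V)) : emg (Function.update z.2 z.1 u) (stE EH z.1) ⊆ sta U u := by
  have hz' := (Finset.mem_filter.1 hz).2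
  intro e he
  obtain ⟨a, ha, rfl⟩ := Finset.mem_image.1 he
  refine Finset.mem_filter.2 ⟨Finset.mem_univ _, ?_, ?_⟩
  · exact Sym2.mem_map.2 ⟨z.1, (Finset.mem_filter.1 ha).2, Function.update_self _ _ _⟩
  · intro w hw
    obtain ⟨y, hy, rfl⟩ := Sym2.mem_map.1 hw
    by_cases h : y = z.1
    · left; rw [h, Function.update_self]
    · right; rw [Function.update_of_ne h]; exact hz'.2.1 y h

/-- the cover event, split in inner and star part. -/
def CovE (EH : Finset (Sym2 V)) (U : Finset W) (w0 u : W) (A B : Finset (Sym2 W)) : Prop :=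
  ∃ z ∈ Hset (V := V) U w0, emg z.2 (inE EH z.1) ⊆ A ∧ emg (Function.update z.2 z.1 u) (stE EH z.1) ⊆ B

noncomputable def Ycov (EH : Finset (Sym2 V)) (U : Finset W) (w0 : W) (p : ℝ)
    (A : Finset (Sym2 W)) : ℝ :=
  ∑ z ∈ Hset (V := V) U w0, ind (emg z.2 (inE EH z.1) ⊆ A) * p ^ #(stE EH z.1)

lemma Ycov_nonneg (EH : Finset (Sym2 V)) (U : Finset W) (w0 : W) {p : ℝ} (hp : 0 ≤ p)
    (A : Finset (Sym2 W)) : 0 ≤ Ycov EH U w0 p A :=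
  Finset.sum_nonneg fun _ _ => mul_nonneg (ind_nonneg _) (pow_nonneg hp _)

lemma cov_prob {EH : Finset (Sym2 V)} (hB : Bal EH) (U : Finset W) {w0 u : W} (hu : u ∈ U)
    {p : ℝ} (hp0 : 0 ≤ p) (hp1 : p ≤ 1 / 2) (A : Finset (Sym2 W)) :
    Ex (sta U u) p (fun B => ind (CovE EH U w0 u A B)) ≤ 1 - Real.exp (-2 * Ycov EH U w0 p A) := by
  set T := (Hset (V := V) U w0).filter (fun z => emg z.2 (inE EH z.1) ⊆ A) with hT
  have h1 := harris_prod hp0 (by linarith) T (sta U u)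
    (fun z => emg (Function.update z.2 z.1 u) (stE EH z.1))
    (fun z hz => em_st_sub (Finset.mem_filter.1 hz).1 EH)
  have h2 : Ex (sta U u) p (fun B => ind (CovE EH U w0 u A B)) =
      1 - Ex (sta U u) p (fun B => ind (∀ i ∈ T, ¬ emg (Function.update i.2 i.1 u) (stE EH i.1) ⊆ B)) := by
    have e : Ex (sta U u) p (fun B => ind (∀ i ∈ T, ¬ emg (Function.update i.2 i.1 u) (stE EH i.1) ⊆ B)) =
        Ex (sta U u) p (fun B => ind (¬ CovE EH U w0 u A B)) := by
      refine Ex_congr fun B _ => ind_congr ?_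
      unfold CovE
      rw [hT]
      constructor
      · rintro h ⟨z, hz, h3, h4⟩
        exact h z (Finset.mem_filter.2 ⟨hz, h3⟩) h4
      · intro h z hz h4
        exact h ⟨z, (Finset.mem_filter.1 hz).1, (Finset.mem_filter.1 hz).2, h4⟩
    rw [e, Ex_ind_not]; ring
  rw [h2]
  have h3 : Real.exp (-2 * Ycov EH U w0 p A) ≤
      ∏ z ∈ T, (1 - p ^ #(emg (Function.update z.2 z.1 u) (stE EH z.1))) := by
    have e1 : -2 * Ycov EH U w0 p A = ∑ z ∈ T, (-2 * p ^ #(stE EH z.1)) := by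
      rw [← Finset.mul_sum, hT, Finset.sum_filter]
      unfold Ycov
      congr 1
      refine Finset.sum_congr rfl fun z _ => ?_
      unfold ind
      split_ifs <;> simp
    rw [e1, Real.exp_sum]
    refine Finset.prod_le_prod (fun _ _ => (Real.exp_pos _).le) fun z hz => ?_
    rw [Hset_em_st_card hu (Finset.mem_filter.1 hz).1]
    refine exp_le_one_sub (pow_nonneg hp0 _) ?_
    have hx : z.1 ∈ vs EH := by rw [hB.top]; exact Finset.mem_univ _
    obtain ⟨a, ha, hxa⟩ := (Finset.mem_filter.1 hx).2
    have hpos : 0 < #(stE EH z.1) := Finset.card_pos.2 ⟨a, Finset.mem_filter.2 ⟨ha, hxa⟩⟩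
    calc p ^ #(stE EH z.1) ≤ p ^ 1 := pow_le_pow_of_le_one hp0 (by linarith) hpos
      _ ≤ _ := by rw [pow_one]; exact hp1
  linarith

lemma Ycov_exp {EH : Finset (Sym2 V)} (U : Finset W) (w0 : W) {p : ℝ} (hp0 : 0 ≤ p) :
    Ex (univ : Finset (Sym2 W)) p (Ycov EH U w0 p) ≤
      Fintype.card V * (Fintype.card W : ℝ) ^ (Fintype.card V - 1) * p ^ #EH := by
  have h1 : Ex (univ : Finset (Sym2 W)) p (Ycov EH U w0 p) =
      ∑ z ∈ Hset (V := V) U w0, p ^ #EH := by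
    unfold Ycov
    rw [Ex_sum]
    refine Finset.sum_congr rfl fun z hz => ?_
    have : Ex (univ : Finset (Sym2 W)) p
        (fun A => ind (emg z.2 (inE EH z.1) ⊆ A) * p ^ #(stE EH z.1)) =
        p ^ #(stE EH z.1) * Ex (univ : Finset (Sym2 W)) p (fun A => ind (emg z.2 (inE EH z.1) ⊆ A)) := by
      rw [← Ex_mul]; exact Ex_congr fun A _ => mul_comm _ _
    rw [this, Ex_subset (Finset.subset_univ _), Hset_em_in_card hz, ← pow_add, inE_stE_card]
  rw [h1, Finset.sum_const, nsmul_eq_mul]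
  refine mul_le_mul_of_nonneg_right ?_ (pow_nonneg hp0 _)
  exact_mod_cast Hset_card U w0

lemma group_cov {EH : Finset (Sym2 V)} (hB : Bal EH) (U : Finset W) (w0 : W)
    {p : ℝ} (hp0 : 0 ≤ p) (hp1 : p ≤ 1 / 2) (g : Finset W) (hg : g ⊆ U) {L : ℝ} (hL : 0 < L) :
    Ex (univ : Finset (Sym2 W)) p (fun A => ind (∀ u ∈ g, CovE EH U w0 u A A)) ≤
      Fintype.card V * (Fintype.card W : ℝ) ^ (Fintype.card V - 1) * p ^ #EH / L +
        (1 - Real.exp (-2 * L)) ^ #g := by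
  have hp1' : p ≤ 1 := by linarith
  have hexp1 : ∀ y : ℝ, 0 ≤ y → 0 ≤ 1 - Real.exp (-2 * y) := by
    intro y hy
    have : Real.exp (-2 * y) ≤ 1 := Real.exp_le_one_iff.2 (by linarith)
    linarith
  have key := Ex_prod_le hp0 hp1' g (s0 U) (sta U) (fun u hu => s0_sta (hg hu))
    (fun u hu u' hu' h => sta_sta (hg hu) h)
    (fun u A B => ind (CovE EH U w0 u A B)) (fun _ _ _ => ind_nonneg _)
    (fun A => 1 - Real.exp (-2 * Ycov EH U w0 p A))
    (fun A => hexp1 _ (Ycov_nonneg EH U w0 hp0 A))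
    (fun u hu A => cov_prob hB U (hg hu) hp0 hp1 A) (fun _ => 1) (fun _ => zero_le_one)
  simp only [one_mul] at key
  have e1 : Ex (univ : Finset (Sym2 W)) p (fun A => ind (∀ u ∈ g, CovE EH U w0 u A A)) ≤
      Ex univ p (fun A => ∏ u ∈ g, ind (CovE EH U w0 u (A ∩ s0 U) (A ∩ sta U u))) := by
    refine Ex_mono hp0 hp1' fun A _ => ?_
    by_cases h : ∀ u ∈ g, CovE EH U w0 u A A
    · rw [ind_true h]
      apply le_of_eq
      symm
      refine Finset.prod_eq_one fun u hu => ind_true ?_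
      obtain ⟨z, hz, h1, h2⟩ := h u hu
      exact ⟨z, hz, Finset.subset_inter h1 (em_in_sub hz EH),
        Finset.subset_inter h2 (em_st_sub hz EH)⟩
    · rw [ind_false h]
      exact Finset.prod_nonneg fun _ _ => ind_nonneg _
  refine e1.trans (key.trans ?_)
  have e2 : Ex univ p (fun A => (1 - Real.exp (-2 * Ycov EH U w0 p (A ∩ s0 U))) ^ #g) ≤
      Ex univ p (fun A => L⁻¹ * Ycov EH U w0 p A + (1 - Real.exp (-2 * L)) ^ #g) := by
    refine Ex_mono hp0 hp1' fun A _ => ?_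
    have hY0 := Ycov_nonneg EH U w0 hp0 (A ∩ s0 U)
    have hYY : Ycov EH U w0 p (A ∩ s0 U) ≤ Ycov EH U w0 p A :=
      Finset.sum_le_sum fun z _ => mul_le_mul_of_nonneg_right
        (ind_mono fun h => h.trans Finset.inter_subset_left) (pow_nonneg hp0 _)
    have hYL : 0 ≤ L⁻¹ * Ycov EH U w0 p A := mul_nonneg (inv_nonneg.2 hL.le) (hY0.trans hYY)
    by_cases hle : Ycov EH U w0 p (A ∩ s0 U) ≤ L
    · have : (1 - Real.exp (-2 * Ycov EH U w0 p (A ∩ s0 U))) ^ #g ≤ (1 - Real.exp (-2 * L)) ^ #g := by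
        refine pow_le_pow_left₀ (hexp1 _ hY0) ?_ _
        have : Real.exp (-2 * L) ≤ Real.exp (-2 * Ycov EH U w0 p (A ∩ s0 U)) :=
          Real.exp_le_exp.2 (by linarith)
        linarith
      linarith
    · push Not at hle
      have h1 : 1 ≤ L⁻¹ * Ycov EH U w0 p A := by
        rw [inv_mul_eq_div, le_div_iff₀ hL]; linarith
      have h2 : (1 - Real.exp (-2 * Ycov EH U w0 p (A ∩ s0 U))) ^ #g ≤ 1 :=
        pow_le_one₀ (hexp1 _ hY0) (by linarith [Real.exp_pos (-2 * Ycov EH U w0 p (A ∩ s0 U))])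
      have h3 : 0 ≤ (1 - Real.exp (-2 * L)) ^ #g := pow_nonneg (hexp1 _ hL.le) _
      linarith
  refine e2.trans ?_
  rw [Ex_add, Ex_mul, Ex_const]
  have := Ycov_exp (EH := EH) U w0 hp0
  have h4 : L⁻¹ * Ex (univ : Finset (Sym2 W)) p (Ycov EH U w0 p) ≤
      L⁻¹ * (Fintype.card V * (Fintype.card W : ℝ) ^ (Fintype.card V - 1) * p ^ #EH) :=
    mul_le_mul_of_nonneg_left this (inv_nonneg.2 hL.le)
  rw [inv_mul_eq_div (L) (_ * _)] at h4
  exact add_le_add_left h4 _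

/-- some copy meets `U` twice. -/
def Two (EH : Finset (Sym2 V)) (U : Finset W) (A : Finset (Sym2 W)) : Prop :=
  ∃ f : V → W, Function.Injective f ∧ emg f EH ⊆ A ∧ ∃ x y, x ≠ y ∧ f x ∈ U ∧ f y ∈ U

lemma two_prob (EH : Finset (Sym2 V)) (U : Finset W) {p : ℝ} (hp0 : 0 ≤ p) (hp1 : p ≤ 1) :
    Ex (univ : Finset (Sym2 W)) p (fun A => ind (Two EH U A)) ≤
      Fintype.card V ^ 2 * ((#U:ℝ) ^ 2 * (Fintype.card W : ℝ) ^ (Fintype.card V - 2)) * p ^ #EH := by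
  set Q : Finset (V × V) := univ.filter (fun z => z.1 ≠ z.2) with hQ
  set Fs : V × V → Finset (V → W) := fun z =>
    (univ.filter (fun f => f z.1 ∈ U ∧ f z.2 ∈ U)).filter Function.Injective with hFs
  calc _ ≤ Ex (univ : Finset (Sym2 W)) p (fun A => ∑ z ∈ Q, ∑ f ∈ Fs z, ind (emg f EH ⊆ A)) := by
        refine Ex_mono hp0 hp1 fun A _ => ?_
        have h1 : ind (Two EH U A) ≤ ind (∃ z ∈ Q, ∃ f ∈ Fs z, emg f EH ⊆ A) := by
          refine ind_mono ?_
          rintro ⟨f, hf, hA, x, y, hxy, hx, hy⟩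
          exact ⟨(x, y), Finset.mem_filter.2 ⟨Finset.mem_univ _, hxy⟩, f,
            Finset.mem_filter.2 ⟨Finset.mem_filter.2 ⟨Finset.mem_univ _, hx, hy⟩, hf⟩, hA⟩
        refine h1.trans ((ind_exists_le _ _).trans ?_)
        exact Finset.sum_le_sum fun z _ => ind_exists_le _ _
    _ = ∑ z ∈ Q, ∑ f ∈ Fs z, p ^ #EH := by
        rw [Ex_sum]
        refine Finset.sum_congr rfl fun z _ => ?_
        rw [Ex_sum]
        refine Finset.sum_congr rfl fun f hf => ?_
        rw [Ex_subset (Finset.subset_univ _), emg,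
          Finset.card_image_of_injective _ (Sym2.map.injective (Finset.mem_filter.1 hf).2)]
    _ ≤ ∑ z ∈ Q, ((#U:ℝ) ^ 2 * (Fintype.card W : ℝ) ^ (Fintype.card V - 2)) * p ^ #EH := by
        refine Finset.sum_le_sum fun z hz => ?_
        rw [Finset.sum_const, nsmul_eq_mul]
        refine mul_le_mul_of_nonneg_right ?_ (pow_nonneg hp0 _)
        have := (Finset.card_le_card (Finset.filter_subset Function.Injective _)).trans
          (two_card (W := W) U (Finset.mem_filter.1 hz).2)
        exact_mod_cast this
    _ ≤ _ := by
        rw [Finset.sum_const, nsmul_eq_mul, mul_assoc ((Fintype.card V:ℝ) ^ 2)]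
        refine mul_le_mul_of_nonneg_right ?_ (mul_nonneg (by positivity) (pow_nonneg hp0 _))
        have : #Q ≤ Fintype.card V ^ 2 := by
          refine (Finset.card_le_univ _).trans ?_
          rw [Fintype.card_prod, sq]
        exact_mod_cast this

end ZeroCov

set_option linter.unusedSectionVars false

section ZeroFin
open Finset
open scoped Classical
variable {V : Type} [Fintype V]

lemma factor_det {H : SimpleGraph V} {EH : Finset (Sym2 V)} (hv : 0 < Fintype.card V)
    (hEH : ∀ u v, s(u, v) ∈ EH → H.Adj u v) {n k : ℕ} (φ : V × Fin k ↪ Fin n) (w0 : Fin n)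
    (A : Finset (Sym2 (Fin n))) (hF : HasFactor H (gOf A)) :
    Two EH (univ.map φ) A ∨ ∃ x : V, ∀ u ∈ univ.image (fun j : Fin k => φ (x, j)),
      CovE EH (univ.map φ) w0 u A A := by
  obtain ⟨f, hf, hadj⟩ := hF
  have hcopy : ∀ i, emg (fun x => f (i, x)) EH ⊆ A := by
    intro i e he
    obtain ⟨a, ha, rfl⟩ := Finset.mem_image.1 he
    induction a using Sym2.ind with
    | _ a b =>
    have h := hadj i (hEH a b ha)
    rw [gOf, SimpleGraph.fromEdgeSet_adj] at h
    exact_mod_cast h.1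
  have hinj : ∀ i, Function.Injective (fun x => f (i, x)) := by
    intro i x y hxy
    exact congrArg Prod.snd (hf hxy)
  by_cases h2 : Two EH (univ.map φ) A
  · exact Or.inl h2
  refine Or.inr ?_
  have hgrp : ∃ x : V, ∀ j : Fin k, φ (x, j) ∈ univ.image f := by
    by_contra hcon
    push Not at hcon
    choose j hj using hcon
    have hsub : univ.image (fun x => φ (x, j x)) ⊆ (univ : Finset (Fin n)) \ univ.image f := by
      intro w hw
      obtain ⟨x, _, rfl⟩ := Finset.mem_image.1 hw
      exact Finset.mem_sdiff.2 ⟨Finset.mem_univ _, hj x⟩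
    have hc := Finset.card_le_card hsub
    rw [Finset.card_image_of_injective _ (by
        intro x y hxy
        exact congrArg Prod.fst (φ.injective hxy)),
      Finset.card_sdiff_of_subset (Finset.subset_univ _), Finset.card_image_of_injective _ hf] at hc
    simp only [Finset.card_univ, Fintype.card_prod, Fintype.card_fin] at hc
    have h1 := Nat.div_add_mod n (Fintype.card V)
    have h3 := Nat.mod_lt n hv
    rw [mul_comm] at h1
    omega
  obtain ⟨x0, hx0⟩ := hgrp
  refine ⟨x0, ?_⟩
  intro u hu
  obtain ⟨j, _, rfl⟩ := Finset.mem_image.1 hu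
  obtain ⟨⟨i, x⟩, _, hix⟩ := Finset.mem_image.1 (hx0 j)
  set u := φ (x0, j) with hudef
  have huU : u ∈ univ.map φ := Finset.mem_map_of_mem _ (Finset.mem_univ _)
  set g : V → Fin n := fun y => f (i, y) with hg
  have hgx : g x = u := hix
  have hupd : Function.update (Function.update g x w0) x u = g := by
    rw [Function.update_idem, ← hgx, Function.update_eq_self]
  have hnot : ∀ y, y ≠ x → g y ∉ univ.map φ := by
    intro y hy hyU
    exact h2 ⟨g, hinj i, hcopy i, x, y, hy.symm, hgx ▸ huU, hyU⟩
  have hcomp : ∀ y, y ≠ x → Function.update g x w0 y = g y := fun y hy => Function.update_of_ne hy _ _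
  refine ⟨(x, Function.update g x w0), ?_, ?_, ?_⟩
  · refine Finset.mem_filter.2 ⟨Finset.mem_univ _, Function.update_self x w0 g, ?_, ?_⟩
    · intro y hy
      show Function.update g x w0 y ∉ _
      rw [hcomp y hy]; exact hnot y hy
    · intro y hy z hz hyz
      have hyz' : Function.update g x w0 y = Function.update g x w0 z := hyz
      rw [hcomp y hy, hcomp z hz] at hyz'
      exact hinj i hyz'
  · show emg (Function.update g x w0) (inE EH x) ⊆ A
    intro e he
    obtain ⟨a, ha, rfl⟩ := Finset.mem_image.1 he
    have ha' := Finset.mem_filter.1 ha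
    have : Sym2.map (Function.update g x w0) a = Sym2.map g a :=
      Sym2.map_congr fun y hy => hcomp y fun h => ha'.2 (h ▸ hy)
    rw [this]
    exact hcopy i (Finset.mem_image_of_mem _ ha'.1)
  · show emg (Function.update (Function.update g x w0) x u) (stE EH x) ⊆ A
    rw [hupd]
    exact (Finset.image_subset_image (Finset.filter_subset _ _)).trans (hcopy i)

lemma zero_bound {H : SimpleGraph V} {EH : Finset (Sym2 V)} (hB : Bal EH)
    (hEH : ∀ u v, s(u, v) ∈ EH → H.Adj u v) {n k : ℕ} (hn : 0 < n)
    (hk : Fintype.card V * k ≤ n) {p : ℝ} (hp0 : 0 ≤ p) (hp1 : p ≤ 1 / 2) {L : ℝ} (hL : 0 < L) :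
    Ex (univ : Finset (Sym2 (Fin n))) p (fun A => ind (HasFactor H (gOf A))) ≤
      Fintype.card V ^ 2 * ((Fintype.card V * k : ℝ) ^ 2 * (n : ℝ) ^ (Fintype.card V - 2)) * p ^ #EH +
      Fintype.card V * (Fintype.card V * (n : ℝ) ^ (Fintype.card V - 1) * p ^ #EH / L +
        (1 - Real.exp (-2 * L)) ^ k) := by
  have hv2 := hB.two_le_card
  have hp1' : p ≤ 1 := by linarith
  have hc : Fintype.card (V × Fin k) ≤ Fintype.card (Fin n) := by
    simpa [Fintype.card_prod, Fintype.card_fin] using hk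
  obtain ⟨φ⟩ := Function.Embedding.nonempty_of_card_le hc
  set w0 : Fin n := ⟨0, hn⟩
  set U : Finset (Fin n) := univ.map φ with hU
  have hUc : #U = Fintype.card V * k := by
    rw [hU, Finset.card_map, Finset.card_univ, Fintype.card_prod, Fintype.card_fin]
  set g : V → Finset (Fin n) := fun x => univ.image (fun j : Fin k => φ (x, j)) with hg
  have hgc : ∀ x, #(g x) = k := by
    intro x
    rw [hg]
    simp only
    rw [Finset.card_image_of_injective, Finset.card_univ, Fintype.card_fin]
    intro i j hij
    exact congrArg Prod.snd (φ.injective hij)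
  have hgU : ∀ x, g x ⊆ U := by
    intro x w hw
    obtain ⟨j, _, rfl⟩ := Finset.mem_image.1 hw
    exact Finset.mem_map_of_mem _ (Finset.mem_univ _)
  calc _ ≤ Ex (univ : Finset (Sym2 (Fin n))) p (fun A => ind (Two EH U A) +
        ∑ x : V, ind (∀ u ∈ g x, CovE EH U w0 u A A)) := by
        refine Ex_mono hp0 hp1' fun A _ => ?_
        have h1 : ind (HasFactor H (gOf A)) ≤
            ind (Two EH U A ∨ ∃ x ∈ (univ : Finset V), ∀ u ∈ g x, CovE EH U w0 u A A) := by
          refine ind_mono fun h => ?_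
          rcases factor_det (by omega) hEH φ w0 A h with h | ⟨x, hx⟩
          · exact Or.inl h
          · exact Or.inr ⟨x, Finset.mem_univ _, hx⟩
        refine h1.trans ((ind_or_le _ _).trans ?_)
        have := ind_exists_le (univ : Finset V) (fun x => ∀ u ∈ g x, CovE EH U w0 u A A)
        linarith
    _ = Ex (univ : Finset (Sym2 (Fin n))) p (fun A => ind (Two EH U A)) +
        ∑ x : V, Ex (univ : Finset (Sym2 (Fin n))) p
          (fun A => ind (∀ u ∈ g x, CovE EH U w0 u A A)) := by
        rw [Ex_add, Ex_sum]
    _ ≤ _ := by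
        refine add_le_add ?_ ?_
        · have := two_prob EH U hp0 hp1'
          rw [hUc, Fintype.card_fin] at this
          push_cast at this
          exact this
        · calc _ ≤ ∑ x : V, (Fintype.card V * (n : ℝ) ^ (Fintype.card V - 1) * p ^ #EH / L +
              (1 - Real.exp (-2 * L)) ^ k) := by
                refine Finset.sum_le_sum fun x _ => ?_
                have := group_cov hB U w0 hp0 hp1 (g x) (hgU x) hL
                rw [hgc, Fintype.card_fin] at this
                exact this
            _ = _ := by rw [Finset.sum_const, nsmul_eq_mul, Finset.card_univ]

lemma zero_num (v e n k : ℕ) (hv : 2 ≤ v) (hn : 3 ≤ n) (hk0 : 1 ≤ k) (hk1 : k ^ 4 ≤ n) (hk2 : n < (k + 1) ^ 4)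
    {p : ℝ} (hp0 : 0 ≤ p) :
    (v:ℝ) ^ 2 * ((v * k : ℝ) ^ 2 * (n : ℝ) ^ (v - 2)) * p ^ e +
      v * (v * (n : ℝ) ^ (v - 1) * p ^ e / (Real.log n / 16) +
        (1 - Real.exp (-2 * (Real.log n / 16))) ^ k) ≤
    (2 * (v:ℝ) ^ 4 + 16 * v ^ 2) * (p ^ e * (n:ℝ) ^ (v - 1) / Real.log n) +
      v * Real.exp (-(Real.exp (Real.log n / 8) / 2)) := by
  have hn3 : (3:ℝ) ≤ n := by exact_mod_cast hn
  have hn0 : (0:ℝ) < n := by linarith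
  have hlog1 : 1 ≤ Real.log n := by
    rw [Real.le_log_iff_exp_le (by linarith)]
    linarith [Real.exp_one_lt_d9]
  have hlog0 : 0 < Real.log n := by linarith
  have hpe : 0 ≤ p ^ e := pow_nonneg hp0 _
  set a := p ^ e * (n:ℝ) ^ (v - 1) / Real.log n with ha
  have hal : a * Real.log n = p ^ e * (n:ℝ) ^ (v - 1) := by
    rw [ha]; field_simp
  have ha0 : 0 ≤ a := by rw [ha]; positivity
  have hsq : (k:ℝ) ^ 2 ≤ Real.sqrt n := by
    apply Real.le_sqrt_of_sq_le
    have : ((k:ℝ)) ^ 4 ≤ n := by exact_mod_cast hk1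
    calc ((k:ℝ) ^ 2) ^ 2 = (k:ℝ) ^ 4 := by ring
      _ ≤ _ := this
  have hls : Real.log n ≤ 2 * Real.sqrt n := by
    have h1 : Real.log (Real.sqrt n) ≤ Real.sqrt n - 1 :=
      Real.log_le_sub_one_of_pos (Real.sqrt_pos.2 hn0)
    rw [Real.log_sqrt hn0.le] at h1
    linarith
  have hkl : (k:ℝ) ^ 2 * Real.log n ≤ 2 * n := by
    calc (k:ℝ) ^ 2 * Real.log n ≤ Real.sqrt n * (2 * Real.sqrt n) := by gcongr
      _ = 2 * (Real.sqrt n * Real.sqrt n) := by ring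
      _ = 2 * n := by rw [Real.mul_self_sqrt hn0.le]
  have hnp : (n:ℝ) ^ (v - 1) = (n:ℝ) ^ (v - 2) * n := by
    rw [← pow_succ]; congr 1; omega
  have t1 : (v:ℝ) ^ 2 * ((v * k : ℝ) ^ 2 * (n : ℝ) ^ (v - 2)) * p ^ e ≤ 2 * (v:ℝ) ^ 4 * a := by
    have h1 : (k:ℝ) ^ 2 * ((n:ℝ) ^ (v - 2) * p ^ e) ≤ 2 * a := by
      have h2 : (k:ℝ) ^ 2 * ((n:ℝ) ^ (v - 2) * p ^ e) * n ≤ 2 * a * n := by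
        calc _ = (k:ℝ) ^ 2 * (p ^ e * (n:ℝ) ^ (v - 1)) := by rw [hnp]; ring
          _ = ((k:ℝ) ^ 2 * Real.log n) * a := by rw [← hal]; ring
          _ ≤ (2 * n) * a := by gcongr
          _ = _ := by ring
      exact le_of_mul_le_mul_right h2 hn0
    calc _ = (v:ℝ) ^ 4 * ((k:ℝ) ^ 2 * ((n:ℝ) ^ (v - 2) * p ^ e)) := by ring
      _ ≤ (v:ℝ) ^ 4 * (2 * a) := by gcongr
      _ = _ := by ring
  have t2 : v * (n : ℝ) ^ (v - 1) * p ^ e / (Real.log n / 16) = 16 * v * a := by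
    rw [ha]; field_simp
  set y := Real.exp (Real.log n / 8) with hy
  have hy0 : 0 < y := Real.exp_pos _
  have hy8 : y ^ 8 = n := by
    rw [hy, ← Real.exp_nat_mul]
    rw [show ((8:ℕ):ℝ) * (Real.log n / 8) = Real.log n by push_cast; ring, Real.exp_log hn0]
  have hky : y ^ 2 ≤ 2 * k := by
    have h1 : (y ^ 2) ^ (4:ℕ) ≤ (2 * k : ℝ) ^ (4:ℕ) := by
      have h2 : (n:ℝ) ≤ (k + 1 : ℝ) ^ 4 := by exact_mod_cast hk2.le
      have h3 : (k + 1 : ℝ) ≤ 2 * k := by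
        have : (1:ℝ) ≤ k := by exact_mod_cast hk0
        linarith
      calc (y ^ 2) ^ (4:ℕ) = y ^ (8:ℕ) := by ring
        _ = (n:ℝ) := hy8
        _ ≤ _ := h2
        _ ≤ _ := by gcongr
    exact le_of_pow_le_pow_left₀ (by norm_num) (by positivity) h1
  have t3 : (1 - Real.exp (-2 * (Real.log n / 16))) ^ k ≤ Real.exp (-(y / 2)) := by
    have e1 : Real.exp (-2 * (Real.log n / 16)) = y⁻¹ := by
      rw [hy, ← Real.exp_neg]; congr 1; ring
    rw [e1]
    have hy1 : 1 ≤ y := by rw [hy]; exact Real.one_le_exp (by positivity)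
    have h1 : 1 - y⁻¹ ≤ Real.exp (-y⁻¹) := by linarith [Real.add_one_le_exp (-y⁻¹)]
    have h0 : 0 ≤ 1 - y⁻¹ := by
      have := inv_le_one_of_one_le₀ hy1
      linarith
    calc (1 - y⁻¹) ^ k ≤ Real.exp (-y⁻¹) ^ k := pow_le_pow_left₀ h0 h1 k
      _ = Real.exp (-(y⁻¹ * k)) := by rw [← Real.exp_nat_mul]; congr 1; ring
      _ ≤ _ := by
        apply Real.exp_le_exp.2
        apply neg_le_neg
        rw [inv_mul_eq_div, le_div_iff₀ hy0]
        nlinarith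
  rw [t2]
  have t4 : (v:ℝ) * (1 - Real.exp (-2 * (Real.log n / 16))) ^ k ≤ v * Real.exp (-(y / 2)) := by
    gcongr
  linarith

theorem zero_stmt {H : SimpleGraph V} {EH : Finset (Sym2 V)} (hB : Bal EH)
    (hEH : ∀ u v, s(u, v) ∈ EH → H.Adj u v) {p : ℕ → ℝ} (hp : ∀ n, 0 ≤ p n ∧ p n ≤ 1)
    (h : Tendsto (fun n : ℕ => p n ^ #EH * (n:ℝ) ^ (Fintype.card V - 1) / Real.log n) atTop (𝓝 0)) :
    Tendsto (fun n : ℕ => Ex (univ : Finset (Sym2 (Fin n))) (p n)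
      (fun A => ind (HasFactor H (gOf A)))) atTop (𝓝 0) := by
  have hv2 := hB.two_le_card
  set v := Fintype.card V with hv
  have hlim : Tendsto (fun n : ℕ => (2 * (v:ℝ) ^ 4 + 16 * v ^ 2) *
      (p n ^ #EH * (n:ℝ) ^ (v - 1) / Real.log n) +
      v * Real.exp (-(Real.exp (Real.log n / 8) / 2))) atTop (𝓝 0) := by
    have h1 : Tendsto (fun n : ℕ => Real.log (n:ℝ)) atTop atTop :=
      Real.tendsto_log_atTop.comp tendsto_natCast_atTop_atTop
    have h2 : Tendsto (fun n : ℕ => Real.exp (Real.log (n:ℝ) / 8) / 2) atTop atTop :=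
      (Real.tendsto_exp_atTop.comp (h1.atTop_div_const (by norm_num))).atTop_div_const (by norm_num)
    have h3 : Tendsto (fun n : ℕ => Real.exp (-(Real.exp (Real.log (n:ℝ) / 8) / 2))) atTop (𝓝 0) :=
      Real.tendsto_exp_neg_atTop_nhds_zero.comp h2
    have := (h.const_mul (2 * (v:ℝ) ^ 4 + 16 * v ^ 2)).add (h3.const_mul (v:ℝ))
    simpa using this
  refine squeeze_zero' (Eventually.of_forall fun n =>
    Ex_nonneg (hp n).1 (hp n).2 fun _ _ => ind_nonneg _) ?_ hlim
  have hsmall : ∀ᶠ n : ℕ in atTop, p n ^ #EH * (n:ℝ) ^ (v - 1) / Real.log n < (1 / 2) ^ #EH :=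
    h.eventually_lt_const (by positivity)
  filter_upwards [hsmall, eventually_ge_atTop 3, eventually_ge_atTop (v ^ 4)] with n h1 h2 h3
  have hn3 : (3:ℝ) ≤ n := by exact_mod_cast h2
  have hlog1 : 1 ≤ Real.log n := by
    rw [Real.le_log_iff_exp_le (by linarith)]
    linarith [Real.exp_one_lt_d9]
  have hp2 : p n ≤ 1 / 2 := by
    have e0 : #EH ≠ 0 := (Finset.card_pos.2 hB.ne).ne'
    have hpe := pow_nonneg (hp n).1 #EH
    have e1 : p n ^ #EH ≤ p n ^ #EH * (n:ℝ) ^ (v - 1) / Real.log n := by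
      rw [le_div_iff₀ (by linarith)]
      refine mul_le_mul_of_nonneg_left ?_ hpe
      calc Real.log n ≤ n := (Real.log_le_sub_one_of_pos (by linarith)).trans (by linarith)
        _ = (n:ℝ) ^ 1 := (pow_one _).symm
        _ ≤ (n:ℝ) ^ (v - 1) := pow_le_pow_right₀ (by linarith) (by omega)
    exact le_of_pow_le_pow_left₀ e0 (by norm_num) (e1.trans h1.le)
  set k := Nat.sqrt (Nat.sqrt n) with hk
  have hk1 : k ^ 4 ≤ n := by
    have e1 := Nat.sqrt_le' n
    have e2 := Nat.sqrt_le' (Nat.sqrt n)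
    calc k ^ 4 = (k ^ 2) ^ 2 := by ring
      _ ≤ (Nat.sqrt n) ^ 2 := Nat.pow_le_pow_left e2 2
      _ ≤ n := e1
  have hk2 : n < (k + 1) ^ 4 := by
    have e1 := Nat.sqrt_lt'.1 (show Nat.sqrt n < Nat.sqrt n + 1 by omega)
    have e2 := Nat.sqrt_lt'.1 (show Nat.sqrt (Nat.sqrt n) < k + 1 by omega)
    calc n < (Nat.sqrt n + 1) ^ 2 := e1
      _ ≤ ((k + 1) ^ 2) ^ 2 := Nat.pow_le_pow_left e2 2
      _ = _ := by ring
  have hkv : v ≤ k := by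
    by_contra hcon
    have : (k + 1) ^ 4 ≤ v ^ 4 := Nat.pow_le_pow_left (by omega) 4
    omega
  have hvk : v * k ≤ n := by
    calc v * k ≤ k * k := Nat.mul_le_mul_right _ hkv
      _ = k ^ 2 := by ring
      _ ≤ k ^ 4 := Nat.pow_le_pow_right (by omega) (by norm_num)
      _ ≤ n := hk1
  refine (zero_bound hB hEH (by omega) hvk (hp n).1 hp2 (L := Real.log n / 16) (by linarith)).trans ?_
  exact zero_num v #EH n k hv2 h2 (by omega) hk1 hk2 (hp n).1

end ZeroFin

set_option linter.unusedSectionVars false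

section GnpEx
open Finset
open scoped Classical

lemma bern_true {p : ℝ} (h1 : p ≤ 1) : bernoulliMeasure p {true} = ENNReal.ofReal p := by
  have : ENNReal.ofReal p ≤ 1 := by
    rw [← ENNReal.ofReal_one]; exact ENNReal.ofReal_le_ofReal h1
  simp [bernoulliMeasure, min_eq_left this]

lemma bern_false {p : ℝ} (h0 : 0 ≤ p) (h1 : p ≤ 1) :
    bernoulliMeasure p {false} = ENNReal.ofReal (1 - p) := by
  have : ENNReal.ofReal p ≤ 1 := by
    rw [← ENNReal.ofReal_one]; exact ENNReal.ofReal_le_ofReal h1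
  simp [bernoulliMeasure, min_eq_left this, ENNReal.ofReal_sub _ h0]

lemma bern_finite {p : ℝ} (h0 : 0 ≤ p) (h1 : p ≤ 1) : IsFiniteMeasure (bernoulliMeasure p) := by
  refine ⟨?_⟩
  have : (Set.univ : Set Bool) = {true} ∪ {false} := by ext b; cases b <;> simp
  rw [this]
  refine (measure_union_le _ _).trans_lt ?_
  rw [bern_true h1, bern_false h0 h1]
  exact ENNReal.add_lt_top.2 ⟨ENNReal.ofReal_lt_top, ENNReal.ofReal_lt_top⟩

/-- the open edges of an outcome. -/
noncomputable def opn {n : ℕ} (ω : Sym2 (Fin n) → Bool) : Finset (Sym2 (Fin n)) :=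
  univ.filter (fun e => ω e = true)

lemma graphOf_eq {n : ℕ} (ω : Sym2 (Fin n) → Bool) : graphOf ω = gOf (opn ω) := by
  ext u v
  simp only [graphOf, gOf, opn, SimpleGraph.fromRel_adj, SimpleGraph.fromEdgeSet_adj,
    Finset.coe_filter, Set.mem_ofPred_eq, Finset.mem_univ, true_and]
  rw [Sym2.eq_swap (a := v) (b := u)]
  tauto

lemma gnp_singleton {n : ℕ} {p : ℝ} (h0 : 0 ≤ p) (h1 : p ≤ 1) (ω : Sym2 (Fin n) → Bool) :
    gnp n p {ω} = ENNReal.ofReal (p ^ #(opn ω) * (1 - p) ^ #(univ \ opn ω)) := by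
  have := bern_finite h0 h1
  have hq : 0 ≤ 1 - p := by linarith
  rw [gnp, Measure.pi_singleton]
  have e1 : ∀ e : Sym2 (Fin n), bernoulliMeasure p {ω e} =
      ENNReal.ofReal (if ω e = true then p else 1 - p) := by
    intro e
    by_cases h : ω e = true
    · rw [if_pos h, h, bern_true h1]
    · rw [if_neg h, Bool.eq_false_of_not_eq_true h, bern_false h0 h1]
  rw [Finset.prod_congr rfl fun e _ => e1 e, ← ENNReal.ofReal_prod_of_nonneg]
  · congr 1
    rw [Finset.prod_ite, Finset.prod_const, Finset.prod_const]
    congr 3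
    ext e
    simp [opn]
  · intro e _
    split_ifs <;> assumption

lemma gnp_eq {n : ℕ} {p : ℝ} (h0 : 0 ≤ p) (h1 : p ≤ 1) (P : SimpleGraph (Fin n) → Prop) :
    gnp n p {ω | P (graphOf ω)} =
      ENNReal.ofReal (Ex (univ : Finset (Sym2 (Fin n))) p (fun A => ind (P (gOf A)))) := by
  have hq : 0 ≤ 1 - p := by linarith
  have hset : {ω : Sym2 (Fin n) → Bool | P (graphOf ω)} =
      ((univ.filter (fun ω : Sym2 (Fin n) → Bool => P (graphOf ω)) : Finset _) : Set _) := by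
    ext ω; simp
  rw [hset, ← sum_measure_singleton, Finset.sum_congr rfl fun ω _ => gnp_singleton h0 h1 ω,
    ← ENNReal.ofReal_sum_of_nonneg (fun ω _ => by positivity)]
  congr 1
  unfold Ex
  rw [Finset.sum_filter]
  refine Finset.sum_nbij' opn (fun A e => decide (e ∈ A)) ?_ ?_ ?_ ?_ ?_
  · intro ω _; simp
  · intro A _; simp
  · intro ω _
    funext e
    by_cases h : ω e = true <;> simp [opn, h]
  · intro A _
    ext e; simp [opn]
  · intro ω _
    simp only [graphOf_eq]
    unfold ind
    split_ifs <;> simp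

end GnpEx

section Densities
open Finset
open scoped Classical
variable {V : Type} [Fintype V]

/-- edges of `H` as a finset. -/
noncomputable def eF (H : SimpleGraph V) : Finset (Sym2 V) := (Set.toFinite H.edgeSet).toFinset

lemma mem_eF {H : SimpleGraph V} {a : Sym2 V} : a ∈ eF H ↔ a ∈ H.edgeSet :=
  Set.Finite.mem_toFinset _

lemma eF_card (H : SimpleGraph V) : H.edgeSet.ncard = #(eF H) :=
  Set.ncard_eq_toFinset_card _ _

/-- subgraph spanned by a set of edges. -/
def subOf (H : SimpleGraph V) (A : Finset (Sym2 V)) (hA : A ⊆ eF H) : H.Subgraph where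
  verts := (vs A : Set V)
  Adj u v := s(u, v) ∈ A
  adj_sub h := by
    have := mem_eF.1 (hA h)
    exact this
  edge_vert := by
    intro u v h
    exact Finset.mem_coe.2 (Finset.mem_filter.2 ⟨Finset.mem_univ _, _, h, Sym2.mem_mk_left _ _⟩)
  symm := by
    constructor
    intro u v h
    show s(v, u) ∈ A
    rw [Sym2.eq_swap]; exact h

lemma subOf_edge (H : SimpleGraph V) (A : Finset (Sym2 V)) (hA : A ⊆ eF H) :
    (subOf H A hA).edgeSet = (A : Set (Sym2 V)) := by
  ext a
  induction a using Sym2.ind with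
  | _ u v => rw [SimpleGraph.Subgraph.mem_edgeSet]; rfl

lemma bal_of {H : SimpleGraph V} (hV : 2 ≤ Fintype.card V) (hE : H.edgeSet.Nonempty)
    (hbal : StrictlyOneBalanced H) : Bal (eF H) := by
  have hne : (eF H).Nonempty := by
    obtain ⟨a, ha⟩ := hE
    exact ⟨a, mem_eF.2 ha⟩
  have hnd : ∀ a ∈ eF H, ¬ a.IsDiag := fun a ha => H.not_isDiag_of_mem_edgeSet (mem_eF.1 ha)
  have h2 : ∀ A ⊆ eF H, A.Nonempty → 1 < #(vs A) := by
    intro A hA hAne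
    obtain ⟨a, ha⟩ := hAne
    have hd := hnd a (hA ha)
    induction a using Sym2.ind with
    | _ u v =>
    rw [Sym2.mk_isDiag_iff] at hd
    exact Finset.one_lt_card.2 ⟨u, Finset.mem_filter.2 ⟨Finset.mem_univ _, _, ha, Sym2.mem_mk_left _ _⟩,
      v, Finset.mem_filter.2 ⟨Finset.mem_univ _, _, ha, Sym2.mem_mk_right _ _⟩, hd⟩
  have key : ∀ A (hA : A ⊆ eF H), A.Nonempty → subOf H A hA ≠ ⊤ →
      #A * (Fintype.card V - 1) < #(eF H) * (#(vs A) - 1) := by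
    intro A hA hAne htop
    have h3 := h2 A hA hAne
    have hvc : (subOf H A hA).verts.ncard = #(vs A) := Set.ncard_coe_finset _
    have h4 := hbal (subOf H A hA) (by rw [hvc]; exact h3) htop
    rw [hvc, subOf_edge, Set.ncard_coe_finset, eF_card] at h4
    have e1 : (1:ℝ) < #(vs A) := by exact_mod_cast h3
    have e2 : (2:ℝ) ≤ Fintype.card V := by exact_mod_cast hV
    rw [div_lt_div_iff₀ (by linarith) (by linarith)] at h4
    have e3 : ((#A * (Fintype.card V - 1) : ℕ) : ℝ) < ((#(eF H) * (#(vs A) - 1) : ℕ) : ℝ) := by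
      rw [Nat.cast_mul, Nat.cast_mul, Nat.cast_sub (by omega), Nat.cast_sub (by omega)]
      simpa using h4
    exact_mod_cast e3
  refine ⟨hnd, hne, ?_, ?_⟩
  · by_contra hcon
    have h3 := key (eF H) (Finset.Subset.refl _) hne (by
      intro h
      apply hcon
      have : (subOf H (eF H) (Finset.Subset.refl _)).verts = Set.univ := by
        rw [h]; rfl
      have h' : (vs (eF H) : Set V) = Set.univ := this
      exact_mod_cast h')
    have h4 := Finset.card_le_univ (vs (eF H))
    have h5 := Nat.lt_of_mul_lt_mul_left h3
    omega
  · intro A hA hAne hneq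
    refine key A hA hAne ?_
    intro h
    apply hneq
    have h1 := subOf_edge H A hA
    rw [h, SimpleGraph.Subgraph.edgeSet_top] at h1
    ext a
    rw [mem_eF, h1, Finset.mem_coe]

lemma m1_eq {H : SimpleGraph V} (hV : 2 ≤ Fintype.card V) (hbal : StrictlyOneBalanced H) :
    m1 H = (#(eF H) : ℝ) / ((Fintype.card V - 1 : ℕ) : ℝ) := by
  rw [Nat.cast_sub (by omega), Nat.cast_one]
  unfold m1
  apply IsGreatest.csSup_eq
  have htop : ((⊤ : H.Subgraph).edgeSet.ncard : ℝ) / (((⊤ : H.Subgraph).verts.ncard : ℝ) - 1) =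
      (#(eF H) : ℝ) / ((Fintype.card V : ℝ) - 1) := by
    rw [SimpleGraph.Subgraph.edgeSet_top, SimpleGraph.Subgraph.verts_top, Set.ncard_univ,
      Nat.card_eq_fintype_card, eF_card]
  constructor
  · refine ⟨⊤, ?_, htop.symm⟩
    rw [SimpleGraph.Subgraph.verts_top, Set.ncard_univ, Nat.card_eq_fintype_card]
    omega
  · rintro x ⟨H', h1, rfl⟩
    by_cases h : H' = ⊤
    · rw [h, htop]
    · have := (hbal H' h1 h).le
      rwa [eF_card] at this

lemma thr_eq (e d : ℕ) (he : 0 < e) (hd : 0 < d) (p : ℝ) (n : ℕ) (hn : 2 ≤ n) :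
    (p * (n:ℝ) ^ (1 / ((e:ℝ) / (d:ℝ))) / Real.log n ^ (1 / (e:ℝ))) ^ e =
      p ^ e * (n:ℝ) ^ d / Real.log n := by
  have hn0 : (0:ℝ) ≤ n := by positivity
  have hl : 0 < Real.log n := Real.log_pos (by exact_mod_cast hn)
  have he' : (e:ℝ) ≠ 0 := by positivity
  have hd' : (d:ℝ) ≠ 0 := by positivity
  rw [div_pow, mul_pow, ← Real.rpow_natCast ((n:ℝ) ^ _) e, ← Real.rpow_mul hn0,
    ← Real.rpow_natCast (Real.log n ^ _) e, ← Real.rpow_mul hl.le]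
  rw [show 1 / ((e:ℝ) / d) * e = d by field_simp, show 1 / (e:ℝ) * e = 1 by field_simp,
    Real.rpow_one, Real.rpow_natCast]

end Densities


/-- **Johansson–Kahn–Vu theorem.** For a strictly 1-balanced graph `H`,
`(log n)^{1/e(H)} / n^{1/m₁(H)}` is a threshold for `G(n,p)` to contain an `H`-factor. -/
theorem stmt_6 {V : Type} [Fintype V] (H : SimpleGraph V)
    (hV : 2 ≤ Fintype.card V) (hE : H.edgeSet.Nonempty) (hbal : StrictlyOneBalanced H)
    (p : ℕ → ℝ) (hp : ∀ n, 0 ≤ p n ∧ p n ≤ 1) :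
    (Tendsto (fun n : ℕ =>
        p n * (n : ℝ) ^ (1 / m1 H) / Real.log n ^ (1 / (H.edgeSet.ncard : ℝ)))
        atTop (𝓝 0) →
      Tendsto (fun n : ℕ => gnp n (p n) {ω | HasFactor H (graphOf ω)}) atTop (𝓝 0)) ∧
    (Tendsto (fun n : ℕ =>
        p n * (n : ℝ) ^ (1 / m1 H) / Real.log n ^ (1 / (H.edgeSet.ncard : ℝ)))
        atTop atTop →
      Tendsto (fun n : ℕ => gnp n (p n) {ω | HasFactor H (graphOf ω)}) atTop (𝓝 1)) := by
  classical
  have hB := bal_of hV hE hbal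
  have hm := m1_eq hV hbal
  have he : 0 < (eF H).card := Finset.card_pos.2 hB.ne
  have hd : 0 < Fintype.card V - 1 := by omega
  rw [hm, eF_card]
  have hgnp : ∀ n, gnp n (p n) {ω | HasFactor H (graphOf ω)} = ENNReal.ofReal
      (Ex (Finset.univ : Finset (Sym2 (Fin n))) (p n) (fun A => ind (HasFactor H (gOf A)))) :=
    fun n => gnp_eq (hp n).1 (hp n).2 (fun G => HasFactor H G)
  simp only [hgnp]
  have hev : ∀ᶠ n : ℕ in atTop, (p n * (n : ℝ) ^ (1 / (((eF H).card : ℝ) /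
      ((Fintype.card V - 1 : ℕ) : ℝ))) / Real.log n ^ (1 / ((eF H).card : ℝ))) ^ (eF H).card =
      p n ^ (eF H).card * (n : ℝ) ^ (Fintype.card V - 1) / Real.log n := by
    filter_upwards [eventually_ge_atTop 2] with n hn
    exact thr_eq _ _ he hd (p n) n hn
  constructor
  · intro h
    have h1 := h.pow (eF H).card
    rw [zero_pow he.ne'] at h1
    have h2 := zero_stmt hB (fun u v h => mem_eF.1 h) hp (h1.congr' hev)
    have h3 := ENNReal.tendsto_ofReal h2
    rwa [ENNReal.ofReal_zero] at h3
  · intro h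
    have h1 := (tendsto_pow_atTop he.ne').comp h
    have h2 := one_stmt hB (fun u v h => mem_eF.2 h) hp (h1.congr' hev)
    have h4 : Tendsto (fun n : ℕ => Ex (Finset.univ : Finset (Sym2 (Fin n))) (p n)
        (fun A => ind (HasFactor H (gOf A)))) atTop (𝓝 1) := by
      have h5 := h2.const_sub 1
      rw [sub_zero] at h5
      refine h5.congr fun n => ?_
      rw [Ex_ind_not]; ring
    have h3 := ENNReal.tendsto_ofReal h4
    rwa [ENNReal.ofReal_one] at h3
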